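/- Let q ≥ 23 be a prime power. Then μ_q = q^4 + q^3 + (1/2)q^2 + (1/2)q if q ≡ 1 (mod 6); μ_q = q^4 + q^3 + (1/2)q^2 − (3/2)q − 1 if q ≡ 2 (mod 6); μ_q = q^4 + q^3 + (1/2)q^2 − 1/2 if q ≡ 3 (mod 6); μ_q = q^4 + q^3 + (1/2)q^2 − (1/2)q − 1 if q ≡ 4 (mod 6); and μ_q = q^4 + q^3 + (1/2)q^2 − (1/2)q if q ≡ 5 (mod 6). -/

import Mathlib

open Submodule Module

noncomputable section

variable (F : Type) [Field F]

/-- The points of the twisted cubic `C₃(q)` in `P³(F_q)`, viewed as 1-dimensional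
subspaces of `F_q⁴`: the points `(t³ : t² : t : 1)` for `t ∈ F_q` together with
`(1 : 0 : 0 : 0)`. -/
def cubicPts : Set (Submodule F (Fin 4 → F)) :=
  {P | (∃ t : F, P = span F {![t ^ 3, t ^ 2, t, 1]}) ∨ P = span F {![1, 0, 0, 0]}}

/-- The points of the twisted cubic lying on a given subspace `W`. -/
def ptsOn (W : Submodule F (Fin 4 → F)) : Set (Submodule F (Fin 4 → F)) :=
  {P | P ∈ cubicPts F ∧ P ≤ W}

/-- A 3-plane: a plane of `P³(F_q)` containing exactly three points of `C₃(q)`. -/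
def IsThreePlane (W : Submodule F (Fin 4 → F)) : Prop :=
  finrank F W = 3 ∧ (ptsOn F W).ncard = 3

/-- A real chord: a line containing two distinct points of `C₃(q)`. -/
def IsRealChord (L : Submodule F (Fin 4 → F)) : Prop :=
  finrank F L = 2 ∧ ∃ P Q, P ∈ cubicPts F ∧ Q ∈ cubicPts F ∧ P ≠ Q ∧ P ≤ L ∧ Q ≤ L

/-- The set of lines of `P³(F_q)` that are not real chords and are contained in at
least one 3-plane; `μ_q` is its cardinality. -/
def muSet : Set (Submodule F (Fin 4 → F)) :=
  {L | finrank F L = 2 ∧ ¬ IsRealChord F L ∧ ∃ W, IsThreePlane F W ∧ L ≤ W}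

/-- A tangent line of the twisted cubic: at `(t³ : t² : t : 1)` the line spanned by
`(t³, t², t, 1)` and `(3t², 2t, 1, 0)`, and at `(1:0:0:0)` the line spanned by
`(1,0,0,0)` and `(0,0,1,0)`. -/
def IsTangentLine (L : Submodule F (Fin 4 → F)) : Prop :=
  (∃ t : F, L = span F {![t ^ 3, t ^ 2, t, 1], ![3 * t ^ 2, 2 * t, 1, 0]}) ∨
    L = span F {![1, 0, 0, 0], ![0, 0, 1, 0]}

/-- Extension of scalars of a vector of `F⁴` to `E⁴`. -/
def extVec (E : Type) [Field E] [Algebra F E] (v : Fin 4 → F) : Fin 4 → E :=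
  fun i => algebraMap F E (v i)

/-- An imaginary chord: a line `L` of `P³(F_q)` such that the `F_{q²}`-span of `L`
contains the vector `(ξ³, ξ², ξ, 1)` for some `ξ ∈ F_{q²} ∖ F_q`. -/
def IsImagChord (E : Type) [Field E] [Algebra F E] (L : Submodule F (Fin 4 → F)) : Prop :=
  finrank F L = 2 ∧ ∃ ξ : E, ξ ∉ Set.range (algebraMap F E) ∧
    (![ξ ^ 3, ξ ^ 2, ξ, 1]) ∈ span E (extVec F E '' (L : Set (Fin 4 → F)))

/-- The linear form `X₀ − 3t X₁ + 3t² X₂ − t³ X₃` defining the osculating plane at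
`(t³ : t² : t : 1)`. -/
def oscForm (t : F) : (Fin 4 → F) →ₗ[F] F :=
  (LinearMap.proj 0 : (Fin 4 → F) →ₗ[F] F) - (3 * t) • (LinearMap.proj 1 : (Fin 4 → F) →ₗ[F] F)
    + (3 * t ^ 2) • (LinearMap.proj 2 : (Fin 4 → F) →ₗ[F] F)
    - t ^ 3 • (LinearMap.proj 3 : (Fin 4 → F) →ₗ[F] F)

/-- The osculating planes of the twisted cubic, indexed by `F ∪ {∞}` (`none = ∞`,
where the osculating plane is `X₃ = 0`). -/
def oscPlane : Option F → Submodule F (Fin 4 → F)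
  | some t => LinearMap.ker (oscForm F t)
  | none => LinearMap.ker (LinearMap.proj 3 : (Fin 4 → F) →ₗ[F] F)

namespace TC

open Polynomial

theorem manin_core {F : Type} [Field F] (q : ℕ) (hq : 23 ≤ q)
    (k2 k1 k0 h2 h1 h0 A B : F[X])
    (dk2 : k2.natDegree ≤ 2) (dk1 : k1.natDegree ≤ 2) (dk0 : k0.natDegree ≤ 2)
    (dh2 : h2.natDegree ≤ 2) (dh1 : h1.natDegree ≤ 2) (dh0 : h0.natDegree ≤ 2)
    (dA : A.natDegree ≤ 12) (dB : B.natDegree ≤ 12) (hcop : IsCoprime A B) (hB : B ≠ 0)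
    (hG : k2 * X ^ 2 + k1 * X + k0 ≠ 0)
    (hrel : (X ^ q - X) ^ 2 * A ^ 2 + (k2 * (X ^ q) ^ 2 + k1 * X ^ q + k0) * (A * B)
      + (h2 * (X ^ q) ^ 2 + h1 * X ^ q + h0) * B ^ 2 = 0) :
    A ^ 2 + k2 * (A * B) + h2 * B ^ 2 = 0 ∧
    -2 * X * A ^ 2 + k1 * (A * B) + h1 * B ^ 2 = 0 ∧
    X ^ 2 * A ^ 2 + k0 * (A * B) + h0 * B ^ 2 = 0 := by
  obtain ⟨d, hd, hAd, hBd, hdm⟩ : ∃ d, d ≤ 12 ∧ A.natDegree ≤ d ∧ B.natDegree ≤ d ∧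
      (d = A.natDegree ∨ d = B.natDegree) :=
    ⟨max A.natDegree B.natDegree, max_le dA dB, le_max_left _ _, le_max_right _ _, by
      rcases max_choice A.natDegree B.natDegree with h | h <;> simp [h]⟩
  obtain ⟨c2, hc2⟩ : ∃ c2, c2 = A ^ 2 + k2 * (A * B) + h2 * B ^ 2 := ⟨_, rfl⟩
  obtain ⟨c1, hc1⟩ : ∃ c1, c1 = -2 * X * A ^ 2 + k1 * (A * B) + h1 * B ^ 2 := ⟨_, rfl⟩
  obtain ⟨c0, hc0⟩ : ∃ c0, c0 = X ^ 2 * A ^ 2 + k0 * (A * B) + h0 * B ^ 2 := ⟨_, rfl⟩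
  have hX1 : (X : F[X]).natDegree ≤ 1 := natDegree_X_le
  have hA2 : (A ^ 2).natDegree ≤ 2 * d := natDegree_pow_le.trans (by omega)
  have hB2 : (B ^ 2).natDegree ≤ 2 * d := natDegree_pow_le.trans (by omega)
  have hAB : (A * B).natDegree ≤ 2 * d := natDegree_mul_le.trans (by omega)
  have mulb : ∀ (u v : F[X]) (m n k : ℕ), u.natDegree ≤ m → v.natDegree ≤ n → m + n ≤ k →
      (u * v).natDegree ≤ k := fun u v m n k hu hv h => natDegree_mul_le.trans (by omega)
  have addb : ∀ (u v : F[X]) (k : ℕ), u.natDegree ≤ k → v.natDegree ≤ k →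
      (u + v).natDegree ≤ k := fun u v k hu hv => natDegree_add_le_of_degree_le hu hv
  have X2 : (X ^ 2 : F[X]).natDegree ≤ 2 := natDegree_X_pow_le 2
  have m2X : (-2 * X : F[X]).natDegree ≤ 2 := by
    refine mulb _ _ 0 1 2 ?_ hX1 (by omega)
    have : (-2 : F[X]) = C (-2) := by rw [map_neg, map_ofNat]
    rw [this, natDegree_C]
  have dc2 : c2.natDegree ≤ 2 * d + 2 := by
    rw [hc2]
    exact addb _ _ _ (addb _ _ _ (by omega) (mulb _ _ _ _ _ dk2 hAB (by omega)))
      (mulb _ _ _ _ _ dh2 hB2 (by omega))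
  have dc1 : c1.natDegree ≤ 2 * d + 2 := by
    rw [hc1]
    exact addb _ _ _ (addb _ _ _ (mulb _ _ _ _ _ m2X hA2 (by omega))
      (mulb _ _ _ _ _ dk1 hAB (by omega))) (mulb _ _ _ _ _ dh1 hB2 (by omega))
  have dc0 : c0.natDegree ≤ 2 * d + 2 := by
    rw [hc0]
    exact addb _ _ _ (addb _ _ _ (mulb _ _ _ _ _ X2 hA2 (by omega))
      (mulb _ _ _ _ _ dk0 hAB (by omega))) (mulb _ _ _ _ _ dh0 hB2 (by omega))
  have hr : c2 * (X ^ q) ^ 2 + c1 * X ^ q + c0 = 0 := by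
    rw [hc2, hc1, hc0]; linear_combination hrel
  rw [← hc2, ← hc1, ← hc0]
  obtain ⟨e, he⟩ : ∃ e, e = -(c1 + c2 * X ^ q) := ⟨_, rfl⟩
  have he0 : c0 = e * X ^ q := by rw [he]; linear_combination hr
  have he1 : c2 * X ^ q = -(c1 + e) := by rw [he]; ring
  have key : ∀ u : F[X], (u * X ^ q).natDegree ≤ 2 * d + 2 → u = 0 ∨ u.natDegree + q ≤ 2 * d + 2 := by
    intro u hu
    by_cases h : u = 0
    · exact Or.inl h
    · right; rwa [natDegree_mul_X_pow _ h] at hu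
  have de := key e (by rw [← he0]; exact dc0)
  have de' : e.natDegree ≤ 2 * d + 2 := by
    rcases de with h | h
    · simp [h]
    · omega
  have dc2' := key c2 (by rw [he1, natDegree_neg]; exact addb _ _ _ dc1 de')
  have fin : e = 0 → c2 = 0 → c2 = 0 ∧ c1 = 0 ∧ c0 = 0 := by
    intro g1 g2
    refine ⟨g2, ?_, ?_⟩
    · have := he1; rw [g1, g2] at this; linear_combination this
    · rw [he0, g1, zero_mul]
  by_cases hdd : d ≤ 8
  · apply fin
    · rcases de with h | h
      · exact h
      · omega
    · rcases dc2' with h | h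
      · exact h
      · omega
  by_cases hne : e = 0 ∧ c2 = 0
  · exact fin hne.1 hne.2
  exfalso
  have e3 : e.natDegree ≤ 3 := by
    rcases de with h | h
    · simp [h]
    · omega
  have c3 : c2.natDegree ≤ 3 := by
    rcases dc2' with h | h
    · simp [h]
    · omega
  have rel2 : (e - X * c2) ^ 2 * A ^ 2 + (k2 * e ^ 2 + k1 * (e * c2) + k0 * c2 ^ 2) * (A * B)
      + (h2 * e ^ 2 + h1 * (e * c2) + h0 * c2 ^ 2) * B ^ 2 = 0 := by
    have g1 : c1 = - e - c2 * X ^ q := by rw [he]; ring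
    have : c2 * e ^ 2 + c1 * (e * c2) + c0 * c2 ^ 2 = 0 := by rw [g1, he0]; ring
    linear_combination this - e ^ 2 * hc2 - e * c2 * hc1 - c2 ^ 2 * hc0
  obtain ⟨l2, hl2⟩ : ∃ l, l = (e - X * c2) ^ 2 := ⟨_, rfl⟩
  obtain ⟨l1, hl1⟩ : ∃ l, l = (k2 * e ^ 2 + k1 * (e * c2) + k0 * c2 ^ 2) := ⟨_, rfl⟩
  obtain ⟨l0, hl0⟩ : ∃ l, l = (h2 * e ^ 2 + h1 * (e * c2) + h0 * c2 ^ 2) := ⟨_, rfl⟩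
  rw [← hl2, ← hl1, ← hl0] at rel2
  have ee : (e ^ 2).natDegree ≤ 6 := natDegree_pow_le.trans (by omega)
  have cc : (c2 ^ 2).natDegree ≤ 6 := natDegree_pow_le.trans (by omega)
  have ec : (e * c2).natDegree ≤ 6 := mulb _ _ _ _ _ e3 c3 (by omega)
  have dl2 : l2.natDegree ≤ 8 := by
    rw [hl2]; refine natDegree_pow_le.trans ?_
    have : (e - X * c2).natDegree ≤ 4 := by
      rw [sub_eq_add_neg]
      refine addb _ _ _ (by omega) ?_
      rw [natDegree_neg]; exact mulb _ _ _ _ _ hX1 c3 (by omega)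
    omega
  have dl1 : l1.natDegree ≤ 8 := by
    rw [hl1]
    exact addb _ _ _ (addb _ _ _ (mulb _ _ _ _ _ dk2 ee (by omega))
      (mulb _ _ _ _ _ dk1 ec (by omega))) (mulb _ _ _ _ _ dk0 cc (by omega))
  have dl0 : l0.natDegree ≤ 8 := by
    rw [hl0]
    exact addb _ _ _ (addb _ _ _ (mulb _ _ _ _ _ dh2 ee (by omega))
      (mulb _ _ _ _ _ dh1 ec (by omega))) (mulb _ _ _ _ _ dh0 cc (by omega))
  have small : ∀ (u v : F[X]) (k : ℕ), v ∣ u → u.natDegree ≤ k → k < v.natDegree → u = 0 := by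
    intro u v k h1 h2 h3
    by_contra h
    have := natDegree_le_of_dvd h1 h
    omega
  have hBl2 : B ∣ l2 := by
    have h1 : B ∣ l2 * A ^ 2 := ⟨-(l1 * A + l0 * B), by linear_combination rel2⟩
    exact (hcop.symm.pow_right).dvd_of_dvd_mul_right h1
  have hAl0 : A ∣ l0 := by
    have h1 : A ∣ l0 * B ^ 2 := ⟨-(l1 * B + l2 * A), by linear_combination rel2⟩
    exact (hcop.pow_right).dvd_of_dvd_mul_right h1
  by_cases hl20 : l2 = 0
  · -- e = X c2
    have hex : e = X * c2 := by
      rw [hl2] at hl20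
      exact sub_eq_zero.mp (pow_eq_zero_iff (two_ne_zero) |>.mp hl20)
    have hc20 : c2 ≠ 0 := by
      intro h; apply hne; exact ⟨by rw [hex, h, mul_zero], h⟩
    have r3 : (k2 * X ^ 2 + k1 * X + k0) * A + (h2 * X ^ 2 + h1 * X + h0) * B = 0 := by
      have : (c2 ^ 2 * B) * ((k2 * X ^ 2 + k1 * X + k0) * A + (h2 * X ^ 2 + h1 * X + h0) * B) = 0 := by
        rw [hl20, hl1, hl0, hex] at rel2
        linear_combination rel2
      exact (mul_eq_zero.mp this).resolve_left (mul_ne_zero (pow_ne_zero _ hc20) hB)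
    have dG : (k2 * X ^ 2 + k1 * X + k0).natDegree ≤ 4 :=
      addb _ _ _ (addb _ _ _ (mulb _ _ _ _ _ dk2 X2 (by omega)) (mulb _ _ _ _ _ dk1 hX1 (by omega))) (by omega)
    have dH : (h2 * X ^ 2 + h1 * X + h0).natDegree ≤ 4 :=
      addb _ _ _ (addb _ _ _ (mulb _ _ _ _ _ dh2 X2 (by omega)) (mulb _ _ _ _ _ dh1 hX1 (by omega))) (by omega)
    have b1 : B ∣ (k2 * X ^ 2 + k1 * X + k0) :=
      hcop.symm.dvd_of_dvd_mul_right ⟨-(h2 * X ^ 2 + h1 * X + h0), by linear_combination r3⟩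
    have a1 : A ∣ (h2 * X ^ 2 + h1 * X + h0) :=
      hcop.dvd_of_dvd_mul_right ⟨-(k2 * X ^ 2 + k1 * X + k0), by linear_combination r3⟩
    rcases hdm with h | h
    · have := small _ _ 4 a1 dH (by omega)
      rw [this, zero_mul, add_zero] at r3
      rcases mul_eq_zero.mp r3 with h' | h'
      · exact hG h'
      · rw [h'] at h; simp at h; omega
    · exact hG (small _ _ 4 b1 dG (by omega))
  · rcases hdm with h | h
    · have hz := small _ _ 8 hAl0 dl0 (by omega)
      rw [hz] at rel2
      have hA0 : A ≠ 0 := by intro h'; rw [h'] at h; simp at h; omega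
      have r3 : l2 * A + l1 * B = 0 := by
        have : A * (l2 * A + l1 * B) = 0 := by linear_combination rel2
        exact (mul_eq_zero.mp this).resolve_left hA0
      have a1 : A ∣ l1 := hcop.dvd_of_dvd_mul_right ⟨-l2, by linear_combination r3⟩
      have := small _ _ 8 a1 dl1 (by omega)
      rw [this, zero_mul, add_zero] at r3
      exact (mul_ne_zero hl20 hA0) r3
    · exact hl20 (small _ _ 8 hBl2 dl2 (by omega))

end TC


namespace TC

open Polynomial

/-- recursion: `y ^ n = (yrec n).1 * y + (yrec n).2` when `y² + p y + c = 0` -/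
def yrec {R : Type} [CommRing R] (p c : R) : ℕ → R × R
  | 0 => (0, 1)
  | n + 1 => ((yrec p c n).2 - p * (yrec p c n).1, - c * (yrec p c n).1)

theorem yrec_pow {R : Type} [CommRing R] (p c y : R) (h : y ^ 2 + p * y + c = 0) (n : ℕ) :
    y ^ n = (yrec p c n).1 * y + (yrec p c n).2 := by
  induction n with
  | zero => simp [yrec]
  | succ n ih =>
    rw [pow_succ, ih]; simp only [yrec]
    linear_combination (yrec p c n).1 * h

theorem yrec_norm {R : Type} [CommRing R] (p c : R) (n : ℕ) :
    (yrec p c n).1 ^ 2 * c - (yrec p c n).1 * (yrec p c n).2 * p + (yrec p c n).2 ^ 2 = c ^ n := by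
  induction n with
  | zero => simp [yrec]
  | succ n ih =>
    rw [pow_succ c, ← ih]; simp only [yrec]; ring

theorem yrec_map {R S : Type} [CommRing R] [CommRing S] (f : R →+* S) (p c : R) (n : ℕ) :
    yrec (f p) (f c) n = (f (yrec p c n).1, f (yrec p c n).2) := by
  induction n with
  | zero => simp [yrec]
  | succ n ih => simp [yrec, ih]

theorem exists_quad_root {K : Type} [Field K] [IsAlgClosed K] (p c : K) :
    ∃ y : K, y ^ 2 + p * y + c = 0 := by
  obtain ⟨y, hy⟩ := IsAlgClosed.exists_root (C 1 * X ^ 2 + C p * X + C c : K[X])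
    (by rw [degree_quadratic one_ne_zero]; norm_num)
  refine ⟨y, ?_⟩
  simpa [IsRoot] using hy

theorem yrec_trace {F : Type} [Field F] [Fintype F] (P Q : F[X]) :
    2 * (yrec P Q (Fintype.card F)).2 - P * (yrec P Q (Fintype.card F)).1
      = - P ^ (Fintype.card F) := by
  obtain ⟨p, hp⟩ := CharP.exists F
  obtain ⟨n, hpp, hn⟩ := FiniteField.card F p
  have : Fact p.Prime := ⟨hpp⟩
  let K := AlgebraicClosure (FractionRing F[X])
  let f : F[X] →+* K := algebraMap F[X] K
  have hf : Function.Injective f := by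
    have h : f = (algebraMap (FractionRing F[X]) K).comp (algebraMap F[X] (FractionRing F[X])) :=
      IsScalarTower.algebraMap_eq _ _ _
    rw [h]
    exact (algebraMap (FractionRing F[X]) K).injective.comp (IsFractionRing.injective _ _)
  have : CharP K p := (RingHom.charP_iff (f.comp C) (hf.comp C_injective) p).mp hp
  obtain ⟨y, hy⟩ := exists_quad_root (f P) (f Q)
  have hy' : (- f P - y) ^ 2 + f P * (- f P - y) + f Q = 0 := by linear_combination hy
  have e1 := yrec_pow _ _ _ hy (Fintype.card F)
  have e2 := yrec_pow _ _ _ hy' (Fintype.card F)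
  have e3 : (y + (- f P - y)) ^ (Fintype.card F) = y ^ (Fintype.card F) + (- f P - y) ^ (Fintype.card F) := by
    rw [hn]; exact add_pow_char_pow _ _ p n
  have e4 : (- f P) ^ (Fintype.card F) = - (f P) ^ (Fintype.card F) := by
    have h0 : (f P + - f P) ^ (Fintype.card F) = (f P) ^ (Fintype.card F) + (- f P) ^ (Fintype.card F) := by
      rw [hn]; exact add_pow_char_pow _ _ p n
    rw [add_neg_cancel, zero_pow Fintype.card_ne_zero] at h0
    linear_combination - h0
  rw [yrec_map] at e1 e2
  simp only at e1 e2
  apply hf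
  rw [map_sub, map_mul, map_mul, map_neg, map_pow, map_ofNat, ← e4]
  have : y + (- f P - y) = - f P := by ring
  rw [this] at e3
  rw [e3, e1, e2]; ring

/-- local weights -/
noncomputable def wt {F : Type} [Field F] (p c : F) : ℕ :=
  open Classical in if p ^ 2 = 4 * c then 1 else if ∃ z, z ^ 2 + p * z + c = 0 then 2 else 0

theorem prod_X_sub {F : Type} [Field F] [Fintype F] :
    (∏ a : F, (X - C a)) = (X ^ Fintype.card F - X : F[X]) := by
  have h1 := FiniteField.roots_X_pow_card_sub_X F
  have hm : (X ^ Fintype.card F - X : F[X]).Monic :=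
    monic_X_pow_sub (by rw [degree_X]; exact_mod_cast Fintype.one_lt_card)
  have hd : (X ^ Fintype.card F - X : F[X]).natDegree = Fintype.card F :=
    FiniteField.X_pow_card_sub_X_natDegree_eq _ Fintype.one_lt_card
  have := prod_multiset_X_sub_C_of_monic_of_roots_card_eq hm (by rw [h1, hd]; rfl)
  rw [h1] at this
  exact this

theorem mem_of_pow_card {F : Type} [Field F] [Fintype F] {K : Type} [Field K] [Algebra F K] (y : K)
    (h : y ^ Fintype.card F = y) : ∃ x : F, algebraMap F K x = y := by
  have h0 : (∏ a : F, (X - C a)) = (X ^ Fintype.card F - X : F[X]) := prod_X_sub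
  have h2 : eval₂ (algebraMap F K) y (X ^ Fintype.card F - X : F[X]) = 0 := by
    simp [h]
  rw [← h0, eval₂_finsetProd, Finset.prod_eq_zero_iff] at h2
  obtain ⟨a, -, ha⟩ := h2
  simp only [eval₂_sub, eval₂_X, eval₂_C, sub_eq_zero] at ha
  exact ⟨a, ha.symm⟩

theorem local_val {F : Type} [Field F] [Fintype F] (p c : F) (h : wt p c ≠ 2) :
    (yrec p c (Fintype.card F)).1 * (p ^ 2 - 2 * c) - (yrec p c (Fintype.card F)).2 * p = 2 * c := by
  have hN := yrec_norm p c (Fintype.card F)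
  have hT : 2 * (yrec p c (Fintype.card F)).2 - p * (yrec p c (Fintype.card F)).1 = - p := by
    have h1 := yrec_trace (C p) (C c)
    rw [yrec_map] at h1
    have h2 := congrArg (eval 0) h1
    simpa [FiniteField.pow_card] using h2
  rw [FiniteField.pow_card] at hN
  by_cases hb : p ^ 2 = 4 * c
  · have : ((yrec p c (Fintype.card F)).1 * (p ^ 2 - 2 * c) - (yrec p c (Fintype.card F)).2 * p - 2 * c) ^ 2 = 0 := by
      generalize (yrec p c (Fintype.card F)).1 = a at *
      generalize (yrec p c (Fintype.card F)).2 = b at *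
      have key : (a * (p ^ 2 - 2 * c) - b * p) ^ 2 - p ^ 2 * (a * (p ^ 2 - 2 * c) - b * p) + 2 * c * p ^ 2 - 4 * c ^ 2 = 0 := by
        have hp : p = p * a - 2 * b := by linear_combination hT
        have e2 : (a * (p ^ 2 - 2 * c) - b * p) ^ 2 - (p * a - 2 * b) * p * (a * (p ^ 2 - 2 * c) - b * p)
          + c * (p * a - 2 * b) ^ 2 + (a ^ 2 * c - a * b * p + b ^ 2) * p ^ 2 - 4 * (a ^ 2 * c - a * b * p + b ^ 2) * c = 0 := by ring
        rw [← hp, hN] at e2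
        linear_combination e2
      linear_combination key + (a * (p ^ 2 - 2 * c) - b * p - 2 * c) * hb
    exact sub_eq_zero.mp (pow_eq_zero_iff two_ne_zero |>.mp this)
  · have hno : ¬ ∃ z, z ^ 2 + p * z + c = 0 := by
      intro hz; apply h; simp [wt, hb, hz]
    let K := AlgebraicClosure F
    let f : F →+* K := algebraMap F K
    obtain ⟨y, hy⟩ := exists_quad_root (f p) (f c)
    have hyF : ∀ x : F, f x ≠ y := by
      intro x hx; apply hno; refine ⟨x, f.injective ?_⟩
      simp only [map_add, map_mul, map_pow, map_zero, hx]; exact hy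
    have e1 := yrec_pow _ _ _ hy (Fintype.card F)
    rw [yrec_map] at e1
    simp only at e1
    have e2 : (y ^ Fintype.card F) ^ 2 + f p * y ^ Fintype.card F + f c = 0 := by
      have h2 := congrArg (fun z => (FiniteField.frobeniusAlgHom F K) z) hy
      simp only [map_add, map_mul, map_pow, map_zero] at h2
      have hp : FiniteField.frobeniusAlgHom F K (f p) = f p := AlgHom.commutes _ _
      have hc : FiniteField.frobeniusAlgHom F K (f c) = f c := AlgHom.commutes _ _
      rw [hp, hc] at h2
      simpa [FiniteField.coe_frobeniusAlgHom] using h2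
    have e3 : (y ^ Fintype.card F - y) * (y ^ Fintype.card F + y + f p) = 0 := by
      linear_combination e2 - hy
    rcases mul_eq_zero.mp e3 with e | e
    · obtain ⟨x, hx⟩ := mem_of_pow_card y (sub_eq_zero.mp e)
      exact absurd hx (hyF x)
    · generalize (yrec p c (Fintype.card F)).1 = a at *
      generalize (yrec p c (Fintype.card F)).2 = b at *
      have e5 : f (a + 1) * y + f (b + p) = 0 := by
        simp only [map_add, map_one]; linear_combination e - e1
      by_cases ha : a + 1 = 0
      · rw [ha, map_zero, zero_mul, zero_add] at e5
        have hbp : b + p = 0 := (map_eq_zero f).mp e5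
        linear_combination (p ^ 2 - 2 * c) * ha - p * hbp
      · exfalso
        apply hyF (-(b + p) / (a + 1))
        rw [map_div₀, map_neg]
        have : f (a + 1) ≠ 0 := (map_ne_zero f).mpr ha
        rw [div_eq_iff this]
        linear_combination - e5

end TC


namespace TC

open Polynomial

theorem natDegree_mul_le' {R : Type} [CommRing R] {u v : R[X]} {m n : ℕ} (k : ℕ) (hu : u.natDegree ≤ m)
    (hv : v.natDegree ≤ n) (h : m + n ≤ k) : (u * v).natDegree ≤ k :=
  natDegree_mul_le.trans (by omega)

theorem yrec_deg {F : Type} [Field F] (P Q : F[X]) (hP : P.natDegree ≤ 2) (hQ : Q.natDegree ≤ 4)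
    (n : ℕ) :
    (X ^ 2 * (yrec P Q n).1).natDegree ≤ 2 * n ∧ (yrec P Q n).2.natDegree ≤ 2 * n ∧
    (X ^ 2 * (yrec P Q n).1).coeff (2 * n) = (yrec (P.coeff 2) (Q.coeff 4) n).1 ∧
    (yrec P Q n).2.coeff (2 * n) = (yrec (P.coeff 2) (Q.coeff 4) n).2 := by
  induction n with
  | zero => simp [yrec]
  | succ n ih =>
    obtain ⟨h1, h2, h3, h4⟩ := ih
    have e1 : X ^ 2 * (yrec P Q (n + 1)).1 = X ^ 2 * (yrec P Q n).2 - P * (X ^ 2 * (yrec P Q n).1) := by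
      simp only [yrec]; ring
    have e2 : X ^ 2 * (yrec P Q (n + 1)).2 = - (Q * (X ^ 2 * (yrec P Q n).1)) := by
      simp only [yrec]; ring
    have X2 : (X ^ 2 : F[X]).natDegree ≤ 2 := natDegree_X_pow_le 2
    have d2 : (X ^ 2 * (yrec P Q (n + 1)).2).natDegree ≤ 2 * n + 4 := by
      rw [e2, natDegree_neg]; exact natDegree_mul_le' _ hQ h1 (by omega)
    refine ⟨?_, ?_, ?_, ?_⟩
    · rw [e1]
      refine (natDegree_sub_le _ _).trans (max_le ?_ ?_)
      · exact natDegree_mul_le' _ X2 h2 (by omega)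
      · exact natDegree_mul_le' _ hP h1 (by omega)
    · by_cases h0 : (yrec P Q (n + 1)).2 = 0
      · rw [h0]; simp
      · rw [natDegree_X_pow_mul _ h0] at d2; omega
    · rw [e1, coeff_sub, show 2 * (n + 1) = 2 + 2 * n by ring, coeff_mul_add_eq_of_natDegree_le X2 h2,
        coeff_mul_add_eq_of_natDegree_le hP h1, h3, h4]
      simp [yrec]
    · have : (yrec P Q (n + 1)).2.coeff (2 * (n + 1)) = (X ^ 2 * (yrec P Q (n + 1)).2).coeff (4 + 2 * n) := by
        rw [show 4 + 2 * n = 2 * (n + 1) + 2 by ring, coeff_X_pow_mul]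
      rw [this, e2, coeff_neg, coeff_mul_add_eq_of_natDegree_le hQ h1, h3]
      simp [yrec]

/-- quadratic and quartic polynomials from coefficients -/
noncomputable def qd {R : Type} [CommRing R] (p2 p1 p0 : R) : R[X] := C p2 * X ^ 2 + C p1 * X + C p0
noncomputable def qt {R : Type} [CommRing R] (q4 q3 q2 q1 q0 : R) : R[X] :=
  C q4 * X ^ 4 + C q3 * X ^ 3 + C q2 * X ^ 2 + C q1 * X + C q0

theorem qd_deg {R : Type} [CommRing R] (p2 p1 p0 : R) : (qd p2 p1 p0).natDegree ≤ 2 := natDegree_quadratic_le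
theorem qt_deg {R : Type} [CommRing R] (q4 q3 q2 q1 q0 : R) : (qt q4 q3 q2 q1 q0).natDegree ≤ 4 := by
  unfold qt; compute_degree
theorem qd_coeff {R : Type} [CommRing R] (p2 p1 p0 : R) : (qd p2 p1 p0).coeff 2 = p2 := by
  unfold qd; simp
theorem qt_coeff {R : Type} [CommRing R] (q4 q3 q2 q1 q0 : R) : (qt q4 q3 q2 q1 q0).coeff 4 = q4 := by
  unfold qt; simp [coeff_X_pow]

def Th {R : Type} [CommRing R] (q4 q3 q2 q1 q0 s t : R) : R :=
  2 * q4 * s ^ 2 * t ^ 2 + q3 * s * t * (s + t) + 2 * q2 * s * t + q1 * (s + t) + 2 * q0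

def Hh {R : Type} [CommRing R] (p2 p1 p0 q4 q3 q2 q1 q0 s t : R) : R :=
  (-p1*p2*q3+p1^2*q4+p2^2*q2-4*q2*q4+q3^2) * s^2*t^2
  + (2*p0*p1*q4-p0*p2*q3+p2^2*q1-4*q1*q4)*s*t*(s+t)
  + (p0^2*q4+p2^2*q0-4*q0*q4)*(s^2+t^2)
  + (p0*p1*q3-2*p0*p2*q2+2*p0^2*q4+p1*p2*q1+2*p2^2*q0-8*q0*q4-2*q1*q3)*s*t
  + (-p0*p2*q1+p0^2*q3+2*p1*p2*q0-4*q0*q3)*(s+t)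
  + (-p0*p1*q1+p0^2*q2+p1^2*q0-4*q0*q2+q1^2)

theorem Th_id {R : Type} [CommRing R] (p2 p1 p0 q4 q3 q2 q1 q0 s t : R) :
    (Th q4 q3 q2 q1 q0 s t) ^ 2 - (p2*s^2+p1*s+p0)*(p2*t^2+p1*t+p0) * Th q4 q3 q2 q1 q0 s t
     + ((q4*t^4+q3*t^3+q2*t^2+q1*t+q0)*(p2*s^2+p1*s+p0)^2 + (q4*s^4+q3*s^3+q2*s^2+q1*s+q0)*(p2*t^2+p1*t+p0)^2
       - 4 * (q4*s^4+q3*s^3+q2*s^2+q1*s+q0) * (q4*t^4+q3*t^3+q2*t^2+q1*t+q0))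
     = (s - t) ^ 2 * Hh p2 p1 p0 q4 q3 q2 q1 q0 s t := by
  unfold Th Hh; ring

end TC


namespace TC

open Polynomial

section
variable {F : Type} [Field F] [Fintype F] (p2 p1 p0 q4 q3 q2 q1 q0 : F)

noncomputable def maU : F[X] :=
  (yrec (qd p2 p1 p0) (qt q4 q3 q2 q1 q0) (Fintype.card F)).1
    * ((qd p2 p1 p0) ^ 2 - 2 * (qt q4 q3 q2 q1 q0))
  - (yrec (qd p2 p1 p0) (qt q4 q3 q2 q1 q0) (Fintype.card F)).2 * (qd p2 p1 p0)

noncomputable def maT : F[X] :=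
  Th (C q4) (C q3) (C q2) (C q1) (C q0) (X ^ Fintype.card F) X

noncomputable def maV : F[X] := maU p2 p1 p0 q4 q3 q2 q1 q0 - maT q4 q3 q2 q1 q0

noncomputable def maK : F[X] := 2 * maT q4 q3 q2 q1 q0 - (qd p2 p1 p0) ^ Fintype.card F * (qd p2 p1 p0)

noncomputable def maH : F[X] :=
  Hh (C p2) (C p1) (C p0) (C q4) (C q3) (C q2) (C q1) (C q0) (X ^ Fintype.card F) X

theorem qd_pow_card : (qd p2 p1 p0) ^ Fintype.card F =
    C p2 * (X ^ Fintype.card F) ^ 2 + C p1 * X ^ Fintype.card F + C p0 := by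
  rw [← FiniteField.expand_card]; unfold qd; simp

theorem qt_pow_card : (qt q4 q3 q2 q1 q0) ^ Fintype.card F =
    C q4 * (X ^ Fintype.card F) ^ 4 + C q3 * (X ^ Fintype.card F) ^ 3
      + C q2 * (X ^ Fintype.card F) ^ 2 + C q1 * X ^ Fintype.card F + C q0 := by
  rw [← FiniteField.expand_card]; unfold qt; simp

theorem maV_rel : maV p2 p1 p0 q4 q3 q2 q1 q0 ^ 2
    + maK p2 p1 p0 q4 q3 q2 q1 q0 * maV p2 p1 p0 q4 q3 q2 q1 q0
    + (X ^ Fintype.card F - X) ^ 2 * maH p2 p1 p0 q4 q3 q2 q1 q0 = 0 := by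
  have h := Th_id (C p2) (C p1) (C p0) (C q4) (C q3) (C q2) (C q1) (C q0) (X ^ Fintype.card F) X
  rw [← qd_pow_card, ← qt_pow_card] at h
  have hN := yrec_norm (qd p2 p1 p0) (qt q4 q3 q2 q1 q0) (Fintype.card F)
  have hT := yrec_trace (qd p2 p1 p0) (qt q4 q3 q2 q1 q0)
  unfold maV maK maH maT
  rw [← h]
  change _ + ((qt q4 q3 q2 q1 q0) * _ + _ * (qd p2 p1 p0) ^ 2 - 4 * _ * (qt q4 q3 q2 q1 q0)) = _ at h
  unfold maU
  change _ + (_ - _ * (qd p2 p1 p0) * _ + ((qt q4 q3 q2 q1 q0) * _ + _ * (qd p2 p1 p0) ^ 2 - 4 * _ * (qt q4 q3 q2 q1 q0))) = _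
  rw [← hN]
  have hP : (qd p2 p1 p0) ^ Fintype.card F = qd p2 p1 p0 * (yrec (qd p2 p1 p0) (qt q4 q3 q2 q1 q0) (Fintype.card F)).1
     - 2 * (yrec (qd p2 p1 p0) (qt q4 q3 q2 q1 q0) (Fintype.card F)).2 := by
    linear_combination hT
  rw [hP]
  ring

theorem eval_yrec (P Q : F[X]) (x : F) (n : ℕ) :
    eval x (yrec P Q n).1 = (yrec (eval x P) (eval x Q) n).1 ∧
    eval x (yrec P Q n).2 = (yrec (eval x P) (eval x Q) n).2 := by
  have h := yrec_map (evalRingHom x) P Q n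
  simp only [coe_evalRingHom] at h
  rw [h]; simp

theorem eval_maT (x : F) : eval x (maT q4 q3 q2 q1 q0) = 2 * eval x (qt q4 q3 q2 q1 q0) := by
  simp [maT, Th, qt, FiniteField.pow_card]; ring

theorem eval_maV (x : F) (h : wt (eval x (qd p2 p1 p0)) (eval x (qt q4 q3 q2 q1 q0)) ≠ 2) :
    eval x (maV p2 p1 p0 q4 q3 q2 q1 q0) = 0 := by
  have h1 := local_val _ _ h
  have h2 := eval_yrec (qd p2 p1 p0) (qt q4 q3 q2 q1 q0) x (Fintype.card F)
  rw [maV, eval_sub, eval_maT, maU]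
  simp only [eval_sub, eval_mul, eval_pow, eval_ofNat, h2]
  rw [h1, sub_self]

theorem wt_zero {p c : F} (h : wt p c = 0) : p ^ 2 ≠ 4 * c := by
  intro h'; simp [wt, h'] at h

theorem wt_le (p c : F) : wt p c ≤ 2 := by
  unfold wt; split_ifs <;> omega

theorem dvd_maV (x : F) :
    (X - C x) ^ (2 - wt (eval x (qd p2 p1 p0)) (eval x (qt q4 q3 q2 q1 q0)))
      ∣ maV p2 p1 p0 q4 q3 q2 q1 q0 := by
  by_cases h2 : wt (eval x (qd p2 p1 p0)) (eval x (qt q4 q3 q2 q1 q0)) = 2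
  · rw [h2]; simp
  have hd : X - C x ∣ maV p2 p1 p0 q4 q3 q2 q1 q0 := dvd_iff_isRoot.mpr (eval_maV _ _ _ _ _ _ _ _ x h2)
  by_cases h1 : wt (eval x (qd p2 p1 p0)) (eval x (qt q4 q3 q2 q1 q0)) = 1
  · rw [h1]; simpa using hd
  have h0 : wt (eval x (qd p2 p1 p0)) (eval x (qt q4 q3 q2 q1 q0)) = 0 := by
    have := wt_le (eval x (qd p2 p1 p0)) (eval x (qt q4 q3 q2 q1 q0)); omega
  rw [h0]
  have hr := maV_rel p2 p1 p0 q4 q3 q2 q1 q0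
  have hc : IsCoprime (X - C x) (maK p2 p1 p0 q4 q3 q2 q1 q0 + maV p2 p1 p0 q4 q3 q2 q1 q0) := by
    have hi : Irreducible (X - C x) := irreducible_X_sub_C x
    rw [hi.coprime_iff_not_dvd, dvd_iff_isRoot, IsRoot, eval_add, eval_maV _ _ _ _ _ _ _ _ x h2, maK,
      eval_sub, eval_mul, eval_maT, eval_mul, eval_pow, FiniteField.pow_card]
    intro h
    apply wt_zero h0
    simp only [eval_ofNat] at h
    linear_combination -h
  have hdv : (X - C x) ^ 2 ∣ maV p2 p1 p0 q4 q3 q2 q1 q0 *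
      (maK p2 p1 p0 q4 q3 q2 q1 q0 + maV p2 p1 p0 q4 q3 q2 q1 q0) := by
    have h3 : (X - C x) ∣ X ^ Fintype.card F - X := by
      rw [dvd_iff_isRoot]; simp [FiniteField.pow_card]
    obtain ⟨m, hm⟩ := pow_dvd_pow_of_dvd h3 2
    refine ⟨- m * maH p2 p1 p0 q4 q3 q2 q1 q0, ?_⟩
    rw [hm] at hr
    linear_combination hr
  exact (IsCoprime.pow_left hc).dvd_of_dvd_mul_right hdv

theorem maT_deg : (maT q4 q3 q2 q1 q0).natDegree ≤ 2 * Fintype.card F + 2 ∧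
    (maT q4 q3 q2 q1 q0).coeff (2 * Fintype.card F + 2) = 2 * q4 := by
  have hq : 1 < Fintype.card F := Fintype.one_lt_card
  have e : maT q4 q3 q2 q1 q0 = C (2 * q4) * X ^ (2 * Fintype.card F + 2)
      + (C q3 * X ^ (2 * Fintype.card F + 1) + C q3 * X ^ (Fintype.card F + 2)
        + C (2 * q2) * X ^ (Fintype.card F + 1) + C q1 * X ^ Fintype.card F + C q1 * X + C (2 * q0)) := by
    simp only [maT, Th, map_mul, map_ofNat]; ring
  have hd : (C q3 * X ^ (2 * Fintype.card F + 1) + C q3 * X ^ (Fintype.card F + 2)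
        + C (2 * q2) * X ^ (Fintype.card F + 1) + C q1 * X ^ Fintype.card F + C q1 * X + C (2 * q0)).natDegree
      ≤ 2 * Fintype.card F + 1 := by
    refine natDegree_add_le_of_degree_le (natDegree_add_le_of_degree_le (natDegree_add_le_of_degree_le
      (natDegree_add_le_of_degree_le (natDegree_add_le_of_degree_le ?_ ?_) ?_) ?_) ?_) ?_
    · exact natDegree_C_mul_X_pow_le _ _
    · exact (natDegree_C_mul_X_pow_le _ _).trans (by omega)
    · exact (natDegree_C_mul_X_pow_le _ _).trans (by omega)
    · exact (natDegree_C_mul_X_pow_le _ _).trans (by omega)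
    · exact (natDegree_C_mul_le _ _).trans (natDegree_X_le.trans (by omega))
    · rw [natDegree_C]; omega
  rw [e]
  refine ⟨natDegree_add_le_of_degree_le (natDegree_C_mul_X_pow_le _ _) (by omega), ?_⟩
  rw [coeff_add, coeff_C_mul_X_pow, if_pos rfl, coeff_eq_zero_of_natDegree_lt (by omega), add_zero]

theorem maU_deg : (maU p2 p1 p0 q4 q3 q2 q1 q0).natDegree ≤ 2 * Fintype.card F + 2 ∧
    (maU p2 p1 p0 q4 q3 q2 q1 q0).coeff (2 * Fintype.card F + 2)
      = (yrec p2 q4 (Fintype.card F)).1 * (p2 ^ 2 - 2 * q4) - (yrec p2 q4 (Fintype.card F)).2 * p2 := by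
  obtain ⟨h1, h2, h3, h4⟩ := yrec_deg (qd p2 p1 p0) (qt q4 q3 q2 q1 q0) (qd_deg _ _ _) (qt_deg _ _ _ _ _)
    (Fintype.card F)
  rw [qd_coeff, qt_coeff] at h3 h4
  have e : X ^ 2 * maU p2 p1 p0 q4 q3 q2 q1 q0 =
     (X ^ 2 * (yrec (qd p2 p1 p0) (qt q4 q3 q2 q1 q0) (Fintype.card F)).1)
      * ((qd p2 p1 p0) * (qd p2 p1 p0) - C 2 * (qt q4 q3 q2 q1 q0))
    - (X ^ 2 * (qd p2 p1 p0)) * (yrec (qd p2 p1 p0) (qt q4 q3 q2 q1 q0) (Fintype.card F)).2 := by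
    unfold maU; rw [map_ofNat]; ring
  have X2 : (X ^ 2 : F[X]).natDegree ≤ 2 := natDegree_X_pow_le 2
  have d1 : ((qd p2 p1 p0) * (qd p2 p1 p0) - C 2 * (qt q4 q3 q2 q1 q0)).natDegree ≤ 4 := by
    refine (natDegree_sub_le _ _).trans (max_le ?_ ?_)
    · exact natDegree_mul_le' _ (qd_deg _ _ _) (qd_deg _ _ _) (by omega)
    · exact (natDegree_C_mul_le _ _).trans (qt_deg _ _ _ _ _)
  have d2 : (X ^ 2 * (qd p2 p1 p0)).natDegree ≤ 4 := natDegree_mul_le' _ X2 (qd_deg _ _ _) (by omega)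
  have hX : ∀ (u : F[X]) n, (X ^ 2 * u).natDegree ≤ n + 2 → u.natDegree ≤ n := by
    intro u n h
    by_cases h0 : u = 0
    · rw [h0]; simp
    · rw [natDegree_X_pow_mul _ h0] at h; omega
  refine ⟨hX _ _ ?_, ?_⟩
  · rw [e]
    refine (natDegree_sub_le _ _).trans (max_le ?_ ?_)
    · exact natDegree_mul_le' _ h1 d1 (by omega)
    · exact natDegree_mul_le' _ d2 h2 (by omega)
  · have c1 : (maU p2 p1 p0 q4 q3 q2 q1 q0).coeff (2 * Fintype.card F + 2)
      = (X ^ 2 * maU p2 p1 p0 q4 q3 q2 q1 q0).coeff (2 * Fintype.card F + 4) := by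
      rw [show 2 * Fintype.card F + 4 = 2 * Fintype.card F + 2 + 2 by ring, coeff_X_pow_mul]
    rw [c1, e, coeff_sub, coeff_mul_add_eq_of_natDegree_le h1 d1, h3, coeff_sub, coeff_C_mul, qt_coeff,
      show (4 : ℕ) = 2 + 2 by rfl, coeff_mul_add_eq_of_natDegree_le (qd_deg _ _ _) (qd_deg _ _ _), qd_coeff,
      add_comm (2 * Fintype.card F) (2 + 2), coeff_mul_add_eq_of_natDegree_le d2 h2, h4,
      coeff_mul_add_eq_of_natDegree_le X2 (qd_deg _ _ _), qd_coeff, coeff_X_pow_self]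
    ring

theorem maV_deg : (maV p2 p1 p0 q4 q3 q2 q1 q0).natDegree ≤ 2 * Fintype.card F + wt p2 q4 := by
  have hq : 1 < Fintype.card F := Fintype.one_lt_card
  obtain ⟨a1, a2⟩ := maT_deg q4 q3 q2 q1 q0
  obtain ⟨b1, b2⟩ := maU_deg p2 p1 p0 q4 q3 q2 q1 q0
  have c1 : (maV p2 p1 p0 q4 q3 q2 q1 q0).natDegree ≤ 2 * Fintype.card F + 2 := by
    unfold maV; exact (natDegree_sub_le _ _).trans (max_le b1 a1)
  by_cases h2 : wt p2 q4 = 2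
  · rw [h2]; exact c1
  have c2 : (maV p2 p1 p0 q4 q3 q2 q1 q0).coeff (2 * Fintype.card F + 2) = 0 := by
    rw [maV, coeff_sub, a2, b2, local_val _ _ h2, sub_self]
  have c3 : (maV p2 p1 p0 q4 q3 q2 q1 q0).natDegree ≤ 2 * Fintype.card F + 1 := by
    by_contra h
    have : (maV p2 p1 p0 q4 q3 q2 q1 q0).natDegree = 2 * Fintype.card F + 2 := by omega
    rw [← this] at c2
    have h0 := leadingCoeff_eq_zero.mp c2
    rw [h0] at this; simp at this
  by_cases h1 : wt p2 q4 = 1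
  · rw [h1]; exact c3
  have h0 : wt p2 q4 = 0 := by have := wt_le p2 q4; omega
  rw [h0]
  have hr := maV_rel p2 p1 p0 q4 q3 q2 q1 q0
  obtain ⟨V, hV⟩ : ∃ V, V = maV p2 p1 p0 q4 q3 q2 q1 q0 := ⟨_, rfl⟩
  rw [← hV] at hr c1 c2 c3 ⊢
  by_cases hV0 : V = 0
  · rw [hV0]; simp
  have PP : ((qd p2 p1 p0) ^ Fintype.card F).natDegree ≤ 2 * Fintype.card F :=
    natDegree_pow_le.trans (by have := qd_deg p2 p1 p0; nlinarith)
  have PPc : ((qd p2 p1 p0) ^ Fintype.card F).coeff (2 * Fintype.card F) = p2 := by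
    rw [mul_comm, coeff_pow_of_natDegree_le (qd_deg _ _ _), qd_coeff, FiniteField.pow_card]
  have hWc : (maK p2 p1 p0 q4 q3 q2 q1 q0 + V).coeff (2 * Fintype.card F + 2) ≠ 0 := by
    rw [coeff_add, c2, maK, coeff_sub, coeff_mul_add_eq_of_natDegree_le PP (qd_deg _ _ _), PPc, qd_coeff,
      show (2 : F[X]) = C 2 from (map_ofNat C 2).symm, coeff_C_mul, a2]
    intro h
    apply wt_zero h0
    linear_combination - h
  have hWd : 2 * Fintype.card F + 2 ≤ (maK p2 p1 p0 q4 q3 q2 q1 q0 + V).natDegree :=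
    le_natDegree_of_ne_zero hWc
  have hW0 : maK p2 p1 p0 q4 q3 q2 q1 q0 + V ≠ 0 := by
    intro h; rw [h] at hWc; simp at hWc
  have hprod : V * (maK p2 p1 p0 q4 q3 q2 q1 q0 + V)
     = - ((X ^ Fintype.card F - X) ^ 2 * maH p2 p1 p0 q4 q3 q2 q1 q0) := by linear_combination hr
  have hdeg := congrArg natDegree hprod
  rw [natDegree_mul hV0 hW0, natDegree_neg] at hdeg
  have hX1 : ((X : F[X]) ^ Fintype.card F - X).natDegree ≤ Fintype.card F := by
    rw [FiniteField.X_pow_card_sub_X_natDegree_eq _ hq]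
  have hH : (maH p2 p1 p0 q4 q3 q2 q1 q0).natDegree ≤ 2 * Fintype.card F + 2 := by
    have aux : ∀ (c : F) (n : ℕ), n ≤ 2 * Fintype.card F + 2 → (C c * X ^ n).natDegree ≤ 2 * Fintype.card F + 2 :=
      fun c n hn => (natDegree_C_mul_X_pow_le _ _).trans hn
    obtain ⟨h22, h21, h20, h11, h10, h00, he⟩ : ∃ h22 h21 h20 h11 h10 h00 : F, maH p2 p1 p0 q4 q3 q2 q1 q0
       = C h22 * X ^ (2 * Fintype.card F + 2) + C h21 * X ^ (2 * Fintype.card F + 1) + C h21 * X ^ (Fintype.card F + 2)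
        + C h20 * X ^ (2 * Fintype.card F) + C h20 * X ^ 2 + C h11 * X ^ (Fintype.card F + 1)
        + C h10 * X ^ Fintype.card F + C h10 * X ^ 1 + C h00 * X ^ 0 := by
      refine ⟨(-p1*p2*q3+p1^2*q4+p2^2*q2-4*q2*q4+q3^2), (2*p0*p1*q4-p0*p2*q3+p2^2*q1-4*q1*q4),
        (p0^2*q4+p2^2*q0-4*q0*q4), (p0*p1*q3-2*p0*p2*q2+2*p0^2*q4+p1*p2*q1+2*p2^2*q0-8*q0*q4-2*q1*q3),
        (-p0*p2*q1+p0^2*q3+2*p1*p2*q0-4*q0*q3), (-p0*p1*q1+p0^2*q2+p1^2*q0-4*q0*q2+q1^2), ?_⟩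
      simp only [maH, Hh, map_mul, map_add, map_sub, map_neg, map_pow, map_ofNat]
      ring
    rw [he]
    refine natDegree_add_le_of_degree_le (natDegree_add_le_of_degree_le (natDegree_add_le_of_degree_le (natDegree_add_le_of_degree_le (natDegree_add_le_of_degree_le (natDegree_add_le_of_degree_le (natDegree_add_le_of_degree_le
      (natDegree_add_le_of_degree_le ?_ ?_) ?_) ?_) ?_) ?_) ?_) ?_) ?_ <;> exact aux _ _ (by omega)
  have hD : ((X ^ Fintype.card F - X) ^ 2 * maH p2 p1 p0 q4 q3 q2 q1 q0).natDegree ≤ 4 * Fintype.card F + 2 := by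
    refine natDegree_mul_le' _ (m := 2 * Fintype.card F) (natDegree_pow_le.trans (by omega)) hH (by omega)
  omega

end

end TC


namespace TC

open Polynomial

theorem extract_coprime {F : Type} [Field F] (x y : F[X]) :
    ∃ g a b : F[X], x = g * a ∧ y = g * b ∧ IsCoprime a b := by
  classical
  let _ : GCDMonoid F[X] := EuclideanDomain.gcdMonoid F[X]
  obtain ⟨a, b, h1, h2, h3⟩ := extract_gcd x y
  exact ⟨_, a, b, h1, h2, (gcd_isUnit_iff a b).mp h3⟩

theorem wt_pos {F : Type} [Field F] {p c : F} (h : p ^ 2 = 4 * c) : wt p c = 1 := by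
  simp [wt, h]

theorem map_qd {R S : Type} [CommRing R] [CommRing S] (f : R →+* S) (a b c : R) :
    (qd a b c).map f = qd (f a) (f b) (f c) := by simp [qd]
theorem map_qt {R S : Type} [CommRing R] [CommRing S] (f : R →+* S) (a b c d e : R) :
    (qt a b c d e).map f = qt (f a) (f b) (f c) (f d) (f e) := by simp [qt]
theorem eval_qd {R : Type} [CommRing R] (a b c t : R) :
    eval t (qd a b c) = a * t ^ 2 + b * t + c := by simp [qd]
theorem eval_qt {R : Type} [CommRing R] (a b c d e t : R) :
    eval t (qt a b c d e) = a * t ^ 4 + b * t ^ 3 + c * t ^ 2 + d * t + e := by simp [qt]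

theorem manin_alg {E : Type} [Field E] [Infinite E] (p2 p1 p0 q4 q3 q2 q1 q0 t k y y' : E)
    (n2 : k ^ 2 + ((2 * (2 * q4) - p2 * p2) * t ^ 2 + (2 * q3 - p2 * p1) * t + (- (p2 * p0))) * k
      + ((-p1*p2*q3+p1^2*q4+p2^2*q2-4*q2*q4+q3^2) * t ^ 2 + (2*p0*p1*q4-p0*p2*q3+p2^2*q1-4*q1*q4) * t
        + (p0^2*q4+p2^2*q0-4*q0*q4)) = 0)
    (n1 : -2 * t * k ^ 2 + ((2 * q3 - p1 * p2) * t ^ 2 + (2 * (2 * q2) - p1 * p1) * t + (2 * q1 - p1 * p0)) * k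
      + ((2*p0*p1*q4-p0*p2*q3+p2^2*q1-4*q1*q4) * t ^ 2
        + (p0*p1*q3-2*p0*p2*q2+2*p0^2*q4+p1*p2*q1+2*p2^2*q0-8*q0*q4-2*q1*q3) * t
        + (-p0*p2*q1+p0^2*q3+2*p1*p2*q0-4*q0*q3)) = 0)
    (n0 : t ^ 2 * k ^ 2 + ((- (p0 * p2)) * t ^ 2 + (2 * q1 - p0 * p1) * t + (2 * (2 * q0) - p0 * p0)) * k
      + ((p0^2*q4+p2^2*q0-4*q0*q4) * t ^ 2 + (-p0*p2*q1+p0^2*q3+2*p1*p2*q0-4*q0*q3) * t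
        + (-p0*p1*q1+p0^2*q2+p1^2*q0-4*q0*q2+q1^2)) = 0)
    (hP : p2 * t ^ 2 + p1 * t + p0 = -(y + y'))
    (hQ : q4 * t ^ 4 + q3 * t ^ 3 + q2 * t ^ 2 + q1 * t + q0 = y * y') (hyy : y - y' ≠ 0) :
    ∃ Y : E[X], Y.natDegree ≤ 2 ∧ Y ^ 2 + qd p2 p1 p0 * Y + qt q4 q3 q2 q1 q0 = 0 := by
  refine ⟨C ((y - y')⁻¹) * (qd (2 * q4 * t ^ 2 + q3 * t + k) (q3 * t ^ 2 + 2 * q2 * t + q1 - 2 * k * t)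
       (q1 * t + 2 * q0 + k * t ^ 2) + qd p2 p1 p0 * C y'), ?_, ?_⟩
  · refine (natDegree_C_mul_le _ _).trans (natDegree_add_le_of_degree_le (qd_deg _ _ _) ?_)
    exact (natDegree_mul_C_le _ _).trans (qd_deg _ _ _)
  · apply Polynomial.funext
    intro s
    simp only [eval_add, eval_mul, eval_pow, eval_qd, eval_qt, eval_C, eval_zero]
    have hid := Th_id p2 p1 p0 q4 q3 q2 q1 q0 s t
    obtain ⟨P, hPs⟩ : ∃ P, P = p2 * s ^ 2 + p1 * s + p0 := ⟨_, rfl⟩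
    obtain ⟨Q, hQs⟩ : ∃ Q, Q = q4 * s ^ 4 + q3 * s ^ 3 + q2 * s ^ 2 + q1 * s + q0 := ⟨_, rfl⟩
    obtain ⟨T, hT⟩ : ∃ T, T = Th q4 q3 q2 q1 q0 s t := ⟨_, rfl⟩
    obtain ⟨U, hU⟩ : ∃ U, U = (2 * q4 * t ^ 2 + q3 * t + k) * s ^ 2 + (q3 * t ^ 2 + 2 * q2 * t + q1 - 2 * k * t) * s
       + (q1 * t + 2 * q0 + k * t ^ 2) := ⟨_, rfl⟩
    have hUT : U = T + k * (s - t) ^ 2 := by rw [hU, hT]; unfold Th; ring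
    have hK : s ^ 2 * ((2 * (2 * q4) - p2 * p2) * t ^ 2 + (2 * q3 - p2 * p1) * t + (- (p2 * p0)))
       + s * ((2 * q3 - p1 * p2) * t ^ 2 + (2 * (2 * q2) - p1 * p1) * t + (2 * q1 - p1 * p0))
       + ((- (p0 * p2)) * t ^ 2 + (2 * q1 - p0 * p1) * t + (2 * (2 * q0) - p0 * p0))
       = 2 * T + P * (y + y') := by
      have : y + y' = -(p2 * t ^ 2 + p1 * t + p0) := by rw [hP]; ring
      rw [hT, hPs, this]; unfold Th; ring
    have hkey : k ^ 2 * (s - t) ^ 2 + (2 * T + P * (y + y')) * k + Hh p2 p1 p0 q4 q3 q2 q1 q0 s t = 0 := by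
      rw [← hK]; unfold Hh; linear_combination s ^ 2 * n2 + s * n1 + n0
    rw [← hPs, ← hQs, hP, hQ, ← hT] at hid
    rw [← hPs, ← hQs, ← hU]
    have hmain : U ^ 2 + P * (y + y') * U + y * y' * P ^ 2 + Q * (y - y') ^ 2 = 0 := by
      rw [hUT]
      linear_combination hid + (s - t) ^ 2 * hkey
    field_simp
    linear_combination hmain

theorem manin {F : Type} [Field F] [Fintype F] (p2 p1 p0 q4 q3 q2 q1 q0 : F)
    (hq : 23 ≤ Fintype.card F)
    (hN : ∑ x : F, wt (eval x (qd p2 p1 p0)) (eval x (qt q4 q3 q2 q1 q0)) + wt p2 q4 ≤ 12) :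
    ∃ Y : (AlgebraicClosure F)[X], Y.natDegree ≤ 2 ∧
      Y ^ 2 + (qd p2 p1 p0).map (algebraMap F (AlgebraicClosure F)) * Y
        + (qt q4 q3 q2 q1 q0).map (algebraMap F (AlgebraicClosure F)) = 0 := by
  obtain ⟨w, hw⟩ : ∃ w : F → ℕ, w = fun x => wt (eval x (qd p2 p1 p0)) (eval x (qt q4 q3 q2 q1 q0)) := ⟨_, rfl⟩
  have hw2 : ∀ x, w x ≤ 2 := fun x => by rw [hw]; exact wt_le _ _
  have hN' : ∑ x : F, w x + wt p2 q4 ≤ 12 := by rw [hw]; exact hN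
  obtain ⟨V, hV⟩ : ∃ V, V = maV p2 p1 p0 q4 q3 q2 q1 q0 := ⟨_, rfl⟩
  have hrel := maV_rel p2 p1 p0 q4 q3 q2 q1 q0
  have hVd := maV_deg p2 p1 p0 q4 q3 q2 q1 q0
  have hdv : ∀ x, (X - C x) ^ (2 - w x) ∣ V := fun x => by
    rw [hV, hw]; exact dvd_maV p2 p1 p0 q4 q3 q2 q1 q0 x
  rw [← hV] at hrel hVd
  have hD : ∏ x : F, (X - C x) ^ (2 - w x) ∣ V := by
    apply Finset.prod_dvd_of_coprime
    · intro x _ y _ hxy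
      exact IsCoprime.pow (pairwise_coprime_X_sub_C Function.injective_id hxy)
    · intro x _; exact hdv x
  obtain ⟨A, hA⟩ := hD
  obtain ⟨B, hB⟩ : ∃ B : F[X], B = ∏ x : F, (X - C x) ^ (w x) := ⟨_, rfl⟩
  have hB0 : B ≠ 0 := by
    rw [hB]; exact Finset.prod_ne_zero_iff.mpr (fun x _ => pow_ne_zero _ (X_sub_C_ne_zero x))
  have hDn0 : ∏ x : F, (X - C x) ^ (2 - w x) ≠ 0 :=
    Finset.prod_ne_zero_iff.mpr (fun x _ => pow_ne_zero _ (X_sub_C_ne_zero x))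
  have hBdeg : B.natDegree = ∑ x : F, w x := by
    rw [hB, natDegree_prod _ _ (fun x _ => pow_ne_zero _ (X_sub_C_ne_zero x))]
    simp
  have hDdeg : (∏ x : F, (X - C x) ^ (2 - w x)).natDegree = ∑ x : F, (2 - w x) := by
    rw [natDegree_prod _ _ (fun x _ => pow_ne_zero _ (X_sub_C_ne_zero x))]
    simp
  have hsum : ∑ x : F, (2 - w x) + ∑ x : F, w x = 2 * Fintype.card F := by
    rw [← Finset.sum_add_distrib, Finset.sum_congr rfl (fun x _ => Nat.sub_add_cancel (hw2 x))]
    simp [mul_comm]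
  have hDB : (∏ x : F, (X - C x) ^ (2 - w x)) * B = (X ^ Fintype.card F - X) ^ 2 := by
    rw [hB, ← Finset.prod_mul_distrib, ← prod_X_sub, ← Finset.prod_pow]
    refine Finset.prod_congr rfl (fun x _ => ?_)
    rw [← pow_add, Nat.sub_add_cancel (hw2 x)]
  have hAdeg : A.natDegree ≤ 12 := by
    by_cases hA0 : A = 0
    · rw [hA0]; simp
    · rw [hA, natDegree_mul hDn0 hA0, hDdeg] at hVd
      omega
  have hVB : V * B = (X ^ Fintype.card F - X) ^ 2 * A := by rw [hA, ← hDB]; ring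
  have hX0 : (X ^ Fintype.card F - X : F[X]) ^ 2 ≠ 0 := by rw [← hDB]; exact mul_ne_zero hDn0 hB0
  have hrel2 : (X ^ Fintype.card F - X) ^ 2 * A ^ 2 + maK p2 p1 p0 q4 q3 q2 q1 q0 * (A * B)
      + maH p2 p1 p0 q4 q3 q2 q1 q0 * B ^ 2 = 0 := by
    apply mul_left_cancel₀ hX0
    rw [mul_zero]
    linear_combination B ^ 2 * hrel - (V * B + (X ^ Fintype.card F - X) ^ 2 * A + maK p2 p1 p0 q4 q3 q2 q1 q0 * B) * hVB
  obtain ⟨g, a, b, ha, hb, hab⟩ := extract_coprime A B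
  have hg0 : g ≠ 0 := by rintro rfl; rw [zero_mul] at hb; exact hB0 hb
  have hb0 : b ≠ 0 := by rintro rfl; rw [mul_zero] at hb; exact hB0 hb
  have hBdeg12 : B.natDegree ≤ 12 := by rw [hBdeg]; omega
  have hbdeg : b.natDegree ≤ 12 := by
    rw [hb, natDegree_mul hg0 hb0] at hBdeg12; omega
  have hadeg : a.natDegree ≤ 12 := by
    by_cases ha0 : a = 0
    · rw [ha0]; simp
    · rw [ha, natDegree_mul hg0 ha0] at hAdeg; omega
  have hrel3 : (X ^ Fintype.card F - X) ^ 2 * a ^ 2 + maK p2 p1 p0 q4 q3 q2 q1 q0 * (a * b)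
      + maH p2 p1 p0 q4 q3 q2 q1 q0 * b ^ 2 = 0 := by
    apply mul_left_cancel₀ (pow_ne_zero 2 hg0)
    rw [mul_zero]
    rw [ha, hb] at hrel2
    linear_combination hrel2
  have hGne : qd (2 * (2 * q4) - p2 * p2) (2 * q3 - p2 * p1) (- (p2 * p0)) * X ^ 2
      + qd (2 * q3 - p1 * p2) (2 * (2 * q2) - p1 * p1) (2 * q1 - p1 * p0) * X
      + qd (- (p0 * p2)) (2 * q1 - p0 * p1) (2 * (2 * q0) - p0 * p0) ≠ 0 := by
    intro h
    have h1 : ∀ x : F, w x = 1 := by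
      intro x
      rw [hw]
      apply wt_pos
      have := congrArg (eval x) h
      simp [qd, qt] at this ⊢
      linear_combination - this
    rw [Finset.sum_congr rfl (fun x _ => h1 x)] at hN'
    simp at hN'
    omega
  obtain ⟨m2, m1, m0⟩ := manin_core (Fintype.card F) hq _ _ _
    (qd (-p1*p2*q3+p1^2*q4+p2^2*q2-4*q2*q4+q3^2) (2*p0*p1*q4-p0*p2*q3+p2^2*q1-4*q1*q4) (p0^2*q4+p2^2*q0-4*q0*q4))
    (qd (2*p0*p1*q4-p0*p2*q3+p2^2*q1-4*q1*q4) (p0*p1*q3-2*p0*p2*q2+2*p0^2*q4+p1*p2*q1+2*p2^2*q0-8*q0*q4-2*q1*q3)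
      (-p0*p2*q1+p0^2*q3+2*p1*p2*q0-4*q0*q3))
    (qd (p0^2*q4+p2^2*q0-4*q0*q4) (-p0*p2*q1+p0^2*q3+2*p1*p2*q0-4*q0*q3)
      (-p0*p1*q1+p0^2*q2+p1^2*q0-4*q0*q2+q1^2))
    a b (qd_deg _ _ _) (qd_deg _ _ _) (qd_deg _ _ _) (qd_deg _ _ _) (qd_deg _ _ _) (qd_deg _ _ _)
    hadeg hbdeg hab hb0 hGne (by
      rw [← hrel3, maK, maT, maH, qd_pow_card]
      simp only [qd, Th, Hh, map_mul, map_add, map_sub, map_neg, map_pow, map_ofNat]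
      ring)
  let E := AlgebraicClosure F
  let f : F →+* E := algebraMap F E
  have hfinj : Function.Injective (Polynomial.map f) := map_injective f f.injective
  obtain ⟨t, ht⟩ : ∃ t : E, eval t ((b * (qd (2 * (2 * q4) - p2 * p2) (2 * q3 - p2 * p1) (- (p2 * p0)) * X ^ 2
      + qd (2 * q3 - p1 * p2) (2 * (2 * q2) - p1 * p1) (2 * q1 - p1 * p0) * X
      + qd (- (p0 * p2)) (2 * q1 - p0 * p1) (2 * (2 * q0) - p0 * p0))).map f) ≠ 0 := by
    by_contra h
    push Not at h
    have h0 := Polynomial.funext (p := _) (q := (0 : E[X])) (fun r => (h r).trans (eval_zero).symm)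
    rw [← Polynomial.map_zero f] at h0
    exact mul_ne_zero hb0 hGne (hfinj h0)
  rw [Polynomial.map_mul, eval_mul] at ht
  have htb := left_ne_zero_of_mul ht
  have htG := right_ne_zero_of_mul ht
  have n2 := congrArg (fun u => eval t (u.map f)) m2
  have n1 := congrArg (fun u => eval t (u.map f)) m1
  have n0 := congrArg (fun u => eval t (u.map f)) m0
  simp only [map_qd, Polynomial.map_add, Polynomial.map_mul, Polynomial.map_pow, map_X, Polynomial.map_neg,
    Polynomial.map_ofNat, Polynomial.map_zero,
    eval_add, eval_mul, eval_pow, eval_neg, eval_qd, eval_X, eval_zero, eval_ofNat] at n2 n1 n0 htG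
  simp only [map_add, map_mul, map_sub, map_neg, map_pow, map_ofNat] at n2 n1 n0 htG
  obtain ⟨β, hβ⟩ : ∃ β, β = eval t (b.map f) := ⟨_, rfl⟩
  obtain ⟨k, hk⟩ : ∃ k, k = eval t (a.map f) / β := ⟨_, rfl⟩
  rw [← hβ] at n2 n1 n0 htb
  have hak : eval t (a.map f) = k * β := by rw [hk, div_mul_cancel₀ _ htb]
  rw [hak] at n2 n1 n0
  have hβ2 : β ^ 2 ≠ 0 := pow_ne_zero 2 htb
  obtain ⟨y, hy⟩ := exists_quad_root (f p2 * t ^ 2 + f p1 * t + f p0)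
    (f q4 * t ^ 4 + f q3 * t ^ 3 + f q2 * t ^ 2 + f q1 * t + f q0)
  obtain ⟨y', hy'⟩ : ∃ y', y' = - (f p2 * t ^ 2 + f p1 * t + f p0) - y := ⟨_, rfl⟩
  have hP0 : f p2 * t ^ 2 + f p1 * t + f p0 = -(y + y') := by rw [hy']; ring
  have hQ0 : f q4 * t ^ 4 + f q3 * t ^ 3 + f q2 * t ^ 2 + f q1 * t + f q0 = y * y' := by
    rw [hy']; linear_combination hy
  have hyy : y - y' ≠ 0 := by
    intro h
    apply htG
    have : (f p2 * t ^ 2 + f p1 * t + f p0) ^ 2 = 4 * (f q4 * t ^ 4 + f q3 * t ^ 3 + f q2 * t ^ 2 + f q1 * t + f q0) := by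
      rw [hP0, hQ0, sub_eq_zero.mp h]; ring
    linear_combination - this
  change ∃ Y : E[X], Y.natDegree ≤ 2 ∧ Y ^ 2 + (qd p2 p1 p0).map f * Y + (qt q4 q3 q2 q1 q0).map f = 0
  rw [map_qd, map_qt]
  refine manin_alg (f p2) (f p1) (f p0) (f q4) (f q3) (f q2) (f q1) (f q0) t k y y' ?_ ?_ ?_ hP0 hQ0 hyy
  · apply mul_left_cancel₀ hβ2; rw [mul_zero]; linear_combination n2
  · apply mul_left_cancel₀ hβ2; rw [mul_zero]; linear_combination n1
  · apply mul_left_cancel₀ hβ2; rw [mul_zero]; linear_combination n0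

end TC


namespace TC

open Polynomial

/-- The base point condition at an affine parameter. -/
def BaseAt {E : Type} [Field E] (a b c d e f y : E) : Prop :=
  a * y ^ 2 + b * y + c = 0 ∧ b * y ^ 2 + (c + d) * y + e = 0 ∧ c * y ^ 2 + e * y + f = 0

def Fam {E : Type} [Field E] (a b c d e f : E) : Prop :=
  ∃ l α β γ δ : E, a = l * α ^ 2 ∧ b = l * α * (β + γ) ∧ c = l * β * γ ∧ d = 3 * l * α * δ ∧
    e = l * δ * (β + γ) ∧ f = l * δ ^ 2 ∧ α * δ = β ^ 2 - β * γ + γ ^ 2 ∧ l ≠ 0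

theorem class_coeff {E : Type} [Field E] (a b c d e f α β γ δ α' β' γ' δ' : E)
    (hA : ¬ (a = 0 ∧ b = 0 ∧ c = 0))
    (hpl : a * f - b * e + c * d = 0)
    (h1 : a = α * α') (h2 : b = α * γ' + γ * α') (h3 : c = γ * γ')
    (h4 : b = β * α' + α * β') (h5 : c + d = β * γ' + δ * α' + α * δ' + γ * β')
    (h6 : e = δ * γ' + γ * δ') (h7 : c = β * β') (h8 : e = β * δ' + δ * β') (h9 : f = δ * δ') :
    (∃ y, BaseAt a b c d e f y) ∨ Fam a b c d e f := by
  have s1 : α * (β' - γ') = - (α' * (β - γ)) := by linear_combination h2 - h4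
  have s2 : δ * (β' - γ') = - (δ' * (β - γ)) := by linear_combination h6 - h8
  have s3 : β * (β' - γ') = - (γ' * (β - γ)) := by linear_combination h3 - h7
  have s4 : γ * (β' - γ') = - (β' * (β - γ)) := by linear_combination h3 - h7
  have hd : d = β * γ' + δ * α' + α * δ' + γ * β' - γ * γ' := by linear_combination h5 - h3
  by_cases hu : β - γ = 0
  · by_cases hu' : β' - γ' = 0
    · have eb : γ = β := by linear_combination -hu
      have eb' : γ' = β' := by linear_combination -hu'
      subst eb eb'
      left
      have hp : (α * δ - γ ^ 2) * (α' * δ' - γ' ^ 2) = 0 := by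
        rw [h1, h2, h3, h6, h9, hd] at hpl
        linear_combination hpl
      have hbase : ∀ α γ δ α' γ' δ' : E, a = α * α' → b = α * γ' + γ * α' → c = γ * γ' →
          e = δ * γ' + γ * δ' → f = δ * δ' → d = γ * γ' + δ * α' + α * δ' + γ * γ' - γ * γ' →
          α * δ - γ ^ 2 = 0 → ∃ y, BaseAt a b c d e f y := by
        intro α γ δ α' γ' δ' h1 h2 h3 h6 h9 hd h
        have hα : α ≠ 0 := by
          rintro rfl
          have : γ = 0 := by
            have : γ ^ 2 = 0 := by linear_combination -h
            exact pow_eq_zero_iff (two_ne_zero) |>.1 this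
          subst this
          apply hA; simp [h1, h2, h3]
        have hδ : δ = γ ^ 2 / α := by field_simp; linear_combination h
        refine ⟨-γ / α, ?_, ?_, ?_⟩
        · rw [h1, h2, h3]; field_simp; ring
        · rw [h2, h6, h3, hd, hδ]; field_simp; ring
        · rw [h3, h6, h9, hδ]; field_simp; ring
      rcases mul_eq_zero.1 hp with h | h
      · exact hbase α γ δ α' γ' δ' h1 h2 h3 h6 h9 hd h
      · exact hbase α' γ' δ' α γ δ (by rw [h1]; ring) (by rw [h2]; ring) (by rw [h3]; ring)
          (by rw [h6]; ring) (by rw [h9]; ring) (by rw [hd]; ring) h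
    · exfalso
      rw [hu] at s1 s2 s3 s4
      simp [hu'] at s1 s2 s3 s4
      subst s1 s3 s4
      apply hA; simp [h1, h2, h3]
  · obtain ⟨l, hl⟩ : ∃ l, l = -(β' - γ') / (β - γ) := ⟨_, rfl⟩
    have e1 : α' = l * α := by rw [hl]; field_simp; linear_combination s1
    have e2 : δ' = l * δ := by rw [hl]; field_simp; linear_combination s2
    have e3 : γ' = l * β := by rw [hl]; field_simp; linear_combination s3
    have e4 : β' = l * γ := by rw [hl]; field_simp; linear_combination s4
    clear hl s1 s2 s3 s4
    subst e1 e2 e3 e4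
    have hl0 : l ≠ 0 := by
      rintro rfl; apply hA; simp [h1, h2, h3]
    have hp : (α * δ - β * γ) * (α * δ - (β ^ 2 - β * γ + γ ^ 2)) = 0 := by
      rw [h1, h2, h3, h6, h9, hd] at hpl
      apply mul_left_cancel₀ (pow_ne_zero 2 hl0)
      linear_combination hpl
    rcases mul_eq_zero.1 hp with h | h
    · left
      have hα : α ≠ 0 := by
        rintro rfl
        apply hA
        refine ⟨by rw [h1]; ring, by rw [h2]; ring, by rw [h3]; linear_combination -l * h⟩
      have hδ : δ = β * γ / α := by field_simp; linear_combination h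
      refine ⟨-γ / α, ?_, ?_, ?_⟩
      · rw [h1, h2, h3]; field_simp; ring
      · rw [h2, h6, h3, hd, hδ]; field_simp; ring
      · rw [h3, h6, h9, hδ]; field_simp; ring
    · right
      refine ⟨l, α, β, γ, δ, by rw [h1]; ring, by rw [h2]; ring, by rw [h3]; ring, ?_,
        by rw [h6]; ring, by rw [h9]; ring, by linear_combination h, hl0⟩
      rw [hd]; linear_combination -l * h

theorem qd_coeffs {R : Type} [CommRing R] (p2 p1 p0 : R) :
    (qd p2 p1 p0).coeff 2 = p2 ∧ (qd p2 p1 p0).coeff 1 = p1 ∧ (qd p2 p1 p0).coeff 0 = p0 := by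
  unfold qd; refine ⟨by simp, ?_, ?_⟩ <;> simp [coeff_X, coeff_C]

theorem class_E {E : Type} [Field E] (a b c d e f : E)
    (hA : ¬ (a = 0 ∧ b = 0 ∧ c = 0))
    (hpl : a * f - b * e + c * d = 0) (Y : E[X]) (hYd : Y.natDegree ≤ 2)
    (hY : Y ^ 2 + qd b (c + d) e * Y + qd a b c * qd c e f = 0) :
    (∃ y, BaseAt a b c d e f y) ∨ Fam a b c d e f := by
  have cf := @qd_coeffs E _
  have hA0 : qd a b c ≠ 0 := by
    intro h
    obtain ⟨h1, h2, h3⟩ := cf a b c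
    rw [h] at h1 h2 h3
    exact hA ⟨h1.symm, h2.symm, h3.symm⟩
  obtain ⟨g, s, t, hs, ht, hst⟩ := extract_coprime (qd a b c) Y
  have hg : g ≠ 0 := by rintro rfl; apply hA0; rw [hs]; ring
  have hs0 : s ≠ 0 := by rintro rfl; apply hA0; rw [hs]; ring
  have hY' : t * (-qd b (c + d) e - Y) = s * qd c e f := by
    apply mul_left_cancel₀ hg
    have : g * t * (-qd b (c + d) e - Y) = g * s * qd c e f := by
      rw [← hs, ← ht]; linear_combination -hY
    linear_combination this
  obtain ⟨h, hh⟩ : s ∣ (-qd b (c + d) e - Y) :=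
    hst.dvd_of_dvd_mul_left ⟨_, hY'⟩
  have hC : qd c e f = t * h := by
    apply mul_left_cancel₀ hs0
    rw [← hY', hh]; ring
  have hB : qd b (c + d) e = -(g * t + s * h) := by
    rw [← ht, ← hh]; ring
  have dA : (g * s).natDegree ≤ 2 := hs ▸ qd_deg a b c
  have dY : (g * t).natDegree ≤ 2 := ht ▸ hYd
  have dC : (t * h).natDegree ≤ 2 := hC ▸ qd_deg c e f
  have dY' : (s * h).natDegree ≤ 2 := by
    rw [← hh]
    refine (natDegree_sub_le _ _).trans (max_le ?_ hYd)
    rw [natDegree_neg]; exact qd_deg _ _ _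
  have gen : ∀ u v : E[X], v.natDegree ≤ 2 → (u * v).natDegree ≤ 2 → u ≠ 0 → u.natDegree + v.natDegree ≤ 2 ∨ v = 0 := by
    intro u v _ h1 hu
    by_cases hv : v = 0
    · right; exact hv
    · left; rwa [natDegree_mul hu hv] at h1
  have dgs : g.natDegree + s.natDegree ≤ 2 := by rwa [natDegree_mul hg hs0] at dA
  have dgt : t.natDegree + g.natDegree ≤ 2 := by
    by_cases h0 : t = 0
    · subst h0; simp; omega
    · rw [natDegree_mul hg h0] at dY; omega
  have dsh : s.natDegree + h.natDegree ≤ 2 := by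
    by_cases h0 : h = 0
    · subst h0; simp; omega
    · rwa [natDegree_mul hs0 h0] at dY'
  have dth : t.natDegree + h.natDegree ≤ 2 := by
    by_cases h0 : t = 0
    · subst h0; simp; omega
    · by_cases h1 : h = 0
      · subst h1; simp; omega
      · rwa [natDegree_mul h0 h1] at dC
  have base : ∀ y : E, C y ^ 2 * qd a b c + C y * qd b (c + d) e + qd c e f = 0 →
      BaseAt a b c d e f y := by
    intro y hy
    have e2 := congrArg (fun p => coeff p 2) hy
    have e1 := congrArg (fun p => coeff p 1) hy
    have e0 := congrArg (fun p => coeff p 0) hy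
    simp only [← C_pow, coeff_add, coeff_C_mul, cf, coeff_zero] at e2 e1 e0
    refine ⟨by linear_combination e2, by linear_combination e1, by linear_combination e0⟩
  by_cases c1 : g.natDegree = 0 ∧ h.natDegree = 0
  · left
    obtain ⟨g0, rfl⟩ : ∃ g0, g = C g0 := ⟨_, eq_C_of_natDegree_eq_zero c1.1⟩
    obtain ⟨h0, rfl⟩ : ∃ h0, h = C h0 := ⟨_, eq_C_of_natDegree_eq_zero c1.2⟩
    have hg0 : g0 ≠ 0 := by rintro rfl; simp at hg
    refine ⟨h0 / g0, base _ ?_⟩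
    rw [hs, hB, hC]
    have : C h0 = C (h0 / g0) * C g0 := by rw [← C_mul]; congr 1; field_simp
    rw [this]; ring
  by_cases c2 : s.natDegree = 0 ∧ t.natDegree = 0
  · left
    obtain ⟨g0, rfl⟩ : ∃ g0, s = C g0 := ⟨_, eq_C_of_natDegree_eq_zero c2.1⟩
    obtain ⟨h0, rfl⟩ : ∃ h0, t = C h0 := ⟨_, eq_C_of_natDegree_eq_zero c2.2⟩
    have hg0 : g0 ≠ 0 := by rintro rfl; simp at hs0
    refine ⟨h0 / g0, base _ ?_⟩
    rw [hs, hB, hC]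
    have : C h0 = C (h0 / g0) * C g0 := by rw [← C_mul]; congr 1; field_simp
    rw [this]; ring
  obtain ⟨α, γ, hs'⟩ := exists_eq_X_add_C_of_natDegree_le_one (show s.natDegree ≤ 1 by omega)
  obtain ⟨β, δ, ht'⟩ := exists_eq_X_add_C_of_natDegree_le_one (show (-t).natDegree ≤ 1 by rw [natDegree_neg]; omega)
  obtain ⟨α', γ', hg'⟩ := exists_eq_X_add_C_of_natDegree_le_one (show g.natDegree ≤ 1 by omega)
  obtain ⟨β', δ', hh'⟩ := exists_eq_X_add_C_of_natDegree_le_one (show (-h).natDegree ≤ 1 by rw [natDegree_neg]; omega)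
  have eA : qd a b c = qd (α * α') (α * γ' + γ * α') (γ * γ') := by
    rw [hs, hs', hg']; simp only [qd, C_add, C_mul]; ring
  have eB : qd b (c + d) e = qd (β * α' + α * β') (β * γ' + δ * α' + α * δ' + γ * β') (δ * γ' + γ * δ') := by
    have : qd b (c + d) e = g * (-t) + s * (-h) := by rw [hB]; ring
    rw [this, hs', hg', ht', hh']; simp only [qd, C_add, C_mul]; ring
  have eC : qd c e f = qd (β * β') (β * δ' + δ * β') (δ * δ') := by
    have : qd c e f = (-t) * (-h) := by rw [hC]; ring
    rw [this, ht', hh']; simp only [qd, C_add, C_mul]; ring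
  have inj : ∀ x y z x' y' z' : E, qd x y z = qd x' y' z' → x = x' ∧ y = y' ∧ z = z' := by
    intro x y z x' y' z' h
    obtain ⟨h1, h2, h3⟩ := cf x y z
    obtain ⟨h1', h2', h3'⟩ := cf x' y' z'
    rw [h] at h1 h2 h3
    exact ⟨h1.symm.trans h1', h2.symm.trans h2', h3.symm.trans h3'⟩
  obtain ⟨a1, a2, a3⟩ := inj _ _ _ _ _ _ eA
  obtain ⟨b1, b2, b3⟩ := inj _ _ _ _ _ _ eB
  obtain ⟨c1, c2, c3⟩ := inj _ _ _ _ _ _ eC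
  exact class_coeff a b c d e f α β γ δ α' β' γ' δ' hA hpl a1 a2 a3 b1 b2 b3 c1 c2 c3

end TC


namespace TC

open Polynomial

/-- rank one condition: chord type -/
def ZC {F : Type} [Field F] (a b c d e f : F) : Prop :=
  a * (c + d) = b ^ 2 ∧ a * e = b * c ∧ a * f = c ^ 2 ∧ b * e = c * (c + d) ∧ b * f = c * e ∧
    (c + d) * f = e ^ 2

def ZF1 {F : Type} [Field F] (a b c d e f : F) : Prop :=
  a ≠ 0 ∧ (∀ T, T ^ 2 - b * T + a * c ≠ 0) ∧ a * d = 3 * (b ^ 2 - 3 * a * c) ∧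
    a ^ 2 * e = b * (b ^ 2 - 3 * a * c) ∧ a ^ 3 * f = (b ^ 2 - 3 * a * c) ^ 2

def ZF2 {F : Type} [Field F] (a b c d e f : F) : Prop :=
  a = 0 ∧ b = 0 ∧ d = 0 ∧ f ≠ 0 ∧ e ^ 2 = 3 * (c * f) ∧ (∀ T, T ^ 2 - e * T + c * f ≠ 0)

def Z3 {F : Type} [Field F] (a b c d e f : F) : Prop :=
  a = 0 ∧ b = 0 ∧ c ≠ 0 ∧ d = 0 ∧ e = 0 ∧ f = 0 ∧ (∀ T : F, T ^ 2 + T + 1 = 0 → T = 1)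

theorem wt_root {F : Type} [Field F] {p c : F} (z : F) (h : z ^ 2 + p * z + c = 0) : 1 ≤ wt p c := by
  unfold wt
  split_ifs with h1 h2
  · exact le_rfl
  · norm_num
  · exact absurd ⟨z, h⟩ h2

theorem descent_base {F E : Type} [Field F] [Field E] [Algebra F E] (a b c d e f : F)
    (hb : ∀ y : F, ¬ BaseAt a b c d e f y) (y : E)
    (hy : BaseAt (algebraMap F E a) (algebraMap F E b) (algebraMap F E c) (algebraMap F E d)
      (algebraMap F E e) (algebraMap F E f) y) : ZC a b c d e f := by
  have hyF : ∀ x : F, algebraMap F E x ≠ y := by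
    rintro x rfl
    apply hb x
    obtain ⟨h1, h2, h3⟩ := hy
    refine ⟨?_, ?_, ?_⟩ <;> apply (algebraMap F E).injective <;> simpa [map_add, map_mul, map_pow]
  have key : ∀ s t : F, algebraMap F E s * y + algebraMap F E t = 0 → s = 0 ∧ t = 0 := by
    intro s t h
    have hs : s = 0 := by
      by_contra hs
      apply hyF (-t / s)
      have : algebraMap F E s ≠ 0 := by simpa using hs
      rw [map_div₀, map_neg]; field_simp; linear_combination -h
    subst hs
    simpa using h
  have hy0 : y ≠ 0 := by
    have := hyF 0; rw [map_zero] at this; exact this.symm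
  obtain ⟨h1, h2, h3⟩ := hy
  obtain ⟨k1, k2⟩ := key (a * (c + d) - b * b) (a * e - b * c) (by
    simp only [map_sub, map_mul, map_add]
    linear_combination (algebraMap F E a) * h2 - (algebraMap F E b) * h1)
  obtain ⟨k3, k4⟩ := key (a * e - c * b) (a * f - c * c) (by
    simp only [map_sub, map_mul]
    linear_combination (algebraMap F E a) * h3 - (algebraMap F E c) * h1)
  obtain ⟨k5, k6⟩ := key (b * e - c * (c + d)) (b * f - c * e) (by
    simp only [map_sub, map_mul, map_add]
    linear_combination (algebraMap F E b) * h3 - (algebraMap F E c) * h2)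
  obtain ⟨k7, k8⟩ := key (b * f - e * c) ((c + d) * f - e * e) (by
    simp only [map_sub, map_mul, map_add]
    apply mul_left_cancel₀ hy0
    linear_combination (algebraMap F E f) * h2 - (algebraMap F E e) * h3)
  refine ⟨?_, ?_, ?_, ?_, ?_, ?_⟩
  · linear_combination k1
  · linear_combination k2
  · linear_combination k4
  · linear_combination k5
  · linear_combination k6
  · linear_combination k8

/-- total weight -/
noncomputable def NN {F : Type} [Field F] [Fintype F] (a b c d e f : F) : ℕ :=
  ∑ x : F, wt (b * x ^ 2 + (c + d) * x + e) ((a * x ^ 2 + b * x + c) * (c * x ^ 2 + e * x + f)) +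
    wt b (a * c)

theorem NN_split {F : Type} [Field F] [Fintype F] (a b c d e f : F) (l α β γ δ : F)
    (ha : a = l * α ^ 2) (hb : b = l * α * (β + γ)) (hc : c = l * β * γ) (hd : d = 3 * l * α * δ)
    (he : e = l * δ * (β + γ)) (hf : f = l * δ ^ 2) (h : α * δ = β ^ 2 - β * γ + γ ^ 2) :
    Fintype.card F ≤ NN a b c d e f := by
  unfold NN
  have : ∑ x : F, 1 ≤ ∑ x : F, wt (b * x ^ 2 + (c + d) * x + e)
      ((a * x ^ 2 + b * x + c) * (c * x ^ 2 + e * x + f)) := by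
    apply Finset.sum_le_sum
    intro x _
    apply wt_root (-l * (β * x + δ) * (α * x + β))
    subst ha hb hc hd he hf
    linear_combination (-l * (β * x + δ) * (α * x + β)) * l * x * h
  simp at this
  omega

theorem descent {F : Type} [Field F] [Fintype F] (hq : 23 ≤ Fintype.card F) (a b c d e f : F)
    (hA : ¬ (a = 0 ∧ b = 0 ∧ c = 0))
    (hpl : a * f - b * e + c * d = 0)
    (hb : ∀ y : F, ¬ BaseAt a b c d e f y)
    (hN : NN a b c d e f ≤ 12) :
    ZC a b c d e f ∨ ZF1 a b c d e f ∨ ZF2 a b c d e f ∨ Z3 a b c d e f := by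
  have hN' : ∑ x : F, wt (eval x (qd b (c + d) e))
      (eval x (qt (a * c) (a * e + b * c) (a * f + b * e + c ^ 2) (b * f + c * e) (c * f)))
       + wt b (a * c) ≤ 12 := by
    refine le_trans (le_of_eq ?_) hN
    unfold NN
    congr 1
    apply Finset.sum_congr rfl
    intro x _
    rw [eval_qd, eval_qt]
    congr 1; ring
  obtain ⟨Y, hYd, hY⟩ := manin _ _ _ _ _ _ _ _ hq hN'
  rw [map_qd, map_qt] at hY
  let E := AlgebraicClosure F
  have inj := (algebraMap F E).injective
  have := class_E (algebraMap F E a) (algebraMap F E b) (algebraMap F E c) (algebraMap F E d)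
    (algebraMap F E e) (algebraMap F E f) (by simpa using hA)
    (by rw [← map_mul, ← map_mul, ← map_mul, ← map_sub, ← map_add, hpl, map_zero]) Y hYd (by
      rw [← hY]
      simp only [qd, qt, map_add, map_mul, map_pow]
      ring)
  rcases this with ⟨y, hy⟩ | ⟨l, α, β, γ, δ, h1, h2, h3, h4, h5, h6, h7, hl⟩
  · left; exact descent_base a b c d e f hb y hy
  right
  by_cases ha : a = 0
  · have hα : α = 0 := by
      rw [ha, map_zero] at h1
      have := h1.symm
      simpa [hl] using this
    subst hα
    have hb0 : b = 0 := by apply inj; rw [h2]; simp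
    have hd0 : d = 0 := by apply inj; rw [h4]; simp
    have he3 : e ^ 2 = 3 * (c * f) := by
      apply inj; simp only [map_pow, map_mul, map_ofNat]
      rw [h5, h3, h6]
      linear_combination -l ^ 2 * δ ^ 2 * h7
    subst ha hb0 hd0
    by_cases hf : f = 0
    · subst hf
      have he : e = 0 := by
        have : e ^ 2 = 0 := by rw [he3]; ring
        exact pow_eq_zero_iff two_ne_zero |>.1 this
      subst he
      right; right
      have hc0 : c ≠ 0 := by rintro rfl; exact hA ⟨rfl, rfl, rfl⟩
      refine ⟨rfl, rfl, hc0, rfl, rfl, rfl, ?_⟩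
      intro T hT
      exfalso
      have hT0 : T ≠ 0 := by rintro rfl; norm_num at hT
      have := NN_split 0 0 c 0 0 0 (-c / T) 0 1 (-T) 0 (by ring) (by ring) (by field_simp)
        (by ring) (by ring) (by ring) (by linear_combination -hT)
      omega
    · right; left
      refine ⟨rfl, rfl, rfl, hf, he3, ?_⟩
      intro T hT
      have := NN_split 0 0 c 0 e f (1 / f) 0 T (e - T) f (by ring) (by ring)
        (by field_simp; linear_combination hT)
        (by ring) (by field_simp; ring) (by field_simp) (by linear_combination -3 * hT - he3)
      omega
  · left
    have r1 : a * d = 3 * (b ^ 2 - 3 * a * c) := by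
      apply inj; simp only [map_sub, map_pow, map_mul, map_ofNat]
      rw [h1, h2, h3, h4]; linear_combination 3 * l ^ 2 * α ^ 2 * h7
    have r2 : a ^ 2 * e = b * (b ^ 2 - 3 * a * c) := by
      apply inj; simp only [map_sub, map_pow, map_mul, map_ofNat]
      rw [h1, h2, h3, h5]; linear_combination l ^ 3 * α ^ 3 * (β + γ) * h7
    have r3 : a ^ 3 * f = (b ^ 2 - 3 * a * c) ^ 2 := by
      apply inj; simp only [map_sub, map_pow, map_mul, map_ofNat]
      rw [h1, h2, h3, h6]
      linear_combination l ^ 4 * α ^ 4 * (α * δ + β ^ 2 - β * γ + γ ^ 2) * h7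
    refine ⟨ha, ?_, r1, r2, r3⟩
    intro T hT
    have := NN_split a b c d e f (1 / a) a T (b - T) ((b ^ 2 - 3 * a * c) / a) (by field_simp)
      (by field_simp; ring)
      (by field_simp; linear_combination hT)
      (by field_simp; linear_combination r1) (by field_simp; linear_combination r2)
      (by field_simp; linear_combination r3) (by field_simp; linear_combination -3 * hT)
    omega

end TC


namespace TC

open Polynomial

section
variable {F : Type} [Field F]

/-- homogeneous coordinates of a point of the projective line -/
def nu : Option F → F
  | none => 1
  | some t => t
def de : Option F → F
  | none => 0
  | some _ => 1

theorem det_ne {x y : Option F} (h : x ≠ y) : nu x * de y - nu y * de x ≠ 0 := by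
  cases x <;> cases y <;> simp_all [nu, de, sub_eq_zero]

def fA (a b c : F) (x : Option F) : F := a * nu x ^ 2 + b * nu x * de x + c * de x ^ 2

def psi (a b c d e f : F) (x y : Option F) : F :=
  fA a b c x * nu y ^ 2 + fA b (c + d) e x * nu y * de y + fA c e f x * de y ^ 2

theorem psi_symm (a b c d e f : F) (x y : Option F) : psi a b c d e f x y = psi a b c d e f y x := by
  unfold psi fA; ring

def Base (a b c d e f : F) (x : Option F) : Prop :=
  fA a b c x = 0 ∧ fA b (c + d) e x = 0 ∧ fA c e f x = 0

def Trip (a b c d e f : F) : Prop :=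
  ∃ x y z : Option F, x ≠ y ∧ x ≠ z ∧ y ≠ z ∧ psi a b c d e f x y = 0 ∧ psi a b c d e f x z = 0 ∧
    ¬ Base a b c d e f x

def ZT (a b c d e f : F) : Prop :=
  (2 : F) = 0 ∧ a = 0 ∧ f = 0 ∧ ((b ≠ 0 ∧ d = c ∧ b * e = c ^ 2) ∨ (b = 0 ∧ c = 0 ∧ d = 0 ∧ e ≠ 0))

theorem quad_two (A B C : F) (h : wt B (A * C) = 2) :
    ∃ y z : Option F, y ≠ z ∧ A * nu y ^ 2 + B * nu y * de y + C * de y ^ 2 = 0 ∧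
      A * nu z ^ 2 + B * nu z * de z + C * de z ^ 2 = 0 := by
  unfold wt at h
  split_ifs at h with h1 h2
  · omega
  obtain ⟨z, hz⟩ := h2
  by_cases hA : A = 0
  · subst hA
    have hB : B ≠ 0 := by rintro rfl; simp at h1
    refine ⟨none, some (-C / B), by simp, by simp [nu, de], ?_⟩
    simp only [nu, de]; field_simp; ring
  · refine ⟨some (z / A), some ((-B - z) / A), ?_, ?_, ?_⟩
    · intro h
      simp only [Option.some.injEq] at h
      field_simp at h
      apply h1
      linear_combination (2 * z + B) * h - 4 * hz
    · simp only [nu, de]; field_simp; linear_combination hz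
    · simp only [nu, de]; field_simp; linear_combination hz

theorem quad_one [Finite F] (A B C : F) (h0 : ¬ (A = 0 ∧ B = 0 ∧ C = 0)) (h : wt B (A * C) = 1) :
    ∃ (y : Option F) (k : F), k ≠ 0 ∧ A = k * de y ^ 2 ∧ B = - 2 * k * nu y * de y ∧
      C = k * nu y ^ 2 := by
  unfold wt at h
  split_ifs at h with h1 h2
  swap
  · omega
  by_cases hA : A = 0
  · subst hA
    have hB : B = 0 := by
      have : B ^ 2 = 0 := by rw [h1]; ring
      exact pow_eq_zero_iff two_ne_zero |>.1 this
    subst hB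
    exact ⟨none, C, by tauto, by simp [de], by simp [de], by simp [nu]⟩
  · have key : ∃ y, B = -2 * A * y ∧ C = A * y ^ 2 := by
      by_cases h2 : (2 : F) = 0
      · have hB : B = 0 := by
          have : B ^ 2 = 0 := by rw [h1]; linear_combination 2 * (A * C) * h2
          exact pow_eq_zero_iff two_ne_zero |>.1 this
        have : CharP F 2 := CharTwo.of_one_ne_zero_of_two_eq_zero one_ne_zero h2
        have hsq : ∃ y, y * y = C / A := by
          obtain ⟨y, hy⟩ := FiniteField.isSquare_of_char_two (ringChar.eq F 2 ▸ rfl) (C / A)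
          exact ⟨y, hy.symm⟩
        obtain ⟨y, hy⟩ := hsq
        refine ⟨y, by rw [hB]; linear_combination A * y * h2, ?_⟩
        field_simp at hy; linear_combination -hy
      · refine ⟨-B / (2 * A), by field_simp, ?_⟩
        have h4 : (4 : F) ≠ 0 := by
          have : (4 : F) = 2 * 2 := by norm_num
          rw [this]; exact mul_ne_zero h2 h2
        field_simp
        have : (2 : F) ^ 2 = 4 := by norm_num
        linear_combination -h1 + A * C * this
    obtain ⟨y, hB, hC⟩ := key
    exact ⟨some y, A, hA, by simp [de], by simpa [nu, de] using hB, by simpa [nu] using hC⟩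

theorem double_root (a b c d e f : F) (hpl : a * f - b * e + c * d = 0) (x y : Option F) (k : F)
    (hk : k ≠ 0)
    (h1 : fA a b c x = k * de y ^ 2) (h2 : fA b (c + d) e x = - 2 * k * nu y * de y)
    (h3 : fA c e f x = k * nu y ^ 2) : psi a b c d e f y y = 0 := by
  apply mul_left_cancel₀ hk
  rw [mul_zero]
  unfold psi fA at *
  rcases x with _ | x <;> rcases y with _ | y <;> simp only [nu, de] at *
  · have ha : a = 0 := by linear_combination h1
    have hb : b = 0 := by linear_combination h2
    have hc : c = k := by linear_combination h3
    subst ha hb hc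
    linear_combination 0 * hpl
  · have ha : a = k := by linear_combination h1
    subst ha
    have hb : b = -2 * a * y := by linear_combination h2
    have hc : c = a * y ^ 2 := by linear_combination h3
    subst hb hc
    linear_combination hpl
  · have hc : c = - a * x ^ 2 - b * x := by linear_combination h1
    have he : e = - b * x ^ 2 - (c + d) * x := by linear_combination h2
    have hf : f = k - c * x ^ 2 - e * x := by linear_combination h3
    subst hf he hc
    linear_combination hpl
  · have hc : c = k - a * x ^ 2 - b * x := by linear_combination h1
    have he : e = -2 * k * y - b * x ^ 2 - (c + d) * x := by linear_combination h2
    have hf : f = k * y ^ 2 - c * x ^ 2 - e * x := by linear_combination h3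
    subst hf he hc
    linear_combination (x - y) ^ 2 * hpl

open Classical in
theorem card_zeros [Fintype F] (P : F[X]) (n : ℕ) (hP : P ≠ 0) (hn : P.natDegree ≤ n)
    (S : Finset (Option F)) (h1 : ∀ t, some t ∈ S → P.eval t = 0) (h2 : none ∈ S → P.coeff n = 0) :
    S.card ≤ n := by
  have e1 : S.eraseNone.card ≤ P.natDegree := by
    refine le_trans ?_ (P.card_roots')
    refine le_trans (Finset.card_le_card ?_) (Multiset.toFinset_card_le _)
    intro t ht
    rw [Finset.mem_eraseNone] at ht
    simp [hP, h1 t ht]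
  by_cases hS : none ∈ S
  · have hlt : P.natDegree < n := by
      refine lt_of_le_of_ne hn ?_
      intro h
      have := h2 hS
      rw [← h] at this
      exact hP (leadingCoeff_eq_zero.1 this)
    have : S.card = S.eraseNone.card + 1 := by
      rw [Finset.card_eraseNone_of_mem hS]
      have := Finset.card_pos.2 ⟨_, hS⟩
      omega
    omega
  · rw [Finset.card_eraseNone_of_not_mem hS] at e1
    omega

end

end TC


namespace TC

open Polynomial

section
variable {F : Type} [Field F] [Fintype F]

theorem NN_eq (a b c d e f : F) :
    NN a b c d e f = ∑ x : Option F, wt (fA b (c + d) e x) (fA a b c x * fA c e f x) := by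
  rw [Fintype.sum_option]
  unfold NN fA
  simp only [nu, de]
  rw [add_comm]
  congr 1
  · congr 1 <;> ring
  · apply Finset.sum_congr rfl; intro x _; congr 1 <;> ring

open Classical in
theorem NN_le (a b c d e f : F) (hpl : a * f - b * e + c * d = 0)
    (hbase : ∀ x, ¬ Base a b c d e f x) (hT : ¬ Trip a b c d e f)
    (hW : ¬ (a = 0 ∧ 2 * b = 0 ∧ 3 * c + d = 0 ∧ 2 * e = 0 ∧ f = 0)) :
    NN a b c d e f ≤ 12 := by
  rw [NN_eq]
  set w : Option F → ℕ := fun x => wt (fA b (c + d) e x) (fA a b c x * fA c e f x) with hw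
  let ZW : Finset (Option F) := Finset.univ.filter (fun x => psi a b c d e f x x = 0)
  let S2 : Finset (Option F) := Finset.univ.filter (fun x => psi a b c d e f x x ≠ 0 ∧ w x = 1)
  have hT' : ∀ x y z, x ≠ y → x ≠ z → y ≠ z → psi a b c d e f x y = 0 → psi a b c d e f x z = 0 → False :=
    fun x y z h1 h2 h3 h4 h5 => hT ⟨x, y, z, h1, h2, h3, h4, h5, hbase x⟩
  have hZW : ZW.card ≤ 4 := by
    let P : F[X] := qt a (2 * b) (3 * c + d) (2 * e) f
    have hc : P.coeff 4 = a ∧ P.coeff 3 = 2 * b ∧ P.coeff 2 = 3 * c + d ∧ P.coeff 1 = 2 * e ∧ P.coeff 0 = f := by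
      simp only [P, qt, coeff_add, coeff_C_mul, coeff_X_pow, coeff_X, coeff_C]
      norm_num
    have hP : P ≠ 0 := by
      intro h
      rw [h] at hc
      simp only [coeff_zero] at hc
      obtain ⟨h1, h2, h3, h4, h5⟩ := hc
      exact hW ⟨h1.symm, h2.symm, h3.symm, h4.symm, h5.symm⟩
    apply card_zeros P 4 hP (qt_deg _ _ _ _ _)
    · intro t ht
      have := (Finset.mem_filter.1 ht).2
      simp only [psi, fA, nu, de] at this
      rw [eval_qt]; linear_combination this
    · intro h
      have := (Finset.mem_filter.1 h).2
      simp only [psi, fA, nu, de] at this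
      rw [hc.1]; linear_combination this
  have h2 : ∀ x, w x = 2 → psi a b c d e f x x = 0 := by
    intro x hx
    obtain ⟨y, z, hyz, hy, hz⟩ := quad_two _ _ _ hx
    change psi a b c d e f x y = 0 at hy
    change psi a b c d e f x z = 0 at hz
    by_cases hxy : x = y
    · rw [← hxy] at hy; exact hy
    by_cases hxz : x = z
    · rw [← hxz] at hz; exact hz
    exact (hT' x y z hxy hxz hyz hy hz).elim
  have h1 : ∀ x ∈ S2, ∃ y ∈ ZW, x ≠ y ∧ psi a b c d e f y x = 0 := by
    intro x hx
    obtain ⟨hx0, hx1⟩ := (Finset.mem_filter.1 hx).2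
    obtain ⟨y, k, hk, e1, e2, e3⟩ := quad_one _ _ _ (hbase x) hx1
    have hyy := double_root a b c d e f hpl x y k hk e1 e2 e3
    have hxy : psi a b c d e f x y = 0 := by
      unfold psi; rw [e1, e2, e3]; ring
    refine ⟨y, by simp [ZW, hyy], ?_, by rw [psi_symm]; exact hxy⟩
    rintro rfl; exact hx0 hxy
  choose! g hg using h1
  have hS2 : S2.card ≤ ZW.card := by
    apply Finset.card_le_card_of_injOn g (fun x hx => (hg x hx).1)
    intro x hx x' hx' hxx
    by_contra hne
    obtain ⟨_, k1, k2⟩ := hg x hx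
    obtain ⟨_, k3, k4⟩ := hg x' hx'
    rw [← hxx] at k3 k4
    exact hT' (g x) x x' k1.symm k3.symm hne k2 k4
  have hsum : ∑ x, w x ≤ 2 * ZW.card + S2.card := by
    rw [Finset.card_filter, Finset.card_filter, Finset.mul_sum, ← Finset.sum_add_distrib]
    apply Finset.sum_le_sum
    intro x _
    have hle := wt_le (fA b (c + d) e x) (fA a b c x * fA c e f x)
    change w x ≤ 2 at hle
    have := h2 x
    by_cases hz : psi a b c d e f x x = 0
    · simp [hz]; exact hle
    · simp [hz]
      have : w x ≠ 2 := fun h => hz (this h)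
      split_ifs <;> omega
  exact le_trans hsum (by omega)

theorem W_zero (a b c d e f : F) (hpl : a * f - b * e + c * d = 0)
    (hbase : ∀ x, ¬ Base a b c d e f x)
    (hW : a = 0 ∧ 2 * b = 0 ∧ 3 * c + d = 0 ∧ 2 * e = 0 ∧ f = 0) : Z3 a b c d e f := by
  obtain ⟨rfl, hb, hd, he, rfl⟩ := hW
  have hd : d = - 3 * c := by linear_combination hd
  subst hd
  by_cases h2 : (2 : F) = 0
  · exfalso
    by_cases hb0 : b = 0
    · subst hb0
      have hc : c = 0 := by
        have : c ^ 2 = 0 := by linear_combination hpl + 2 * c ^ 2 * h2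
        exact pow_eq_zero_iff two_ne_zero |>.1 this
      subst hc
      exact hbase none (by simp [Base, fA, nu, de])
    · obtain ⟨r, rfl⟩ : ∃ r, c = b * r := ⟨c / b, by field_simp⟩
      have he : e = b * r ^ 2 := by
        apply mul_left_cancel₀ hb0; linear_combination -hpl - 2 * (b * r) ^ 2 * h2
      apply hbase (some r)
      subst he
      simp only [Base, fA, nu, de]
      refine ⟨?_, ?_, ?_⟩
      · linear_combination b * r * h2
      · linear_combination 0 * h2
      · linear_combination b * r ^ 3 * h2
  · have hb : b = 0 := by simpa [h2] using hb
    have he : e = 0 := by simpa [h2] using he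
    subst hb he
    have hc : c ≠ 0 := by
      rintro rfl
      exact hbase none (by simp [Base, fA, nu, de])
    have h3 : (3 : F) = 0 := by
      have : c ^ 2 * 3 = 0 := by linear_combination -hpl
      simpa [hc] using this
    refine ⟨rfl, rfl, hc, by rw [h3]; ring, rfl, rfl, ?_⟩
    intro T hT
    have : (T - 1) ^ 2 = 0 := by linear_combination hT - T * h3
    have := pow_eq_zero_iff two_ne_zero |>.1 this
    linear_combination this

theorem exists_nonroot (P : F[X]) (n : ℕ) (hn : n < Fintype.card F) (hP : P ≠ 0) (hd : P.natDegree ≤ n) :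
    ∃ x, P.eval x ≠ 0 := by
  by_contra! h
  apply hP
  exact eq_zero_of_natDegree_lt_card_of_eval_eq_zero' P Finset.univ (fun i _ => h i)
    (by rw [Finset.card_univ]; omega)

theorem qd_ne {a b c : F} (h : ¬ (a = 0 ∧ b = 0 ∧ c = 0)) : qd a b c ≠ 0 := by
  intro h'
  obtain ⟨h1, h2, h3⟩ := qd_coeffs a b c
  rw [h'] at h1 h2 h3
  exact h ⟨h1.symm, h2.symm, h3.symm⟩

theorem base_fin (hq : 23 ≤ Fintype.card F) (a b c d e f r : F)
    (hr : Base a b c d e f (some r)) (hT : ¬ Trip a b c d e f) : ZC a b c d e f ∨ ZT a b c d e f := by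
  obtain ⟨h1, h2, h3⟩ := hr
  simp only [fA, nu, de] at h1 h2 h3
  obtain ⟨b', hb'⟩ : ∃ b', b' = b + a * r := ⟨_, rfl⟩
  obtain ⟨n, hn⟩ : ∃ n, n = d + b * r := ⟨_, rfl⟩
  have hb : b = b' - a * r := by linear_combination -hb'
  have hc : c = - r * b' := by rw [hb']; linear_combination h1
  have hd : d = n - r * b' + r ^ 2 * a := by rw [hb', hn]; ring
  have he : e = - r * n + r ^ 2 * b' := by rw [hb', hn]; linear_combination h2 - r * h1
  have hf : f = r ^ 2 * n := by rw [hn]; linear_combination h3 - r * h2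
  clear hb' hn h1 h2 h3
  subst hb hc hd he hf
  by_cases hm : a * n = b' ^ 2
  · left
    refine ⟨?_, ?_, ?_, ?_, ?_, ?_⟩
    · linear_combination hm
    · linear_combination -r * hm
    · linear_combination r ^ 2 * hm
    · linear_combination r ^ 2 * hm
    · linear_combination -r ^ 3 * hm
    · linear_combination r ^ 4 * hm
  · right
    by_cases h0 : a = 0 ∧ 2 * b' = 0 ∧ n = 0
    · obtain ⟨rfl, h2, rfl⟩ := h0
      have hb0 : b' ≠ 0 := by rintro rfl; exact hm (by ring)
      have h2 : (2 : F) = 0 := by simpa [hb0] using h2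
      exact ⟨h2, rfl, by ring, Or.inl ⟨by simpa using hb0, by ring, by ring⟩⟩
    · exfalso
      obtain ⟨x, hx⟩ := exists_nonroot
        (qd 0 1 (-r) * qd 0 a b' * qd a (2 * b') n * qd 0 (b' + a * r) (n + b' * r)) 8 (by omega)
        (mul_ne_zero (mul_ne_zero (mul_ne_zero (qd_ne (by simp)) (qd_ne (by
            rintro ⟨-, rfl, rfl⟩; exact hm (by ring)))) (qd_ne h0)) (qd_ne (by
            rintro ⟨-, h, h'⟩
            apply hm
            linear_combination a * h' - b' * h)))
        (natDegree_mul_le' _ (natDegree_mul_le' _ (natDegree_mul_le' _ (qd_deg _ _ _) (qd_deg _ _ _) le_rfl)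
          (qd_deg _ _ _) le_rfl) (qd_deg _ _ _) le_rfl)
      rw [eval_mul, eval_mul, eval_mul] at hx
      simp only [eval_qd] at hx
      obtain ⟨hx, x4⟩ := mul_ne_zero_iff.1 hx
      obtain ⟨hx, x3⟩ := mul_ne_zero_iff.1 hx
      obtain ⟨x1, x2⟩ := mul_ne_zero_iff.1 hx
      have x2' : a * x + b' ≠ 0 := by
        intro h; apply x2; linear_combination h
      have x1' : x ≠ r := by
        intro h; apply x1; linear_combination h
      apply hT
      refine ⟨some x, some (-(b' * x + n) / (a * x + b')), some r, ?_, ?_, ?_, ?_, ?_, ?_⟩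
      · intro h
        rw [Option.some.injEq, eq_div_iff x2'] at h
        apply x3; linear_combination h
      · simpa using x1'
      · intro h
        rw [Option.some.injEq, div_eq_iff x2'] at h
        apply x4; linear_combination -h
      · simp only [psi, fA, nu, de]
        field_simp
        ring
      · simp only [psi, fA, nu, de]
        ring
      · rintro ⟨h, -, -⟩
        simp only [fA, nu, de] at h
        apply mul_ne_zero x2' (sub_ne_zero.2 x1')
        linear_combination h

theorem base_inf (hq : 23 ≤ Fintype.card F) (a b c d e f : F)
    (hr : Base a b c d e f none) (hT : ¬ Trip a b c d e f) : ZC a b c d e f ∨ ZT a b c d e f := by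
  obtain ⟨h1, h2, h3⟩ := hr
  simp only [fA, nu, de] at h1 h2 h3
  have ha : a = 0 := by linear_combination h1
  have hb : b = 0 := by linear_combination h2
  have hc : c = 0 := by linear_combination h3
  clear h1 h2 h3
  subst ha hb hc
  by_cases hm : d * f = e ^ 2
  · left
    refine ⟨?_, ?_, ?_, ?_, ?_, ?_⟩
    · ring
    · ring
    · ring
    · ring
    · ring
    · linear_combination hm
  · right
    by_cases h0 : d = 0 ∧ 2 * e = 0 ∧ f = 0
    · obtain ⟨rfl, h2, rfl⟩ := h0
      have hb0 : e ≠ 0 := by rintro rfl; exact hm (by ring)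
      have h2 : (2 : F) = 0 := by simpa [hb0] using h2
      exact ⟨h2, rfl, rfl, Or.inr ⟨rfl, rfl, rfl, hb0⟩⟩
    · exfalso
      obtain ⟨x, hx⟩ := exists_nonroot
        (qd 0 d e * qd d (2 * e) f) 4 (by omega)
        (mul_ne_zero (qd_ne (by
            rintro ⟨-, rfl, rfl⟩; exact hm (by ring))) (qd_ne h0))
        (natDegree_mul_le' _ (qd_deg _ _ _) (qd_deg _ _ _) le_rfl)
      rw [eval_mul] at hx
      simp only [eval_qd] at hx
      obtain ⟨x2, x3⟩ := mul_ne_zero_iff.1 hx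
      have x2' : d * x + e ≠ 0 := by
        intro h; apply x2; linear_combination h
      apply hT
      refine ⟨some x, some (-(e * x + f) / (d * x + e)), none, ?_, ?_, ?_, ?_, ?_, ?_⟩
      · intro h
        rw [Option.some.injEq, eq_div_iff x2'] at h
        apply x3; linear_combination h
      · simp
      · simp
      · have hy : -(e * x + f) / (d * x + e) * (d * x + e) = -(e * x + f) := div_mul_cancel₀ _ x2'
        simp only [psi, fA, nu, de]
        linear_combination hy
      · simp only [psi, fA, nu, de]
        ring
      · rintro ⟨-, h, -⟩
        simp only [fA, nu, de] at h
        apply x2'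
        linear_combination h

/-- The hard direction. -/
theorem hard (hq : 23 ≤ Fintype.card F) (a b c d e f : F) (hpl : a * f - b * e + c * d = 0)
    (hT : ¬ Trip a b c d e f) :
    ZC a b c d e f ∨ ZT a b c d e f ∨ ZF1 a b c d e f ∨ ZF2 a b c d e f ∨ Z3 a b c d e f := by
  by_cases hb : ∃ x, Base a b c d e f x
  · obtain ⟨x, hx⟩ := hb
    cases x with
    | none => rcases base_inf hq a b c d e f hx hT with h | h <;> tauto
    | some r => rcases base_fin hq a b c d e f r hx hT with h | h <;> tauto
  · push Not at hb
    by_cases hW : a = 0 ∧ 2 * b = 0 ∧ 3 * c + d = 0 ∧ 2 * e = 0 ∧ f = 0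
    · have := W_zero a b c d e f hpl hb hW; tauto
    · have hN := NN_le a b c d e f hpl hb hT hW
      have := descent hq a b c d e f ?_ hpl ?_ hN
      · tauto
      · rintro ⟨rfl, rfl, rfl⟩
        exact hb none (by simp [Base, fA, nu, de])
      · rintro y ⟨h1, h2, h3⟩
        apply hb (some y)
        simp only [Base, fA, nu, de]
        exact ⟨by linear_combination h1, by linear_combination h2, by linear_combination h3⟩

end

end TC


namespace TC

open Polynomial

section
variable {F : Type} [Field F]

/-- three points with pairwise vanishing form -/
def PT (a b c d e f : F) : Prop :=
  ∃ x y z : Option F, x ≠ y ∧ x ≠ z ∧ y ≠ z ∧ psi a b c d e f x y = 0 ∧ psi a b c d e f x z = 0 ∧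
    psi a b c d e f y z = 0

def Bad (a b c d e f : F) : Prop :=
  ZC a b c d e f ∨ ZT a b c d e f ∨ ZF1 a b c d e f ∨ ZF2 a b c d e f ∨ Z3 a b c d e f

theorem two_of_three (G : Option F → Prop) {x y z : Option F} (h1 : G x ∨ G y) (h2 : G x ∨ G z)
    (h3 : G y ∨ G z) : (G x ∧ G y) ∨ (G x ∧ G z) ∨ (G y ∧ G z) := by tauto

theorem ZF1_not (a b c d e f : F) (h : ZF1 a b c d e f) (x y : Option F) (hxy : x ≠ y) :
    psi a b c d e f x y ≠ 0 := by
  obtain ⟨ha, hirr, r1, r2, r3⟩ := h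
  intro hp
  have hv := det_ne hxy
  obtain ⟨v, hv'⟩ : ∃ v, v = nu x * de y - nu y * de x := ⟨_, rfl⟩
  obtain ⟨U, hU⟩ : ∃ U, U = a ^ 2 * (nu x * nu y) + a * b * (nu y * de x) + (b ^ 2 - 3 * a * c) * (de x * de y) :=
    ⟨_, rfl⟩
  rw [← hv'] at hv
  have key : U ^ 2 + b * U * (a * v) + a * c * (a * v) ^ 2 = 0 := by
    rw [hU, hv']
    unfold psi fA at hp
    linear_combination a ^ 3 * hp - a ^ 2 * (nu x * nu y * de x * de y) * r1
      - a * (nu x * de y + nu y * de x) * de x * de y * r2 - de x ^ 2 * de y ^ 2 * r3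
  apply hirr (-U / (a * v))
  field_simp
  linear_combination key

theorem ZF2_not (a b c d e f : F) (h : ZF2 a b c d e f) (x y : Option F) (hxy : x ≠ y) :
    psi a b c d e f x y ≠ 0 := by
  obtain ⟨rfl, rfl, rfl, hf, r1, hirr⟩ := h
  intro hp
  have hv := det_ne hxy
  obtain ⟨v, hv'⟩ : ∃ v, v = nu x * de y - nu y * de x := ⟨_, rfl⟩
  obtain ⟨U, hU⟩ : ∃ U, U = e * (nu y * de x) + f * (de x * de y) :=
    ⟨_, rfl⟩
  rw [← hv'] at hv
  have key : U ^ 2 + e * U * v + c * f * v ^ 2 = 0 := by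
    rw [hU, hv']
    unfold psi fA at hp
    linear_combination f * hp + (nu x * nu y * de x * de y) * r1
  apply hirr (-U / v)
  field_simp
  linear_combination key

theorem Z3_not (a b c d e f : F) (h : Z3 a b c d e f) (x y : Option F) (hxy : x ≠ y) :
    psi a b c d e f x y ≠ 0 := by
  obtain ⟨rfl, rfl, hc, rfl, rfl, rfl, hT⟩ := h
  intro hp
  have hv := det_ne hxy
  obtain ⟨s, hs⟩ : ∃ s, s = nu x * de y := ⟨_, rfl⟩
  obtain ⟨t, ht⟩ : ∃ t, t = nu y * de x := ⟨_, rfl⟩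
  have key : s ^ 2 + s * t + t ^ 2 = 0 := by
    apply mul_left_cancel₀ hc
    rw [hs, ht]
    unfold psi fA at hp
    linear_combination hp
  rw [← hs, ← ht] at hv
  by_cases h0 : t = 0
  · subst h0
    have : s ^ 2 = 0 := by linear_combination key
    have := pow_eq_zero_iff two_ne_zero |>.1 this
    exact hv (by rw [this]; ring)
  · have := hT (s / t) (by field_simp; linear_combination key)
    field_simp at this
    exact hv (by rw [this]; ring)

theorem ZT_not (a b c d e f : F) (h : ZT a b c d e f) : ¬ PT a b c d e f := by
  rintro ⟨x, y, z, hxy, hxz, hyz, p1, p2, p3⟩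
  obtain ⟨h2, rfl, rfl, h⟩ := h
  have hp : ∀ x y : Option F, x ≠ y → nu x * de y + nu y * de x ≠ 0 := by
    intro x y hxy h
    apply det_ne hxy
    linear_combination h - nu y * de x * h2
  rcases h with ⟨hb, rfl, hbe⟩ | ⟨rfl, rfl, rfl, he⟩
  · have hG : ∀ x y : Option F, x ≠ y → psi 0 b d d e 0 x y = 0 →
        b * nu x + d * de x = 0 ∨ b * nu y + d * de y = 0 := by
      intro x y hxy h
      have := hp x y hxy
      unfold psi fA at h
      have h' : (b * nu x + d * de x) * (b * nu y + d * de y) * (nu x * de y + nu y * de x) = 0 := by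
        linear_combination b * h - (nu x * de y + nu y * de x) * de x * de y * hbe
      rcases mul_eq_zero.1 h' with h | h
      · exact mul_eq_zero.1 h
      · exact absurd h this
    have hD : ∀ x y : Option F, x ≠ y → ¬ (b * nu x + d * de x = 0 ∧ b * nu y + d * de y = 0) := by
      rintro x y hxy ⟨h1, h2⟩
      apply det_ne hxy
      apply mul_left_cancel₀ hb
      linear_combination de y * h1 - de x * h2
    have := two_of_three (fun x => b * nu x + d * de x = 0) (hG x y hxy p1) (hG x z hxz p2) (hG y z hyz p3)
    have d1 := hD x y hxy
    have d2 := hD x z hxz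
    have d3 := hD y z hyz
    tauto
  · have hG : ∀ x y : Option F, x ≠ y → psi 0 0 0 0 e 0 x y = 0 → de x = 0 ∨ de y = 0 := by
      intro x y hxy h
      have := hp x y hxy
      unfold psi fA at h
      have h' : (e * de x) * (de y) * (nu x * de y + nu y * de x) = 0 := by
        linear_combination h
      rcases mul_eq_zero.1 h' with h | h
      · simpa [he] using h
      · exact absurd h this
    have hD : ∀ x y : Option F, x ≠ y → ¬ (de x = 0 ∧ de y = 0) := by
      rintro x y hxy ⟨h1, h2⟩
      apply det_ne hxy
      linear_combination nu x * h2 - nu y * h1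
    have := two_of_three (fun x => de x = 0) (hG x y hxy p1) (hG x z hxz p2) (hG y z hyz p3)
    have d1 := hD x y hxy
    have d2 := hD x z hxz
    have d3 := hD y z hyz
    tauto

theorem ZC_param (a b c d e f : F) (h : ZC a b c d e f)
    (h0 : ¬ (a = 0 ∧ b = 0 ∧ c = 0 ∧ d = 0 ∧ e = 0 ∧ f = 0)) :
    ∃ l s t u : F, l ≠ 0 ∧ a = l * s ^ 2 ∧ b = l * s * t ∧ c = l * s * u ∧ c + d = l * t ^ 2 ∧
      e = l * t * u ∧ f = l * u ^ 2 := by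
  obtain ⟨h1, h2, h3, h4, h5, h6⟩ := h
  by_cases ha : a = 0
  · subst ha
    have hb : b = 0 := pow_eq_zero_iff two_ne_zero |>.1 (show b ^ 2 = 0 by linear_combination -h1)
    have hc : c = 0 := pow_eq_zero_iff two_ne_zero |>.1 (show c ^ 2 = 0 by linear_combination -h3)
    subst hb hc
    by_cases hd : d = 0
    · subst hd
      have he : e = 0 := pow_eq_zero_iff two_ne_zero |>.1 (show e ^ 2 = 0 by linear_combination -h6)
      subst he
      refine ⟨f, 0, 0, 1, by tauto, by ring, by ring, by ring, by ring, by ring, by ring⟩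
    · refine ⟨1 / d, 0, d, e, by simpa using hd, by ring, by ring, by ring, by field_simp; ring, by field_simp, ?_⟩
      field_simp; linear_combination h6
  · refine ⟨1 / a, a, b, c, by simpa using ha, by field_simp, by field_simp, by field_simp, ?_, ?_, ?_⟩
    · field_simp; linear_combination h1
    · field_simp; linear_combination h2
    · field_simp; linear_combination h3

theorem ZC_chord (a b c d e f : F) (h : ZC a b c d e f)
    (h0 : ¬ (a = 0 ∧ b = 0 ∧ c = 0 ∧ d = 0 ∧ e = 0 ∧ f = 0)) (hp : PT a b c d e f) :
    ∃ x y, x ≠ y ∧ Base a b c d e f x ∧ Base a b c d e f y := by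
  obtain ⟨l, s, t, u, hl, ha, hb, hc, hd, he, hf⟩ := ZC_param a b c d e f h h0
  obtain ⟨x, y, z, hxy, hxz, hyz, p1, p2, p3⟩ := hp
  have hG : ∀ x y : Option F, psi a b c d e f x y = 0 → fA s t u x = 0 ∨ fA s t u y = 0 := by
    intro x y h
    unfold psi fA at h
    rw [hd, ha, hb, hc, he, hf] at h
    have : l * (fA s t u x * fA s t u y) = 0 := by unfold fA; linear_combination h
    simpa [hl] using this
  have hB : ∀ x, fA s t u x = 0 → Base a b c d e f x := by
    intro x h
    unfold fA at h
    unfold Base fA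
    rw [hd, ha, hb, hc, he, hf]
    exact ⟨by linear_combination l * s * h, by linear_combination l * t * h, by linear_combination l * u * h⟩
  rcases two_of_three (fun x => fA s t u x = 0) (hG x y p1) (hG x z p2) (hG y z p3) with h | h | h
  · exact ⟨x, y, hxy, hB _ h.1, hB _ h.2⟩
  · exact ⟨x, z, hxz, hB _ h.1, hB _ h.2⟩
  · exact ⟨y, z, hyz, hB _ h.1, hB _ h.2⟩

theorem chord_inf (a b c d e f y : F) (h1 : Base a b c d e f none) (h2 : Base a b c d e f (some y)) :
    ZC a b c d e f := by
  obtain ⟨h1, h2, h3⟩ := h1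
  simp only [fA, nu, de] at h1 h2 h3
  have ha : a = 0 := by linear_combination h1
  have hb : b = 0 := by linear_combination h2
  have hc : c = 0 := by linear_combination h3
  clear h1 h2 h3
  subst ha hb hc
  obtain ⟨-, h1, h2⟩ := h2
  simp only [fA, nu, de] at h1 h2
  have he : e = - d * y := by linear_combination h1
  have hf : f = - e * y := by linear_combination h2
  subst hf he
  refine ⟨by ring, by ring, by ring, by ring, by ring, by ring⟩

theorem chord_ZC (a b c d e f : F) (x y : Option F) (hxy : x ≠ y) (h1 : Base a b c d e f x)
    (h2 : Base a b c d e f y) : ZC a b c d e f := by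
  rcases x with _ | x <;> rcases y with _ | y
  · exact absurd rfl hxy
  · exact chord_inf a b c d e f y h1 h2
  · exact chord_inf a b c d e f x h2 h1
  · obtain ⟨a1, a2, a3⟩ := h1
    obtain ⟨b1, b2, b3⟩ := h2
    simp only [fA, nu, de] at a1 a2 a3 b1 b2 b3
    have hne : x - y ≠ 0 := sub_ne_zero.2 (by simpa using hxy)
    have key : ∀ u v w : F, u * x ^ 2 + v * x * 1 + w * 1 ^ 2 = 0 → u * y ^ 2 + v * y * 1 + w * 1 ^ 2 = 0 →
        v = - u * (x + y) ∧ w = u * (x * y) := by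
      intro u v w e1 e2
      have hv : v = - u * (x + y) := by
        apply mul_left_cancel₀ hne
        linear_combination e1 - e2
      refine ⟨hv, ?_⟩
      rw [hv] at e1
      linear_combination e1
    obtain ⟨k1, k2⟩ := key _ _ _ a1 b1
    obtain ⟨k3, k4⟩ := key _ _ _ a2 b2
    obtain ⟨k5, k6⟩ := key _ _ _ a3 b3
    have k3 : d = - b * (x + y) - c := by linear_combination k3
    rw [k6, k3, k4, k2, k1]
    refine ⟨by ring, by ring, by ring, by ring, by ring, by ring⟩

/-- bad tuples: contained in no 3-plane or a real chord -/
theorem bad_dir (a b c d e f : F) (h0 : ¬ (a = 0 ∧ b = 0 ∧ c = 0 ∧ d = 0 ∧ e = 0 ∧ f = 0))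
    (h : Bad a b c d e f) (hp : PT a b c d e f) :
    ∃ x y, x ≠ y ∧ Base a b c d e f x ∧ Base a b c d e f y := by
  rcases h with h | h | h | h | h
  · exact ZC_chord a b c d e f h h0 hp
  · exact absurd hp (ZT_not a b c d e f h)
  · obtain ⟨x, y, z, hxy, -, -, h1, -⟩ := hp
    exact absurd h1 (ZF1_not a b c d e f h x y hxy)
  · obtain ⟨x, y, z, hxy, -, -, h1, -⟩ := hp
    exact absurd h1 (ZF2_not a b c d e f h x y hxy)
  · obtain ⟨x, y, z, hxy, -, -, h1, -⟩ := hp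
    exact absurd h1 (Z3_not a b c d e f h x y hxy)

theorem ZC_ZF1 [Finite F] (a b c d e f : F) (h : ZC a b c d e f) (h' : ZF1 a b c d e f) : False := by
  obtain ⟨h1, h2, h3, -⟩ := h
  obtain ⟨ha, hirr, r1, r2, r3⟩ := h'
  have e1 : 2 * (b ^ 2 - 4 * (a * c)) = 0 := by linear_combination h1 - r1
  have e2 : b * (b ^ 2 - 4 * (a * c)) = 0 := by linear_combination a * h2 - r2
  have e3 : (b ^ 2 - 4 * (a * c)) * (b ^ 2 - 2 * (a * c)) = 0 := by linear_combination a ^ 2 * h3 - r3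
  have e4 : b ^ 2 - 4 * (a * c) = 0 := by
    by_contra hne
    have hb : b = 0 := by simpa [hne] using e2
    have h2 : (2 : F) = 0 := by simpa [hne] using e1
    apply hne; rw [hb]; linear_combination -2 * (a * c) * h2
  have hw : wt (-b) (1 * (a * c)) = 1 := wt_pos (by linear_combination e4)
  obtain ⟨y, k, hk, k1, k2, k3⟩ := quad_one 1 (-b) (a * c) (by simp) hw
  rcases y with _ | t
  · simp [de] at k1
  · simp only [nu, de] at k1 k2 k3
    have hk1 : k = 1 := by linear_combination -k1
    subst hk1
    apply hirr t
    rw [k3]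
    linear_combination t * k2

end

end TC


namespace TC

open Polynomial

section
variable {F : Type} [Field F]

/-- the line with given coordinates -/
def ln (a b c d e f : F) : Submodule F (Fin 4 → F) where
  carrier := {u | c * u 0 + e * u 1 + f * u 2 = 0 ∧ - b * u 0 - d * u 1 + f * u 3 = 0 ∧
    a * u 0 - d * u 2 - e * u 3 = 0 ∧ a * u 1 + b * u 2 + c * u 3 = 0}
  zero_mem' := by simp
  add_mem' := by
    rintro u v ⟨h1, h2, h3, h4⟩ ⟨k1, k2, k3, k4⟩
    simp only [Set.mem_ofPred_eq, Pi.add_apply]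
    exact ⟨by linear_combination h1 + k1, by linear_combination h2 + k2, by linear_combination h3 + k3,
      by linear_combination h4 + k4⟩
  smul_mem' := by
    rintro s u ⟨h1, h2, h3, h4⟩
    simp only [Set.mem_ofPred_eq, Pi.smul_apply, smul_eq_mul]
    exact ⟨by linear_combination s * h1, by linear_combination s * h2, by linear_combination s * h3,
      by linear_combination s * h4⟩

theorem mem_ln {a b c d e f : F} {u : Fin 4 → F} : u ∈ ln a b c d e f ↔
    c * u 0 + e * u 1 + f * u 2 = 0 ∧ - b * u 0 - d * u 1 + f * u 3 = 0 ∧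
    a * u 0 - d * u 2 - e * u 3 = 0 ∧ a * u 1 + b * u 2 + c * u 3 = 0 := Iff.rfl

/-- tuple of coordinates of the line spanned by two vectors -/
def Pco (v w : Fin 4 → F) (a b c d e f : F) : Prop :=
  a = v 2 * w 3 - v 3 * w 2 ∧ b = - (v 1 * w 3 - v 3 * w 1) ∧ c = v 1 * w 2 - v 2 * w 1 ∧
  d = v 0 * w 3 - v 3 * w 0 ∧ e = - (v 0 * w 2 - v 2 * w 0) ∧ f = v 0 * w 1 - v 1 * w 0

theorem ln_eq_span {a b c d e f : F} {v w : Fin 4 → F} (h : Pco v w a b c d e f)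
    (h0 : ¬ (a = 0 ∧ b = 0 ∧ c = 0 ∧ d = 0 ∧ e = 0 ∧ f = 0)) :
    ln a b c d e f = span F {v, w} := by
  obtain ⟨ha, hb, hc, hd, he, hf⟩ := h
  apply le_antisymm
  · intro u hu
    obtain ⟨h1, h2, h3, h4⟩ := mem_ln.1 hu
    rw [ha, hb, hc] at h4
    rw [ha, hd, he] at h3
    rw [hb, hd, hf] at h2
    rw [hc, he, hf] at h1
    have gen : ∀ i j : Fin 4, v i * w j - v j * w i ≠ 0 →
        (∀ k, (v i * w j - v j * w i) * u k = (u i * w j - u j * w i) * v k + (v i * u j - v j * u i) * w k) →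
        u ∈ span F {v, w} := by
      intro i j hij hk
      rw [mem_span_pair]
      refine ⟨(u i * w j - u j * w i) / (v i * w j - v j * w i),
        (v i * u j - v j * u i) / (v i * w j - v j * w i), ?_⟩
      ext k
      simp only [Pi.add_apply, Pi.smul_apply, smul_eq_mul]
      rw [div_mul_eq_mul_div, div_mul_eq_mul_div, ← add_div, div_eq_iff hij]
      linear_combination -(hk k)
    have : ∃ i j, (i, j) ∈ [((0 : Fin 4), (1 : Fin 4)), (0, 2), (0, 3), (1, 2), (1, 3), (2, 3)] ∧
        v i * w j - v j * w i ≠ 0 := by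
      by_contra! hall
      apply h0
      rw [ha, hb, hc, hd, he, hf]
      refine ⟨hall 2 3 (by simp), ?_, hall 1 2 (by simp), hall 0 3 (by simp), ?_, hall 0 1 (by simp)⟩
      · rw [hall 1 3 (by simp), neg_zero]
      · rw [hall 0 2 (by simp), neg_zero]
    obtain ⟨i, j, hmem, hne⟩ := this
    apply gen i j hne
    intro k
    simp only [List.mem_cons, Prod.mk.injEq, List.not_mem_nil, or_false] at hmem
    rcases hmem with ⟨rfl, rfl⟩ | ⟨rfl, rfl⟩ | ⟨rfl, rfl⟩ | ⟨rfl, rfl⟩ | ⟨rfl, rfl⟩ | ⟨rfl, rfl⟩ <;>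
    fin_cases k <;> simp only [Fin.zero_eta, Fin.mk_one, Fin.reduceFinMk, Fin.isValue] <;>
    first
      | ring1
      | linear_combination h1
      | linear_combination -h1
      | linear_combination h2
      | linear_combination -h2
      | linear_combination h3
      | linear_combination -h3
      | linear_combination h4
      | linear_combination -h4
  · rw [span_le]
    rintro u (rfl | rfl)
    · refine mem_ln.2 ⟨?_, ?_, ?_, ?_⟩ <;> simp only [ha, hb, hc, hd, he, hf] <;> ring
    · refine mem_ln.2 ⟨?_, ?_, ?_, ?_⟩ <;> simp only [ha, hb, hc, hd, he, hf] <;> ring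

theorem Pco_indep {a b c d e f : F} {v w : Fin 4 → F} (h : Pco v w a b c d e f)
    (h0 : ¬ (a = 0 ∧ b = 0 ∧ c = 0 ∧ d = 0 ∧ e = 0 ∧ f = 0)) : finrank F (span F {v, w}) = 2 := by
  have hli : LinearIndependent F ![v, w] := by
    rw [LinearIndependent.pair_iff]
    intro s t hst
    obtain ⟨ha, hb, hc, hd, he, hf⟩ := h
    have hk : ∀ k, s * v k + t * w k = 0 := by
      intro k
      have := congrFun hst k
      simpa using this
    by_contra hne
    apply h0
    have all : ∀ i j, v i * w j - v j * w i = 0 := by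
      intro i j
      by_cases hs : s = 0
      · have ht : t ≠ 0 := by tauto
        apply mul_left_cancel₀ ht
        linear_combination v i * hk j - v j * hk i
      · apply mul_left_cancel₀ hs
        linear_combination w j * hk i - w i * hk j
    rw [ha, hb, hc, hd, he, hf]
    simp [all]
  have := finrank_span_eq_card hli
  rw [Matrix.range_cons, Matrix.range_cons, Matrix.range_empty, Set.union_empty,
    Set.singleton_union] at this
  simpa using this

theorem exists_Pco (a b c d e f : F) (hpl : a * f - b * e + c * d = 0)
    (h0 : ¬ (a = 0 ∧ b = 0 ∧ c = 0 ∧ d = 0 ∧ e = 0 ∧ f = 0)) :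
    ∃ v w, Pco v w a b c d e f := by
  by_cases hf : f ≠ 0
  · refine ⟨![0, f, -e, d], ![-1, 0, c / f, -b / f], ?_⟩
    simp only [Pco, Matrix.cons_val]
    refine ⟨?_, ?_, ?_, ?_, ?_, ?_⟩ <;> field_simp <;> first | ring1 | linear_combination hpl
  by_cases he : e ≠ 0
  · refine ⟨![0, f, -e, d], ![-1, c / e, 0, -a / e], ?_⟩
    simp only [Pco, Matrix.cons_val]
    refine ⟨?_, ?_, ?_, ?_, ?_, ?_⟩ <;> field_simp <;> first | ring1 | linear_combination hpl | linear_combination -hpl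
  by_cases hd : d ≠ 0
  · refine ⟨![0, f, -e, d], ![-1, b / d, -a / d, 0], ?_⟩
    simp only [Pco, Matrix.cons_val]
    refine ⟨?_, ?_, ?_, ?_, ?_, ?_⟩ <;> field_simp <;> first | ring1 | linear_combination hpl | linear_combination -hpl
  by_cases hc : c ≠ 0
  · refine ⟨![-f, 0, c, -b], ![e / c, -1, 0, a / c], ?_⟩
    simp only [Pco, Matrix.cons_val]
    refine ⟨?_, ?_, ?_, ?_, ?_, ?_⟩ <;> field_simp <;> first | ring1 | linear_combination hpl | linear_combination -hpl
  by_cases hb : b ≠ 0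
  · refine ⟨![-f, 0, c, -b], ![d / b, -1, a / b, 0], ?_⟩
    simp only [Pco, Matrix.cons_val]
    refine ⟨?_, ?_, ?_, ?_, ?_, ?_⟩ <;> field_simp <;> first | ring1 | linear_combination hpl | linear_combination -hpl
  by_cases ha : a ≠ 0
  · refine ⟨![0, 0, a, 0], ![0, 0, 0, 1], ?_⟩
    simp only [Pco, Matrix.cons_val]
    simp only [not_not] at hb hc hd he hf
    subst hb hc hd he hf
    norm_num
  simp only [not_not] at *
  tauto

end

end TC


namespace TC

open Polynomial

section
variable {F : Type} [Field F]

theorem exists_coord (L : Submodule F (Fin 4 → F)) (hL : finrank F L = 2) :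
    ∃ a b c d e f : F, ¬ (a = 0 ∧ b = 0 ∧ c = 0 ∧ d = 0 ∧ e = 0 ∧ f = 0) ∧
      a * f - b * e + c * d = 0 ∧ L = ln a b c d e f := by
  let B := finBasisOfFinrankEq F L hL
  obtain ⟨v, hv⟩ : ∃ v : Fin 4 → F, v = (B 0 : Fin 4 → F) := ⟨_, rfl⟩
  obtain ⟨w, hw⟩ : ∃ w : Fin 4 → F, w = (B 1 : Fin 4 → F) := ⟨_, rfl⟩
  have hli : LinearIndependent F ![v, w] := by
    have h1 := B.linearIndependent.map' L.subtype (by simp)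
    have heq : ![v, w] = L.subtype ∘ B := by
      ext i k
      fin_cases i <;> simp [hv, hw]
    rw [heq]
    exact h1
  have hspan : L = span F {v, w} := by
    have h1 := congrArg (Submodule.map L.subtype) B.span_eq
    rw [Submodule.map_span, Submodule.map_top, Submodule.range_subtype] at h1
    rw [← h1]
    congr 1
    ext u
    simp only [Set.mem_image, Set.mem_range, Set.mem_insert_iff, Set.mem_singleton_iff]
    constructor
    · rintro ⟨_, ⟨i, rfl⟩, rfl⟩
      fin_cases i <;> simp [hv, hw]
    · rintro (h | h)
      · exact ⟨_, ⟨0, rfl⟩, by rw [h, hv]; rfl⟩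
      · exact ⟨_, ⟨1, rfl⟩, by rw [h, hw]; rfl⟩
  rw [LinearIndependent.pair_iff] at hli
  have hP : Pco v w (v 2 * w 3 - v 3 * w 2) (- (v 1 * w 3 - v 3 * w 1)) (v 1 * w 2 - v 2 * w 1)
    (v 0 * w 3 - v 3 * w 0) (- (v 0 * w 2 - v 2 * w 0)) (v 0 * w 1 - v 1 * w 0) :=
    ⟨rfl, rfl, rfl, rfl, rfl, rfl⟩
  have h0 : ¬ ((v 2 * w 3 - v 3 * w 2) = 0 ∧ (- (v 1 * w 3 - v 3 * w 1)) = 0 ∧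
    (v 1 * w 2 - v 2 * w 1) = 0 ∧ (v 0 * w 3 - v 3 * w 0) = 0 ∧
    (- (v 0 * w 2 - v 2 * w 0)) = 0 ∧ (v 0 * w 1 - v 1 * w 0) = 0) := by
    rintro ⟨h1, h2, h3, h4, h5, h6⟩
    have all : ∀ i j, v i * w j - v j * w i = 0 := by
      intro i j
      fin_cases i <;> fin_cases j <;>
        simp only [Fin.zero_eta, Fin.mk_one, Fin.reduceFinMk, Fin.isValue] <;>
      first
      | ring1
      | linear_combination h1
      | linear_combination -h1
      | linear_combination h2
      | linear_combination -h2
      | linear_combination h3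
      | linear_combination -h3
      | linear_combination h4
      | linear_combination -h4
      | linear_combination h5
      | linear_combination -h5
      | linear_combination h6
      | linear_combination -h6
    have hvi : ∃ i, v i ≠ 0 := by
      by_contra! hv0
      have := hli 1 0 (by ext k; simp [hv0 k])
      simp at this
    obtain ⟨i, hi⟩ := hvi
    have := hli (w i) (- v i) (by
      ext k
      simp only [Pi.add_apply, Pi.smul_apply, smul_eq_mul, Pi.zero_apply]
      linear_combination -(all i k))
    exact hi (by simpa using this.2)
  exact ⟨_, _, _, _, _, _, h0, by ring, by rw [ln_eq_span hP h0]; exact hspan⟩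

theorem ln_finrank {a b c d e f : F} (hpl : a * f - b * e + c * d = 0)
    (h0 : ¬ (a = 0 ∧ b = 0 ∧ c = 0 ∧ d = 0 ∧ e = 0 ∧ f = 0)) : finrank F (ln a b c d e f) = 2 := by
  obtain ⟨v, w, h⟩ := exists_Pco a b c d e f hpl h0
  rw [ln_eq_span h h0]
  exact Pco_indep h h0

theorem ln_inj {a b c d e f a' b' c' d' e' f' : F} (hpl : a * f - b * e + c * d = 0)
    (h0 : ¬ (a = 0 ∧ b = 0 ∧ c = 0 ∧ d = 0 ∧ e = 0 ∧ f = 0)) (hpl' : a' * f' - b' * e' + c' * d' = 0)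
    (h0' : ¬ (a' = 0 ∧ b' = 0 ∧ c' = 0 ∧ d' = 0 ∧ e' = 0 ∧ f' = 0))
    (h : ln a b c d e f = ln a' b' c' d' e' f') :
    ∃ s : F, s ≠ 0 ∧ a' = s * a ∧ b' = s * b ∧ c' = s * c ∧ d' = s * d ∧ e' = s * e ∧ f' = s * f := by
  obtain ⟨v, w, hP⟩ := exists_Pco a b c d e f hpl h0
  obtain ⟨v', w', hP'⟩ := exists_Pco a' b' c' d' e' f' hpl' h0'
  rw [ln_eq_span hP h0, ln_eq_span hP' h0'] at h
  have hv : v' ∈ span F {v, w} := by rw [h]; exact subset_span (by simp)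
  have hw : w' ∈ span F {v, w} := by rw [h]; exact subset_span (by simp)
  rw [mem_span_pair] at hv hw
  obtain ⟨α, β, rfl⟩ := hv
  obtain ⟨γ, δ, rfl⟩ := hw
  obtain ⟨ha, hb, hc, hd, he, hf⟩ := hP
  obtain ⟨ha', hb', hc', hd', he', hf'⟩ := hP'
  simp only [Pi.add_apply, Pi.smul_apply, smul_eq_mul] at ha' hb' hc' hd' he' hf'
  have k1 : a' = (α * δ - β * γ) * a := by rw [ha', ha]; ring
  have k2 : b' = (α * δ - β * γ) * b := by rw [hb', hb]; ring
  have k3 : c' = (α * δ - β * γ) * c := by rw [hc', hc]; ring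
  have k4 : d' = (α * δ - β * γ) * d := by rw [hd', hd]; ring
  have k5 : e' = (α * δ - β * γ) * e := by rw [he', he]; ring
  have k6 : f' = (α * δ - β * γ) * f := by rw [hf', hf]; ring
  refine ⟨_, ?_, k1, k2, k3, k4, k5, k6⟩
  intro hs
  rw [hs, zero_mul] at k1 k2 k3 k4 k5 k6
  exact h0' ⟨k1, k2, k3, k4, k5, k6⟩

theorem ln_smul {a b c d e f s : F} (hs : s ≠ 0) :
    ln (s * a) (s * b) (s * c) (s * d) (s * e) (s * f) = ln a b c d e f := by
  ext u
  rw [mem_ln, mem_ln]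
  have e1 : s * c * u 0 + s * e * u 1 + s * f * u 2 = s * (c * u 0 + e * u 1 + f * u 2) := by ring
  have e2 : - (s * b) * u 0 - s * d * u 1 + s * f * u 3 = s * (- b * u 0 - d * u 1 + f * u 3) := by ring
  have e3 : s * a * u 0 - s * d * u 2 - s * e * u 3 = s * (a * u 0 - d * u 2 - e * u 3) := by ring
  have e4 : s * a * u 1 + s * b * u 2 + s * c * u 3 = s * (a * u 1 + b * u 2 + c * u 3) := by ring
  rw [e1, e2, e3, e4]
  simp [hs]

/-- point of the twisted cubic as a vector -/
def vec (x : Option F) : Fin 4 → F := ![nu x ^ 3, nu x ^ 2 * de x, nu x * de x ^ 2, de x ^ 3]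

theorem vec_none : vec (none : Option F) = ![1, 0, 0, 0] := by
  simp [vec, nu, de]

theorem vec_some (t : F) : vec (some t) = ![t ^ 3, t ^ 2, t, 1] := by
  simp [vec, nu, de]

theorem mem_cubicPts (P : Submodule F (Fin 4 → F)) : P ∈ cubicPts F ↔ ∃ x, P = span F {vec x} := by
  unfold cubicPts
  constructor
  · rintro (⟨t, h⟩ | h)
    · exact ⟨some t, by rw [vec_some]; exact h⟩
    · exact ⟨none, by rw [vec_none]; exact h⟩
  · rintro ⟨_ | t, h⟩
    · right; rw [vec_none] at h; exact h
    · left; exact ⟨t, by rw [vec_some] at h; exact h⟩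

theorem vec_inj {x y : Option F} (h : span F {vec x} = span F {vec y}) : x = y := by
  have h1 : vec x ∈ span F {vec y} := by rw [← h]; exact subset_span rfl
  rw [mem_span_singleton] at h1
  obtain ⟨s, hs⟩ := h1
  cases x with
  | none =>
    cases y with
    | none => rfl
    | some t =>
      rw [vec_none, vec_some] at hs
      have k0 := congrFun hs 0
      have k3 := congrFun hs 3
      simp at k0 k3
      simp [k3] at k0
  | some r =>
    cases y with
    | none =>
      rw [vec_none, vec_some] at hs
      have k3 := congrFun hs 3
      simp at k3
    | some t =>
      rw [vec_some, vec_some] at hs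
      have k2 := congrFun hs 2
      have k3 := congrFun hs 3
      simp at k2 k3
      rw [k3, one_mul] at k2
      rw [k2]

theorem nu_de (x : Option F) : nu x ≠ 0 ∨ de x ≠ 0 := by
  cases x <;> simp [nu, de]

theorem vec_mem_ln (a b c d e f : F) (x : Option F) : vec x ∈ ln a b c d e f ↔ Base a b c d e f x := by
  rw [mem_ln]
  unfold Base fA vec
  simp only [Matrix.cons_val]
  constructor
  · rintro ⟨h1, h2, h3, h4⟩
    cases x with
    | none =>
      simp [nu, de] at h1 h2 h3 ⊢
      exact ⟨h3, h2, h1⟩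
    | some t =>
      simp [nu, de] at h1 h2 h3 h4 ⊢
      have k1 : a * t ^ 2 + b * t + c = 0 := h4
      have k2 : b * t ^ 2 + (c + d) * t + e = 0 := by linear_combination t * h4 - h3
      have k3 : c * t ^ 2 + e * t + f = 0 := by linear_combination h2 + t * k2
      exact ⟨k1, k2, k3⟩
  · rintro ⟨h1, h2, h3⟩
    refine ⟨?_, ?_, ?_, ?_⟩
    · linear_combination nu x * h3
    · linear_combination de x * h3 - nu x * h2
    · linear_combination nu x * h1 - de x * h2
    · linear_combination de x * h1

/-- the determinant form of a line -/
def Dl (a b c d e f : F) (X : Fin 4 → F) : (Fin 4 → F) →ₗ[F] F where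
  toFun Y := f * (X 2 * Y 3 - X 3 * Y 2) + e * (X 1 * Y 3 - X 3 * Y 1) + d * (X 1 * Y 2 - X 2 * Y 1)
    + c * (X 0 * Y 3 - X 3 * Y 0) + b * (X 0 * Y 2 - X 2 * Y 0) + a * (X 0 * Y 1 - X 1 * Y 0)
  map_add' Y Z := by simp only [Pi.add_apply]; ring
  map_smul' s Y := by simp only [Pi.smul_apply, smul_eq_mul, RingHom.id_apply]; ring

theorem Dl_apply (a b c d e f : F) (X Y : Fin 4 → F) : Dl a b c d e f X Y =
    f * (X 2 * Y 3 - X 3 * Y 2) + e * (X 1 * Y 3 - X 3 * Y 1) + d * (X 1 * Y 2 - X 2 * Y 1)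
    + c * (X 0 * Y 3 - X 3 * Y 0) + b * (X 0 * Y 2 - X 2 * Y 0) + a * (X 0 * Y 1 - X 1 * Y 0) := rfl

theorem Dl_vec (a b c d e f : F) (x y : Option F) : Dl a b c d e f (vec x) (vec y) =
    (nu x * de y - nu y * de x) * psi a b c d e f x y := by
  rw [Dl_apply]
  unfold vec psi fA
  simp only [Matrix.cons_val]
  ring

theorem ln_le_ker (a b c d e f : F) (X : Fin 4 → F) : ln a b c d e f ≤ LinearMap.ker (Dl a b c d e f X) := by
  intro Y hY
  obtain ⟨h1, h2, h3, h4⟩ := mem_ln.1 hY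
  rw [LinearMap.mem_ker, Dl_apply]
  linear_combination X 0 * h4 - X 1 * h3 + X 2 * h2 - X 3 * h1

theorem Dl_eq_zero (a b c d e f : F) (X : Fin 4 → F) (h : Dl a b c d e f X = 0) : X ∈ ln a b c d e f := by
  have h0 := LinearMap.congr_fun h ![1, 0, 0, 0]
  have h1 := LinearMap.congr_fun h ![0, 1, 0, 0]
  have h2 := LinearMap.congr_fun h ![0, 0, 1, 0]
  have h3 := LinearMap.congr_fun h ![0, 0, 0, 1]
  rw [Dl_apply] at h0 h1 h2 h3
  simp only [Matrix.cons_val, LinearMap.zero_apply] at h0 h1 h2 h3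
  rw [mem_ln]
  refine ⟨?_, ?_, ?_, ?_⟩
  · linear_combination h3
  · linear_combination -h2
  · linear_combination h1
  · linear_combination -h0

end

end TC


namespace TC

open Polynomial

section
variable {F : Type} [Field F]

theorem ptsOn_eq (W : Submodule F (Fin 4 → F)) :
    ptsOn F W = (fun x : Option F => span F {vec x}) '' {x | vec x ∈ W} := by
  ext P
  unfold ptsOn
  simp only [Set.mem_ofPred_eq, Set.mem_image, mem_cubicPts]
  constructor
  · rintro ⟨⟨x, rfl⟩, h⟩
    exact ⟨x, h (subset_span rfl), rfl⟩
  · rintro ⟨x, hx, rfl⟩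
    exact ⟨⟨x, rfl⟩, by rw [span_le]; rintro _ rfl; exact hx⟩

theorem ptsOn_ncard (W : Submodule F (Fin 4 → F)) : (ptsOn F W).ncard = {x : Option F | vec x ∈ W}.ncard := by
  rw [ptsOn_eq, Set.ncard_image_of_injective]
  intro x y h
  exact vec_inj h

theorem finrank_ker_Dl {a b c d e f : F} {X : Fin 4 → F} (h : Dl a b c d e f X ≠ 0) :
    finrank F (LinearMap.ker (Dl a b c d e f X)) = 3 := by
  have h1 := LinearMap.finrank_range_add_finrank_ker (Dl a b c d e f X)
  have h2 : LinearMap.range (Dl a b c d e f X) = ⊤ := LinearMap.range_eq_top.2 (LinearMap.surjective h)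
  rw [h2, finrank_top, finrank_self, finrank_fin_fun] at h1
  omega

theorem trip_plane [Fintype F] (a b c d e f : F) (hT : Trip a b c d e f) :
    ∃ W, IsThreePlane F W ∧ ln a b c d e f ≤ W := by
  classical
  obtain ⟨x, y, z, hxy, hxz, hyz, h1, h2, hb⟩ := hT
  have hne : Dl a b c d e f (vec x) ≠ 0 := by
    intro h
    exact hb ((vec_mem_ln _ _ _ _ _ _ _).1 (Dl_eq_zero _ _ _ _ _ _ _ h))
  refine ⟨LinearMap.ker (Dl a b c d e f (vec x)), ⟨finrank_ker_Dl hne, ?_⟩, ln_le_ker _ _ _ _ _ _ _⟩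
  rw [ptsOn_ncard]
  obtain ⟨D, hD⟩ : ∃ D, D = Dl a b c d e f (vec x) := ⟨_, rfl⟩
  have hexp : ∀ Y, D Y = Y 0 * D ![1, 0, 0, 0] + Y 1 * D ![0, 1, 0, 0] + Y 2 * D ![0, 0, 1, 0]
      + Y 3 * D ![0, 0, 0, 1] := by
    intro Y
    rw [hD]
    simp only [Dl_apply, Matrix.cons_val]
    ring
  obtain ⟨g0, hg0⟩ : ∃ g, g = D ![1, 0, 0, 0] := ⟨_, rfl⟩
  obtain ⟨g1, hg1⟩ : ∃ g, g = D ![0, 1, 0, 0] := ⟨_, rfl⟩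
  obtain ⟨g2, hg2⟩ : ∃ g, g = D ![0, 0, 1, 0] := ⟨_, rfl⟩
  obtain ⟨g3, hg3⟩ : ∃ g, g = D ![0, 0, 0, 1] := ⟨_, rfl⟩
  rw [← hg0, ← hg1, ← hg2, ← hg3] at hexp
  obtain ⟨S, hS⟩ : ∃ S : Finset (Option F), S = Finset.univ.filter (fun t => D (vec t) = 0) := ⟨_, rfl⟩
  have hset : {t : Option F | vec t ∈ LinearMap.ker (Dl a b c d e f (vec x))} = (S : Set (Option F)) := by
    ext t
    simp [hS, hD]
  rw [hset, Set.ncard_coe_finset]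
  apply le_antisymm
  · obtain ⟨P, hP⟩ : ∃ P : F[X], P = C g0 * X ^ 3 + C g1 * X ^ 2 + C g2 * X + C g3 := ⟨_, rfl⟩
    have c0 : P.coeff 0 = g3 := by rw [hP]; simp [coeff_X, coeff_C]
    have c1 : P.coeff 1 = g2 := by rw [hP]; simp [coeff_X, coeff_C, coeff_X_pow]
    have c2 : P.coeff 2 = g1 := by rw [hP]; simp [coeff_X, coeff_C, coeff_X_pow]
    have c3 : P.coeff 3 = g0 := by rw [hP]; simp [coeff_X, coeff_C, coeff_X_pow]
    apply card_zeros P 3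
    · intro h0
      rw [h0, coeff_zero] at c0 c1 c2 c3
      apply hne
      rw [← hD]
      ext Y
      simp [hexp, ← c0, ← c1, ← c2, ← c3]
    · rw [hP]; compute_degree
    · intro t ht
      rw [hS, Finset.mem_filter, hexp, vec_some] at ht
      have := ht.2
      simp only [Matrix.cons_val] at this
      rw [hP]
      simp only [eval_add, eval_mul, eval_C, eval_pow, eval_X]
      linear_combination this
    · intro ht
      rw [hS, Finset.mem_filter, hexp, vec_none] at ht
      have := ht.2
      simp only [Matrix.cons_val] at this
      rw [c3]
      linear_combination this
  · have hsub : ({x, y, z} : Finset (Option F)) ⊆ S := by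
      intro t ht
      rw [hS, Finset.mem_filter, hD, Dl_vec]
      refine ⟨Finset.mem_univ _, ?_⟩
      simp only [Finset.mem_insert, Finset.mem_singleton] at ht
      rcases ht with rfl | rfl | rfl
      · ring
      · rw [h1, mul_zero]
      · rw [h2, mul_zero]
    have := Finset.card_le_card hsub
    rwa [Finset.card_eq_three.2 ⟨x, y, z, hxy, hxz, hyz, rfl⟩] at this

theorem plane_PT (a b c d e f : F) (hpl : a * f - b * e + c * d = 0)
    (h0 : ¬ (a = 0 ∧ b = 0 ∧ c = 0 ∧ d = 0 ∧ e = 0 ∧ f = 0)) (W : Submodule F (Fin 4 → F))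
    (hW : IsThreePlane F W) (hle : ln a b c d e f ≤ W) : PT a b c d e f := by
  obtain ⟨hr, hc⟩ := hW
  rw [ptsOn_ncard, Set.ncard_eq_three] at hc
  obtain ⟨x, y, z, hxy, hxz, hyz, hs⟩ := hc
  have hx : vec x ∈ W := by
    have : x ∈ {x : Option F | vec x ∈ W} := by rw [hs]; simp
    exact this
  have hy : vec y ∈ W := by
    have : y ∈ {x : Option F | vec x ∈ W} := by rw [hs]; simp
    exact this
  have hz : vec z ∈ W := by
    have : z ∈ {x : Option F | vec x ∈ W} := by rw [hs]; simp
    exact this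
  have key : ∀ X Y, X ∈ W → Y ∈ W → Dl a b c d e f X Y = 0 := by
    intro X Y hX hY
    by_cases hXL : X ∈ ln a b c d e f
    · have : Dl a b c d e f X Y = - Dl a b c d e f Y X := by simp only [Dl_apply]; ring
      rw [this, LinearMap.mem_ker.1 (ln_le_ker _ _ _ _ _ _ Y hXL), neg_zero]
    · have hlt : ln a b c d e f < ln a b c d e f ⊔ span F {X} := by
        refine lt_of_le_of_ne le_sup_left ?_
        intro heq
        apply hXL
        rw [heq]
        exact le_sup_right (a := ln a b c d e f) (subset_span rfl)
      have h3 := finrank_lt_finrank_of_lt hlt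
      rw [ln_finrank hpl h0] at h3
      have hXW : ln a b c d e f ⊔ span F {X} ≤ W := by
        refine sup_le hle ?_
        rw [span_le]; rintro _ rfl; exact hX
      have hEq := eq_of_le_of_finrank_le hXW (by omega)
      rw [← hEq] at hY
      have hker : ln a b c d e f ⊔ span F {X} ≤ LinearMap.ker (Dl a b c d e f X) := by
        refine sup_le (ln_le_ker _ _ _ _ _ _ _) ?_
        rw [span_le]; rintro _ rfl
        rw [SetLike.mem_coe, LinearMap.mem_ker, Dl_apply]
        ring
      exact LinearMap.mem_ker.1 (hker hY)
  have kk : ∀ x y, x ≠ y → vec x ∈ W → vec y ∈ W → psi a b c d e f x y = 0 := by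
    intro x y hxy hx hy
    have := key _ _ hx hy
    rw [Dl_vec] at this
    exact (mul_eq_zero.1 this).resolve_left (det_ne hxy)
  exact ⟨x, y, z, hxy, hxz, hyz, kk _ _ hxy hx hy, kk _ _ hxz hx hz, kk _ _ hyz hy hz⟩

theorem real_chord_iff (a b c d e f : F) (hpl : a * f - b * e + c * d = 0)
    (h0 : ¬ (a = 0 ∧ b = 0 ∧ c = 0 ∧ d = 0 ∧ e = 0 ∧ f = 0)) :
    IsRealChord F (ln a b c d e f) ↔ ∃ x y, x ≠ y ∧ Base a b c d e f x ∧ Base a b c d e f y := by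
  constructor
  · rintro ⟨-, P, Q, hP, hQ, hne, h1, h2⟩
    obtain ⟨x, rfl⟩ := (mem_cubicPts P).1 hP
    obtain ⟨y, rfl⟩ := (mem_cubicPts Q).1 hQ
    exact ⟨x, y, fun h => hne (by rw [h]), (vec_mem_ln _ _ _ _ _ _ _).1 (h1 (subset_span rfl)),
      (vec_mem_ln _ _ _ _ _ _ _).1 (h2 (subset_span rfl))⟩
  · rintro ⟨x, y, hxy, h1, h2⟩
    refine ⟨ln_finrank hpl h0, span F {vec x}, span F {vec y}, (mem_cubicPts _).2 ⟨x, rfl⟩,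
      (mem_cubicPts _).2 ⟨y, rfl⟩, fun h => hxy (vec_inj h), ?_, ?_⟩
    · rw [span_le]; rintro _ rfl; exact (vec_mem_ln _ _ _ _ _ _ _).2 h1
    · rw [span_le]; rintro _ rfl; exact (vec_mem_ln _ _ _ _ _ _ _).2 h2

theorem mem_muSet [Fintype F] (hq : 23 ≤ Fintype.card F) (a b c d e f : F)
    (hpl : a * f - b * e + c * d = 0)
    (h0 : ¬ (a = 0 ∧ b = 0 ∧ c = 0 ∧ d = 0 ∧ e = 0 ∧ f = 0)) :
    ln a b c d e f ∈ muSet F ↔ ¬ Bad a b c d e f := by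
  unfold muSet
  rw [Set.mem_ofPred_eq, real_chord_iff a b c d e f hpl h0]
  constructor
  · rintro ⟨-, hnc, W, hW, hle⟩ hB
    exact hnc (bad_dir a b c d e f h0 hB (plane_PT a b c d e f hpl h0 W hW hle))
  · intro hB
    refine ⟨ln_finrank hpl h0, ?_, ?_⟩
    · rintro ⟨x, y, hxy, h1, h2⟩
      exact hB (Or.inl (chord_ZC a b c d e f x y hxy h1 h2))
    · apply trip_plane
      by_contra hT
      exact hB (hard hq a b c d e f hpl hT)

end

end TC


namespace TC

open Polynomial

section
variable {F : Type} [Field F]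

theorem ncard_param {α β : Type} {S : Set α} {U : Set β} (g : β → α) (π : α → β)
    (h1 : ∀ u ∈ U, g u ∈ S) (h2 : ∀ p ∈ S, π p ∈ U) (h3 : ∀ u ∈ U, π (g u) = u)
    (h4 : ∀ p ∈ S, g (π p) = p) : S.ncard = U.ncard := by
  have hS : S = g '' U := by
    ext p
    constructor
    · intro hp; exact ⟨π p, h2 p hp, h4 p hp⟩
    · rintro ⟨u, hu, rfl⟩; exact h1 u hu
  rw [hS, Set.InjOn.ncard_image]
  intro u hu v hv huv
  have huv' : g u = g v := huv
  rw [← h3 u hu, ← h3 v hv, huv']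

theorem ncard_split [Finite F] {α : Type} [Finite α] (S : Set α) (P : α → Prop) :
    S.ncard = {p | p ∈ S ∧ P p}.ncard + {p | p ∈ S ∧ ¬ P p}.ncard := by
  rw [← Set.ncard_union_eq]
  · congr 1
    ext p
    simp only [Set.mem_union, Set.mem_ofPred_eq]
    tauto
  · rw [Set.disjoint_left]
    rintro p ⟨_, h⟩ ⟨_, h'⟩
    exact h' h

theorem ncard_nz [Fintype F] : ({x : F | x ≠ 0}).ncard + 1 = Nat.card F := by
  have h := Set.ncard_add_ncard_compl ({0} : Set F)
  rw [Set.ncard_singleton] at h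
  have : ({x : F | x ≠ 0}) = ({0} : Set F)ᶜ := by ext; simp
  rw [this]
  omega

abbrev Tup (F : Type) := F × F × F × F × F × F

/-- set of tuples satisfying a six-variable predicate -/
def un (P : F → F → F → F → F → F → Prop) : Set (Tup F) :=
  {p | P p.1 p.2.1 p.2.2.1 p.2.2.2.1 p.2.2.2.2.1 p.2.2.2.2.2}

theorem mem_un (P : F → F → F → F → F → F → Prop) (a b c d e f : F) :
    ((a, b, c, d, e, f) : Tup F) ∈ un P ↔ P a b c d e f := Iff.rfl

def KK (a b c d e f : F) : Prop := ¬ (a = 0 ∧ b = 0 ∧ c = 0 ∧ d = 0 ∧ e = 0 ∧ f = 0) ∧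
  a * f - b * e + c * d = 0

/-- coordinates of a line -/
def lnT (p : Tup F) : Submodule F (Fin 4 → F) := ln p.1 p.2.1 p.2.2.1 p.2.2.2.1 p.2.2.2.2.1 p.2.2.2.2.2

theorem fiber_count [Fintype F] (hq : 23 ≤ Fintype.card F) :
    (un (F := F) fun a b c d e f => KK a b c d e f ∧ ¬ Bad a b c d e f).ncard =
      ({x : F | x ≠ 0}).ncard * (muSet F).ncard := by
  have hex : ∀ L : Submodule F (Fin 4 → F), ∃ p : Tup F, L ∈ muSet F →
      p ∈ un (F := F) KK ∧ lnT p = L := by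
    intro L
    by_cases hL : L ∈ muSet F
    · obtain ⟨a, b, c, d, e, f, h0, hpl, h⟩ := exists_coord L hL.1
      exact ⟨(a, b, c, d, e, f), fun _ => ⟨⟨h0, hpl⟩, h.symm⟩⟩
    · exact ⟨0, fun h => absurd h hL⟩
  choose r hr using hex
  rw [← Set.ncard_prod]
  have hS : (un (F := F) fun a b c d e f => KK a b c d e f ∧ ¬ Bad a b c d e f) =
      (fun u : F × Submodule F (Fin 4 → F) => u.1 • r u.2) '' ({x : F | x ≠ 0} ×ˢ muSet F) := by
    ext ⟨a, b, c, d, e, f⟩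
    rw [mem_un]
    constructor
    · rintro ⟨⟨h0, hpl⟩, hB⟩
      have hm := (mem_muSet hq a b c d e f hpl h0).2 hB
      obtain ⟨⟨k0, kpl⟩, hl⟩ := hr _ hm
      obtain ⟨s, hs, e1, e2, e3, e4, e5, e6⟩ := ln_inj kpl k0 hpl h0 hl
      refine ⟨(s, ln a b c d e f), ⟨hs, hm⟩, ?_⟩
      exact Prod.ext e1.symm (Prod.ext e2.symm (Prod.ext e3.symm (Prod.ext e4.symm
        (Prod.ext e5.symm e6.symm))))
    · rintro ⟨⟨s, L⟩, ⟨hs, hL⟩, h⟩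
      obtain ⟨⟨k0, kpl⟩, hl⟩ := hr L hL
      have hs' : s ≠ 0 := hs
      obtain ⟨p, hp⟩ : ∃ p, p = r L := ⟨_, rfl⟩
      have hL' : L ∈ muSet F := hL
      simp only at h
      rw [← hp] at k0 kpl hl h
      obtain ⟨a', b', c', d', e', f'⟩ := p
      simp only [Prod.smul_mk, smul_eq_mul, Prod.mk.injEq] at h
      obtain ⟨rfl, rfl, rfl, rfl, rfl, rfl⟩ := h
      simp only at k0 kpl
      have k0' : ¬ (s * a' = 0 ∧ s * b' = 0 ∧ s * c' = 0 ∧ s * d' = 0 ∧ s * e' = 0 ∧ s * f' = 0) := by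
        simpa [hs'] using k0
      have kpl' : s * a' * (s * f') - s * b' * (s * e') + s * c' * (s * d') = 0 := by
        linear_combination s ^ 2 * kpl
      refine ⟨⟨k0', kpl'⟩, ?_⟩
      rw [← mem_muSet hq _ _ _ _ _ _ kpl' k0', ln_smul hs']
      have : ln a' b' c' d' e' f' = L := hl
      rw [this]
      exact hL'
  rw [hS, Set.InjOn.ncard_image]
  rintro ⟨s, L⟩ ⟨hs, hL⟩ ⟨s', L'⟩ ⟨hs', hL'⟩ h
  have hsn : s ≠ 0 := hs
  have hsn' : s' ≠ 0 := hs'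
  have lnsm : ∀ (s : F) (p : Tup F), s ≠ 0 → lnT (s • p) = lnT p := by
    rintro s ⟨a, b, c, d, e, f⟩ hs
    exact ln_smul hs
  have h' : s • r L = s' • r L' := h
  have hLL : L = L' := by
    rw [← (hr L hL).2, ← (hr L' hL').2, ← lnsm s _ hsn, ← lnsm s' (r L') hsn', h']
  subst hLL
  have hne : r L ≠ 0 := by
    intro h0
    have := (hr L hL).1
    rw [h0] at this
    exact this.1 (by simp)
  have := smul_left_injective F hne h'
  rw [this]

theorem KK_count [Fintype F] : (un (F := F) KK).ncard + Nat.card F ^ 2 + 1 = Nat.card F ^ 5 + Nat.card F ^ 3 := by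
  obtain ⟨n, hn⟩ : ∃ n, n = ({x : F | x ≠ 0}).ncard := ⟨_, rfl⟩
  have hq := ncard_nz (F := F)
  have hu : (Set.univ : Set F).ncard = Nat.card F := Set.ncard_univ _
  rw [← hn] at hq
  have s1 := ncard_split (F := F) (un (F := F) KK) (fun p => p.1 ≠ 0)
  have c1 : {p : Tup F | p ∈ un (F := F) KK ∧ p.1 ≠ 0}.ncard = n * Nat.card F ^ 4 := by
    rw [ncard_param (U := ({x : F | x ≠ 0} ×ˢ (Set.univ : Set F) ×ˢ (Set.univ : Set F) ×ˢ (Set.univ : Set F) ×ˢ (Set.univ : Set F)))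
      (fun u => (u.1, u.2.1, u.2.2.1, u.2.2.2.1, u.2.2.2.2, (u.2.1 * u.2.2.2.2 - u.2.2.1 * u.2.2.2.1) / u.1))
      (fun p => (p.1, p.2.1, p.2.2.1, p.2.2.2.1, p.2.2.2.2.1))]
    · simp only [Set.ncard_prod, hu, ← hn]; ring
    · rintro ⟨a, b, c, d, e⟩ ⟨ha, -⟩
      have ha' : a ≠ 0 := ha
      refine ⟨⟨fun h => ha' h.1, ?_⟩, ha'⟩
      simp only
      field_simp
      ring
    · rintro ⟨a, b, c, d, e, f⟩ ⟨-, ha⟩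
      exact ⟨ha, by simp⟩
    · rintro ⟨a, b, c, d, e⟩ -
      rfl
    · rintro ⟨a, b, c, d, e, f⟩ ⟨⟨-, h⟩, ha⟩
      simp only [ne_eq] at ha h
      simp only [Prod.mk.injEq, true_and]
      field_simp
      linear_combination -h
  have s2 := ncard_split (F := F) {p : Tup F | p ∈ un (F := F) KK ∧ ¬ (p.1 ≠ 0)} (fun p => p.2.1 ≠ 0)
  have c2 : {p : Tup F | p ∈ {p : Tup F | p ∈ un (F := F) KK ∧ ¬ (p.1 ≠ 0)} ∧ p.2.1 ≠ 0}.ncard = n * Nat.card F ^ 3 := by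
    rw [ncard_param (U := ({x : F | x ≠ 0} ×ˢ (Set.univ : Set F) ×ˢ (Set.univ : Set F) ×ˢ (Set.univ : Set F)))
      (fun u => (0, u.1, u.2.1, u.2.2.1, u.2.1 * u.2.2.1 / u.1, u.2.2.2))
      (fun p => (p.2.1, p.2.2.1, p.2.2.2.1, p.2.2.2.2.2))]
    · simp only [Set.ncard_prod, hu, ← hn]; ring
    · rintro ⟨b, c, d, f⟩ ⟨hb, -⟩
      have hb' : b ≠ 0 := hb
      refine ⟨⟨⟨fun h => hb' h.2.1, ?_⟩, by simp⟩, hb'⟩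
      simp only
      field_simp
      ring
    · rintro ⟨a, b, c, d, e, f⟩ ⟨-, hb⟩
      exact ⟨hb, by simp⟩
    · rintro ⟨b, c, d, f⟩ -
      rfl
    · rintro ⟨a, b, c, d, e, f⟩ ⟨⟨⟨-, h⟩, ha⟩, hb⟩
      simp only [ne_eq, not_not] at ha h hb
      subst ha
      simp only [Prod.mk.injEq, true_and, and_true]
      field_simp
      linear_combination h
  have s3 := ncard_split (F := F) {p : Tup F | p ∈ {p : Tup F | p ∈ un (F := F) KK ∧ ¬ (p.1 ≠ 0)} ∧ ¬ (p.2.1 ≠ 0)} (fun p => p.2.2.1 ≠ 0)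
  have c3 : {p : Tup F | p ∈ {p : Tup F | p ∈ {p : Tup F | p ∈ un (F := F) KK ∧ ¬ (p.1 ≠ 0)} ∧ ¬ (p.2.1 ≠ 0)} ∧ p.2.2.1 ≠ 0}.ncard = n * Nat.card F ^ 2 := by
    rw [ncard_param (U := ({x : F | x ≠ 0} ×ˢ (Set.univ : Set F) ×ˢ (Set.univ : Set F)))
      (fun u => (0, 0, u.1, 0, u.2.1, u.2.2))
      (fun p => (p.2.2.1, p.2.2.2.2.1, p.2.2.2.2.2))]
    · simp only [Set.ncard_prod, hu, ← hn]; ring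
    · rintro ⟨c, e, f⟩ ⟨hc, -⟩
      have hc' : c ≠ 0 := hc
      exact ⟨⟨⟨⟨fun h => hc' h.2.2.1, by simp⟩, by simp⟩, by simp⟩, hc'⟩
    · rintro ⟨a, b, c, d, e, f⟩ ⟨-, hc⟩
      exact ⟨hc, by simp⟩
    · rintro ⟨c, e, f⟩ -
      rfl
    · rintro ⟨a, b, c, d, e, f⟩ ⟨⟨⟨⟨-, h⟩, ha⟩, hb⟩, hc⟩
      simp only [ne_eq, not_not] at ha h hb hc
      subst ha hb
      have hd : d = 0 := by
        apply mul_left_cancel₀ hc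
        linear_combination h
      simp [hd]
  have c4 : {p : Tup F | p ∈ {p : Tup F | p ∈ {p : Tup F | p ∈ un (F := F) KK ∧ ¬ (p.1 ≠ 0)} ∧ ¬ (p.2.1 ≠ 0)} ∧ ¬ (p.2.2.1 ≠ 0)}.ncard + 1 = Nat.card F ^ 3 := by
    rw [ncard_param (U := ({0}ᶜ : Set (F × F × F)))
      (fun u => (0, 0, 0, u.1, u.2.1, u.2.2))
      (fun p => (p.2.2.2.1, p.2.2.2.2.1, p.2.2.2.2.2))]
    · have := Set.ncard_add_ncard_compl ({0} : Set (F × F × F))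
      rw [Set.ncard_singleton, Nat.card_prod, Nat.card_prod] at this
      rw [add_comm, this]; ring
    · rintro ⟨d, e, f⟩ hu
      refine ⟨⟨⟨⟨fun h => hu ?_, by simp⟩, by simp⟩, by simp⟩, by simp⟩
      simp only at h
      simp [h]
    · rintro ⟨a, b, c, d, e, f⟩ ⟨⟨⟨⟨h0, -⟩, ha⟩, hb⟩, hc⟩ hu
      simp only [ne_eq, not_not] at ha hb hc
      simp at hu
      exact h0 ⟨ha, hb, hc, hu⟩
    · rintro ⟨d, e, f⟩ -
      rfl
    · rintro ⟨a, b, c, d, e, f⟩ ⟨⟨⟨⟨h0, -⟩, ha⟩, hb⟩, hc⟩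
      simp only [ne_eq, not_not] at ha hb hc
      simp [ha, hb, hc]
  rw [s1, c1, s2, c2, s3, c3, ← hq]
  rw [← hq] at c4
  nlinarith [c4]

end

end TC


namespace TC

open Polynomial

section
variable {F : Type} [Field F]

theorem ZT_KK (a b c d e f : F) (h : ZT a b c d e f) : KK a b c d e f := by
  obtain ⟨h2, rfl, rfl, ⟨hb, rfl, hbe⟩ | ⟨rfl, rfl, rfl, he⟩⟩ := h
  · exact ⟨fun h => hb h.2.1, by linear_combination -hbe⟩
  · exact ⟨fun h => he h.2.2.2.2.1, by ring⟩

theorem ZF1_KK (a b c d e f : F) (h : ZF1 a b c d e f) : KK a b c d e f := by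
  obtain ⟨ha, -, r1, r2, r3⟩ := h
  refine ⟨fun h => ha h.1, ?_⟩
  apply mul_left_cancel₀ (pow_ne_zero 2 ha)
  linear_combination r3 - b * r2 + a * c * r1

theorem ZF2_KK (a b c d e f : F) (h : ZF2 a b c d e f) : KK a b c d e f := by
  obtain ⟨rfl, rfl, rfl, hf, -, -⟩ := h
  exact ⟨fun h => hf h.2.2.2.2.2, by ring⟩

theorem Z3_KK (a b c d e f : F) (h : Z3 a b c d e f) : KK a b c d e f := by
  obtain ⟨rfl, rfl, hc, rfl, rfl, rfl, -⟩ := h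
  exact ⟨fun h => hc h.2.2.1, by ring⟩

theorem un_union (P Q : F → F → F → F → F → F → Prop) [Finite F]
    (h : ∀ a b c d e f, P a b c d e f → Q a b c d e f → False) :
    (un (F := F) fun a b c d e f => P a b c d e f ∨ Q a b c d e f).ncard =
    (un (F := F) P).ncard + (un (F := F) Q).ncard := by
  rw [← Set.ncard_union_eq]
  · rfl
  · rw [Set.disjoint_left]
    intro p hp hq
    exact h _ _ _ _ _ _ hp hq

theorem total [Fintype F] (hq : 23 ≤ Fintype.card F) :
    ({x : F | x ≠ 0}).ncard * (muSet F).ncard +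
      ((un (F := F) fun a b c d e f => KK a b c d e f ∧ ZC a b c d e f).ncard +
      ((un (F := F) ZT).ncard + ((un (F := F) ZF1).ncard + ((un (F := F) ZF2).ncard +
        (un (F := F) Z3).ncard)))) = (un (F := F) KK).ncard := by
  rw [← fiber_count hq, ← un_union, ← un_union, ← un_union, ← un_union, ← un_union]
  · congr 1
    ext ⟨a, b, c, d, e, f⟩
    simp only [mem_un]
    have h1 := ZT_KK a b c d e f
    have h2 := ZF1_KK a b c d e f
    have h3 := ZF2_KK a b c d e f
    have h4 := Z3_KK a b c d e f
    unfold Bad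
    tauto
  · rintro a b c d e f ⟨h1, h2⟩ h3
    apply h2
    unfold Bad
    tauto
  · rintro a b c d e f ⟨h0, h⟩ (h' | h' | h' | h')
    · obtain ⟨z1, z2, z3, z4, z5, z6⟩ := h
      obtain ⟨h2, rfl, rfl, ⟨hb, rfl, hbe⟩ | ⟨rfl, rfl, rfl, he⟩⟩ := h'
      · apply hb
        have : b ^ 2 = 0 := by linear_combination -z1
        exact pow_eq_zero_iff (two_ne_zero) |>.1 this
      · apply he
        have : e ^ 2 = 0 := by linear_combination -z6
        exact pow_eq_zero_iff (two_ne_zero) |>.1 this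
    · exact ZC_ZF1 a b c d e f h h'
    · obtain ⟨z1, z2, z3, z4, z5, z6⟩ := h
      obtain ⟨rfl, rfl, rfl, hf, r1, hirr⟩ := h'
      have hc : c = 0 := by
        have : c ^ 2 = 0 := by linear_combination -z3
        exact pow_eq_zero_iff (two_ne_zero) |>.1 this
      subst hc
      apply hirr 0
      ring
    · obtain ⟨z1, z2, z3, z4, z5, z6⟩ := h
      obtain ⟨rfl, rfl, hc, rfl, rfl, rfl, -⟩ := h'
      apply hc
      have : c ^ 2 = 0 := by linear_combination -z3
      exact pow_eq_zero_iff (two_ne_zero) |>.1 this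
  · rintro a b c d e f ⟨h2, ha, hf, h⟩ (h' | h' | h')
    · exact h'.1 ha
    · exact h'.2.2.2.1 hf
    · obtain ⟨-, hb, hc, -, he, -⟩ := h'
      rcases h with h | h
      · exact h.1 hb
      · exact hc h.2.1
  · rintro a b c d e f h (h' | h')
    · exact h.1 h'.1
    · exact h.1 h'.1
  · rintro a b c d e f h h'
    exact h.2.2.2.1 h'.2.2.2.2.2.1

theorem ZC_count [Fintype F] : (un (F := F) fun a b c d e f => KK a b c d e f ∧ ZC a b c d e f).ncard + 1
    = Nat.card F ^ 3 := by
  obtain ⟨n, hn⟩ : ∃ n, n = ({x : F | x ≠ 0}).ncard := ⟨_, rfl⟩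
  have hq := ncard_nz (F := F)
  have hu : (Set.univ : Set F).ncard = Nat.card F := Set.ncard_univ _
  rw [← hn] at hq
  obtain ⟨S, hS⟩ : ∃ S, S = (un (F := F) fun a b c d e f => KK a b c d e f ∧ ZC a b c d e f) := ⟨_, rfl⟩
  rw [← hS]
  have hm : ∀ a b c d e f, ((a, b, c, d, e, f) : Tup F) ∈ S ↔ KK a b c d e f ∧ ZC a b c d e f := by
    intro a b c d e f; rw [hS]; rfl
  have s1 := ncard_split (F := F) S (fun p => p.1 ≠ 0)
  have c1 : {p : Tup F | p ∈ S ∧ p.1 ≠ 0}.ncard = n * Nat.card F ^ 2 := by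
    rw [ncard_param (U := ({x : F | x ≠ 0} ×ˢ (Set.univ : Set F) ×ˢ (Set.univ : Set F)))
      (fun u => (u.1, u.2.1, u.2.2, u.2.1 ^ 2 / u.1 - u.2.2, u.2.1 * u.2.2 / u.1, u.2.2 ^ 2 / u.1))
      (fun p => (p.1, p.2.1, p.2.2.1))]
    · simp only [Set.ncard_prod, hu, ← hn]; ring
    · rintro ⟨a, b, c⟩ ⟨ha, -⟩
      have ha' : a ≠ 0 := ha
      refine ⟨(hm _ _ _ _ _ _).2 ⟨⟨fun h => ha' h.1, ?_⟩, ?_⟩, ha'⟩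
      · simp only
        field_simp
        ring
      · refine ⟨?_, ?_, ?_, ?_, ?_, ?_⟩ <;> simp only <;> field_simp <;> ring
    · rintro ⟨a, b, c, d, e, f⟩ ⟨-, ha⟩
      exact ⟨ha, by simp⟩
    · rintro ⟨a, b, c⟩ -
      rfl
    · rintro ⟨a, b, c, d, e, f⟩ ⟨h, ha⟩
      obtain ⟨-, z1, z2, z3, z4, z5, z6⟩ := (hm _ _ _ _ _ _).1 h
      simp only [ne_eq] at ha
      simp only [Prod.mk.injEq, true_and]
      refine ⟨?_, ?_, ?_⟩
      · field_simp
        linear_combination -z1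
      · field_simp
        linear_combination -z2
      · field_simp
        linear_combination -z3
  have hz : ∀ a b c d e f : F, ((a, b, c, d, e, f) : Tup F) ∈ S → a = 0 → b = 0 ∧ c = 0 ∧ d * f = e ^ 2 := by
    intro a b c d e f h ha
    obtain ⟨-, z1, z2, z3, z4, z5, z6⟩ := (hm _ _ _ _ _ _).1 h
    subst ha
    have hb : b = 0 := by
      have : b ^ 2 = 0 := by linear_combination -z1
      exact pow_eq_zero_iff (two_ne_zero) |>.1 this
    have hc : c = 0 := by
      have : c ^ 2 = 0 := by linear_combination -z3
      exact pow_eq_zero_iff (two_ne_zero) |>.1 this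
    subst hb hc
    exact ⟨rfl, rfl, by linear_combination z6⟩
  have s2 := ncard_split (F := F) {p : Tup F | p ∈ S ∧ ¬ (p.1 ≠ 0)} (fun p => p.2.2.2.1 ≠ 0)
  have c2 : {p : Tup F | p ∈ {p : Tup F | p ∈ S ∧ ¬ (p.1 ≠ 0)} ∧ p.2.2.2.1 ≠ 0}.ncard = n * Nat.card F := by
    rw [ncard_param (U := ({x : F | x ≠ 0} ×ˢ (Set.univ : Set F)))
      (fun u => (0, 0, 0, u.1, u.2, u.2 ^ 2 / u.1))
      (fun p => (p.2.2.2.1, p.2.2.2.2.1))]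
    · simp only [Set.ncard_prod, hu, ← hn]
    · rintro ⟨d, e⟩ ⟨hd, -⟩
      have hd' : d ≠ 0 := hd
      refine ⟨⟨(hm _ _ _ _ _ _).2 ⟨⟨fun h => hd' h.2.2.2.1, by ring⟩, ?_⟩, by simp⟩, hd'⟩
      refine ⟨?_, ?_, ?_, ?_, ?_, ?_⟩ <;> simp only <;> field_simp <;> ring
    · rintro ⟨a, b, c, d, e, f⟩ ⟨-, ha⟩
      exact ⟨ha, by simp⟩
    · rintro ⟨a, b⟩ -
      rfl
    · rintro ⟨a, b, c, d, e, f⟩ ⟨⟨h, ha⟩, hd⟩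
      simp only [ne_eq, not_not] at ha hd
      obtain ⟨hb, hc, hf⟩ := hz _ _ _ _ _ _ h ha
      simp only [Prod.mk.injEq, true_and]
      refine ⟨ha.symm, hb.symm, hc.symm, ?_⟩
      field_simp
      linear_combination -hf
  have c3 : {p : Tup F | p ∈ {p : Tup F | p ∈ S ∧ ¬ (p.1 ≠ 0)} ∧ ¬ (p.2.2.2.1 ≠ 0)}.ncard = n := by
    rw [ncard_param (U := {x : F | x ≠ 0})
      (fun u => (0, 0, 0, 0, 0, u))
      (fun p => (p.2.2.2.2.2)), ← hn]
    · intro f hf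
      have hf' : f ≠ 0 := hf
      refine ⟨⟨(hm _ _ _ _ _ _).2 ⟨⟨fun h => hf' h.2.2.2.2.2, by ring⟩, ?_⟩, by simp⟩, by simp⟩
      refine ⟨?_, ?_, ?_, ?_, ?_, ?_⟩ <;> simp
    · rintro ⟨a, b, c, d, e, f⟩ ⟨⟨h, ha⟩, hd⟩ hf
      simp only [ne_eq, not_not] at ha hd
      simp only at hf
      obtain ⟨hb, hc, he⟩ := hz _ _ _ _ _ _ h ha
      have := ((hm _ _ _ _ _ _).1 h).1.1
      rw [hd, zero_mul] at he
      exact this ⟨ha, hb, hc, hd, pow_eq_zero_iff (two_ne_zero) |>.1 he.symm, hf⟩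
    · intro f _
      rfl
    · rintro ⟨a, b, c, d, e, f⟩ ⟨⟨h, ha⟩, hd⟩
      simp only [ne_eq, not_not] at ha hd
      obtain ⟨hb, hc, he⟩ := hz _ _ _ _ _ _ h ha
      rw [hd, zero_mul] at he
      have he' := pow_eq_zero_iff (two_ne_zero) |>.1 he.symm
      simp [ha, hb, hc, hd, he']
  rw [s1, c1, s2, c2, c3, ← hq]
  ring

theorem ZT_count [Fintype F] (h2 : (2 : F) = 0) :
    (un (F := F) ZT).ncard = ({x : F | x ≠ 0}).ncard * (Nat.card F + 1) := by
  obtain ⟨n, hn⟩ : ∃ n, n = ({x : F | x ≠ 0}).ncard := ⟨_, rfl⟩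
  have hu : (Set.univ : Set F).ncard = Nat.card F := Set.ncard_univ _
  rw [← hn]
  have s1 := ncard_split (F := F) (un (F := F) ZT) (fun p => p.2.1 ≠ 0)
  have c1 : {p : Tup F | p ∈ un (F := F) ZT ∧ p.2.1 ≠ 0}.ncard = n * Nat.card F := by
    rw [ncard_param (U := ({x : F | x ≠ 0} ×ˢ (Set.univ : Set F)))
      (fun u => (0, u.1, u.2, u.2, u.2 ^ 2 / u.1, 0))
      (fun p => (p.2.1, p.2.2.1))]
    · simp only [Set.ncard_prod, hu, ← hn]
    · rintro ⟨b, c⟩ ⟨hb, -⟩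
      have hb' : b ≠ 0 := hb
      refine ⟨⟨h2, rfl, rfl, Or.inl ⟨hb', rfl, ?_⟩⟩, hb'⟩
      simp only
      field_simp
    · rintro ⟨a, b, c, d, e, f⟩ ⟨-, hb⟩
      exact ⟨hb, by simp⟩
    · rintro ⟨b, c⟩ -
      rfl
    · rintro ⟨a, b, c, d, e, f⟩ ⟨⟨-, ha, hf, h⟩, hb⟩
      simp only at ha hf hb h
      rcases h with h | h
      · obtain ⟨-, hd, he⟩ := h
        simp only [Prod.mk.injEq, true_and]
        refine ⟨ha.symm, hd.symm, ?_, hf.symm⟩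
        field_simp
        linear_combination -he
      · exact absurd h.1 hb
  have c2 : {p : Tup F | p ∈ un (F := F) ZT ∧ ¬ (p.2.1 ≠ 0)}.ncard = n := by
    rw [ncard_param (U := {x : F | x ≠ 0})
      (fun u => (0, 0, 0, 0, u, 0))
      (fun p => (p.2.2.2.2.1)), ← hn]
    · intro e he
      exact ⟨⟨h2, rfl, rfl, Or.inr ⟨rfl, rfl, rfl, he⟩⟩, by simp⟩
    · rintro ⟨a, b, c, d, e, f⟩ ⟨⟨-, ha, hf, h⟩, hb⟩
      rcases h with h | h
      · exact absurd h.1 hb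
      · exact h.2.2.2
    · intro f _
      rfl
    · rintro ⟨a, b, c, d, e, f⟩ ⟨⟨-, ha, hf, h⟩, hb⟩
      rcases h with h | h
      · exact absurd h.1 hb
      · simp only at ha hf h
        simp [ha, hf, h]
  rw [s1, c1, c2]
  ring

theorem ZT_count' [Fintype F] (h2 : (2 : F) ≠ 0) : (un (F := F) ZT).ncard = 0 := by
  rw [Set.ncard_eq_zero]
  ext p
  simp only [Set.mem_empty_iff_false, iff_false]
  rintro ⟨h, -⟩
  exact h2 h

theorem Z3_count [Fintype F] (h : ∀ T : F, T ^ 2 + T + 1 = 0 → T = 1) :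
    (un (F := F) Z3).ncard = ({x : F | x ≠ 0}).ncard := by
  rw [ncard_param (U := {x : F | x ≠ 0})
      (fun u => (0, 0, u, 0, 0, 0))
      (fun p => (p.2.2.1))]
  · intro e he
    exact ⟨rfl, rfl, he, rfl, rfl, rfl, h⟩
  · rintro ⟨a, b, c, d, e, f⟩ h
    exact h.2.2.1
  · intro f _
    rfl
  · rintro ⟨a, b, c, d, e, f⟩ ⟨ha, hb, -, hd, he, hf, -⟩
    simp only at ha hb hd he hf
    simp [ha, hb, hd, he, hf]

theorem Z3_count' [Fintype F] (w : F) (hw : w ^ 2 + w + 1 = 0) (hw1 : w ≠ 1) : (un (F := F) Z3).ncard = 0 := by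
  rw [Set.ncard_eq_zero]
  ext p
  simp only [Set.mem_empty_iff_false, iff_false]
  intro h
  exact hw1 (h.2.2.2.2.2.2 w hw)

def Irr : Set (F × F) := {u | ∀ T : F, T ^ 2 - u.1 * T + u.2 ≠ 0}

def Irr3 : Set (F × F) := {u | u.1 ^ 2 = 3 * u.2 ∧ ∀ T : F, T ^ 2 - u.1 * T + u.2 ≠ 0}

theorem ZF1_count [Fintype F] : (un (F := F) ZF1).ncard = ({x : F | x ≠ 0}).ncard * (Irr (F := F)).ncard := by
  rw [← Set.ncard_prod, ncard_param (U := {x : F | x ≠ 0} ×ˢ Irr (F := F))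
      (fun u => (u.1, u.2.1, u.2.2 / u.1, 3 * (u.2.1 ^ 2 - 3 * u.2.2) / u.1,
        u.2.1 * (u.2.1 ^ 2 - 3 * u.2.2) / u.1 ^ 2, (u.2.1 ^ 2 - 3 * u.2.2) ^ 2 / u.1 ^ 3))
      (fun p => (p.1, p.2.1, p.1 * p.2.2.1))]
  · rintro ⟨a, b, n⟩ ⟨ha, hi⟩
    have ha' : a ≠ 0 := ha
    have hn : a * (n / a) = n := by field_simp
    refine ⟨ha', ?_, ?_, ?_, ?_⟩
    · intro T
      simp only
      rw [hn]
      exact hi T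
    all_goals
      simp only
      rw [mul_assoc, hn]
      field_simp
  · rintro ⟨a, b, c, d, e, f⟩ ⟨ha, hi, -⟩
    exact ⟨ha, hi⟩
  · rintro ⟨a, b, n⟩ ⟨ha, hi⟩
    have ha' : a ≠ 0 := ha
    have hn : a * (n / a) = n := by field_simp
    simp [hn]
  · rintro ⟨a, b, c, d, e, f⟩ ⟨ha, hi, r1, r2, r3⟩
    simp only at ha r1 r2 r3
    simp only [Prod.mk.injEq, true_and]
    refine ⟨?_, ?_, ?_, ?_⟩
    · field_simp
    · field_simp
      linear_combination -r1
    · field_simp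
      linear_combination -r2
    · field_simp
      linear_combination -r3

theorem ZF2_count [Fintype F] : (un (F := F) ZF2).ncard = ({x : F | x ≠ 0}).ncard * (Irr3 (F := F)).ncard := by
  rw [← Set.ncard_prod, ncard_param (U := {x : F | x ≠ 0} ×ˢ Irr3 (F := F))
      (fun u => (0, 0, u.2.2 / u.1, 0, u.2.1, u.1))
      (fun p => (p.2.2.2.2.2, p.2.2.2.2.1, p.2.2.1 * p.2.2.2.2.2))]
  · rintro ⟨f, e, n⟩ ⟨hf, h3, hi⟩
    have hf' : f ≠ 0 := hf
    have hn : n / f * f = n := by field_simp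
    refine ⟨rfl, rfl, rfl, hf', ?_, ?_⟩
    · simp only
      rw [hn]
      exact h3
    · intro T
      simp only
      rw [hn]
      exact hi T
  · rintro ⟨a, b, c, d, e, f⟩ ⟨-, -, -, hf, h3, hi⟩
    exact ⟨hf, h3, hi⟩
  · rintro ⟨f, e, n⟩ ⟨hf, h3, hi⟩
    have hf' : f ≠ 0 := hf
    have hn : n / f * f = n := by field_simp
    simp [hn]
  · rintro ⟨a, b, c, d, e, f⟩ ⟨ha, hb, hd, hf, -⟩
    simp only at ha hb hd hf
    simp [ha, hb, hd]
    field_simp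

end

end TC


namespace TC

open Polynomial

section
variable {F : Type} [Field F]

/-- elementary symmetric functions of an unordered pair -/
def sy : Sym2 F → F × F := Sym2.lift ⟨fun x y => (x + y, x * y), fun x y =>
  Prod.ext (add_comm x y) (mul_comm x y)⟩

theorem sy_inj : Function.Injective (sy (F := F)) := by
  intro u v
  induction u using Sym2.ind with
  | _ x y =>
  induction v using Sym2.ind with
  | _ x' y' =>
  intro h
  simp only [sy, Sym2.lift_mk, Prod.mk.injEq] at h
  obtain ⟨h1, h2⟩ := h
  rw [Sym2.eq_iff]
  have : (x - x') * (x - y') = 0 := by linear_combination x * h1 - h2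
  rcases mul_eq_zero.1 this with h | h
  · left
    exact ⟨by linear_combination h, by linear_combination h1 - h⟩
  · right
    exact ⟨by linear_combination h, by linear_combination h1 - h⟩

theorem Irr_count [Fintype F] : 2 * (Irr (F := F)).ncard + Nat.card F = Nat.card F ^ 2 := by
  have h1 : (Irr (F := F))ᶜ = sy '' Set.univ := by
    ext ⟨m, n⟩
    simp only [Irr, Set.mem_compl_iff, Set.mem_ofPred_eq, not_forall, not_not, Set.image_univ, Set.mem_range]
    constructor
    · rintro ⟨T, hT⟩
      refine ⟨s(T, m - T), ?_⟩
      simp only [sy, Sym2.lift_mk, Prod.mk.injEq]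
      exact ⟨by ring, by linear_combination -hT⟩
    · rintro ⟨u, hu⟩
      induction u using Sym2.ind with
      | _ x y =>
      simp only [sy, Sym2.lift_mk, Prod.mk.injEq] at hu
      obtain ⟨rfl, rfl⟩ := hu
      exact ⟨x, by ring⟩
  have h2 := Set.ncard_add_ncard_compl (Irr (F := F))
  classical
  rw [h1, Set.ncard_image_of_injective _ sy_inj, Set.ncard_univ, Nat.card_prod,
    Nat.card_eq_fintype_card (α := Sym2 F), Sym2.card, ← Nat.card_eq_fintype_card] at h2
  obtain ⟨q, hq⟩ : ∃ q, q = Nat.card F := ⟨_, rfl⟩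
  rw [← hq] at h2 ⊢
  have h3 := Nat.triangle_succ q
  have h4 : (q + 1).choose 2 * 2 = (q + 1) * q := by
    rw [Nat.choose_two_right]
    exact Nat.div_mul_cancel (by
      simpa [mul_comm] using (Nat.even_mul_succ_self q).two_dvd)
  nlinarith

theorem Irr3_zero [Fintype F] (h3 : (3 : F) ≠ 0) (w : F) (hw : w ^ 2 + w + 1 = 0) : (Irr3 (F := F)).ncard = 0 := by
  rw [Set.ncard_eq_zero]
  ext ⟨m, n⟩
  simp only [Set.mem_empty_iff_false, iff_false]
  rintro ⟨h, hi⟩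
  simp only at h hi
  have hw1 : 1 - w ≠ 0 := by
    intro h
    have : w = 1 := by linear_combination -h
    subst this
    apply h3
    linear_combination hw
  apply hi (m / (1 - w))
  field_simp
  apply mul_left_cancel₀ h3
  linear_combination (-(1 - w) ^ 2) * h + m ^ 2 * hw

theorem Irr3_two [Fintype F] (h3 : (3 : F) ≠ 0) (hw : ∀ w : F, w ^ 2 + w + 1 ≠ 0) :
    (Irr3 (F := F)).ncard = ({x : F | x ≠ 0}).ncard := by
  rw [ncard_param (U := {x : F | x ≠ 0}) (fun m => (m, m ^ 2 / 3)) (fun u => u.1)]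
  · intro m hm
    have hm' : m ≠ 0 := hm
    refine ⟨by simp only; field_simp, ?_⟩
    intro T hT
    simp only at hT
    have hT0 : T ≠ 0 := by
      rintro rfl
      field_simp at hT
      apply hm'
      have : m ^ 2 = 0 := by linear_combination hT
      exact pow_eq_zero_iff (two_ne_zero) |>.1 this
    apply hw (1 - m / T)
    field_simp at hT ⊢
    linear_combination hT
  · rintro ⟨m, n⟩ ⟨h, hi⟩ hm
    simp only at h hi hm
    subst hm
    apply hi 0
    have : 3 * n = 0 := by linear_combination -h
    have := (mul_eq_zero.1 this).resolve_left h3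
    rw [this]; ring
  · intro m _; rfl
  · rintro ⟨m, n⟩ ⟨h, hi⟩
    simp only at h
    simp only [Prod.mk.injEq, true_and]
    field_simp
    exact h

theorem Irr3_three [Fintype F] (h3 : (3 : F) = 0) :
    2 * (Irr3 (F := F)).ncard + 1 = Nat.card F := by
  classical
  have h2 : (2 : F) ≠ 0 := by
    intro h2
    exact one_ne_zero (α := F) (by linear_combination h3 - h2)
  have hchar : ringChar F ≠ 2 := by
    intro h
    apply h2
    have := ringChar.Nat.cast_ringChar (R := F)
    rw [h] at this
    exact_mod_cast this
  rw [ncard_param (U := {x : F | ¬ IsSquare x}) (fun m => (0, -m)) (fun u => -u.2)]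
  · have hs := quadraticChar_sum_zero hchar
    have : ∀ x : F, quadraticChar F x = 1 - 2 * (if ¬ IsSquare x then 1 else 0) - (if x = 0 then 1 else 0) := by
      intro x
      by_cases hx : x = 0
      · subst hx; simp
      · by_cases hsq : IsSquare x
        · rw [(quadraticChar_one_iff_isSquare hx).2 hsq]; simp [hx, hsq]
        · rw [quadraticChar_neg_one_iff_not_isSquare.2 hsq]; simp [hx, hsq]
    simp only [this] at hs
    rw [Finset.sum_sub_distrib, Finset.sum_sub_distrib, ← Finset.mul_sum, Finset.sum_boole,
      Finset.sum_ite_eq'] at hs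
    simp only [Finset.sum_const, Finset.card_univ, Finset.mem_univ, if_true, nsmul_eq_mul, mul_one] at hs
    have hset : {x : F | ¬ IsSquare x} = ((Finset.univ.filter (fun x : F => ¬ IsSquare x) : Finset F) : Set F) := by
      ext; simp
    rw [hset, Set.ncard_coe_finset, Nat.card_eq_fintype_card]
    omega
  · intro m hm
    refine ⟨by simp [h3], ?_⟩
    intro T hT
    apply hm
    exact ⟨T, by simp only at hT; linear_combination -hT⟩
  · rintro ⟨m, n⟩ ⟨h, hi⟩ ⟨T, hT⟩
    simp only at h hi hT
    rw [h3, zero_mul] at h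
    have := pow_eq_zero_iff (two_ne_zero) |>.1 h
    subst this
    exact hi T (by linear_combination -hT)
  · intro m _; simp
  · rintro ⟨m, n⟩ ⟨h, hi⟩
    simp only at h
    rw [h3, zero_mul] at h
    have := pow_eq_zero_iff (two_ne_zero) |>.1 h
    simp [this]

theorem prime_char [Fintype F] (p : ℕ) [hp : Fact p.Prime] (h : p ∣ Fintype.card F) : (p : F) = 0 := by
  obtain ⟨x, hx⟩ := exists_prime_addOrderOf_dvd_card (G := F) p h
  have h1 := addOrderOf_nsmul_eq_zero x
  rw [hx, nsmul_eq_mul] at h1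
  refine (mul_eq_zero.1 h1).resolve_right ?_
  rintro rfl
  rw [addOrderOf_zero] at hx
  exact hp.out.one_lt.ne hx

theorem card_zero [Fintype F] : ((Fintype.card F : ℕ) : F) = 0 := by
  simp

theorem cube_root [Fintype F] (h : Fintype.card F % 3 = 1) : ∃ w : F, w ^ 2 + w + 1 = 0 ∧ w ≠ 1 := by
  classical
  have : Fact (Nat.Prime 3) := ⟨Nat.prime_three⟩
  have hd : 3 ∣ Fintype.card Fˣ := by
    rw [Fintype.card_units]; omega
  obtain ⟨x, hx⟩ := exists_prime_orderOf_dvd_card 3 hd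
  have h1 := pow_orderOf_eq_one x
  rw [hx] at h1
  have hx1 : (x : F) ≠ 1 := by
    intro h
    have : x = 1 := Units.ext h
    rw [this, orderOf_one] at hx
    omega
  refine ⟨x, ?_, hx1⟩
  have h2 : (x : F) ^ 3 = 1 := by
    rw [← Units.val_pow_eq_pow_val, h1, Units.val_one]
  have : ((x : F) - 1) * ((x : F) ^ 2 + x + 1) = 0 := by linear_combination h2
  exact (mul_eq_zero.1 this).resolve_left (sub_ne_zero.2 hx1)

theorem no_cube_root [Fintype F] (h : Fintype.card F % 3 = 2) (w : F) : w ^ 2 + w + 1 ≠ 0 := by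
  intro hw
  classical
  have hw0 : w ≠ 0 := by rintro rfl; simp at hw
  have hw3 : w ^ 3 = 1 := by linear_combination (w - 1) * hw
  have hq := FiniteField.pow_card_sub_one_eq_one w hw0
  obtain ⟨k, hk⟩ : ∃ k, Fintype.card F - 1 = 3 * k + 1 := ⟨Fintype.card F / 3, by omega⟩
  rw [hk, pow_succ, pow_mul, hw3, one_pow, one_mul] at hq
  subst hq
  have h3 : (3 : F) = 0 := by linear_combination hw
  have hc := card_zero (F := F)
  obtain ⟨j, hj⟩ : ∃ j, Fintype.card F = 3 * j + 2 := ⟨Fintype.card F / 3, by omega⟩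
  rw [hj] at hc
  push_cast at hc
  exact one_ne_zero (α := F) (by linear_combination (1 + (j : F)) * h3 - hc)

theorem three_ne [Fintype F] (h : Fintype.card F % 3 ≠ 0) : (3 : F) ≠ 0 := by
  intro h3
  have hc := card_zero (F := F)
  obtain ⟨j, hj⟩ : ∃ j, Fintype.card F = 3 * j + Fintype.card F % 3 := ⟨Fintype.card F / 3, by omega⟩
  have : Fintype.card F % 3 = 1 ∨ Fintype.card F % 3 = 2 := by omega
  rw [hj] at hc
  rcases this with h1 | h1 <;> rw [h1] at hc <;> push_cast at hc
  · exact one_ne_zero (α := F) (by linear_combination hc - (j : F) * h3)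
  · exact one_ne_zero (α := F) (by linear_combination (1 + (j : F)) * h3 - hc)

theorem two_ne [Fintype F] (h : Fintype.card F % 2 = 1) : (2 : F) ≠ 0 := by
  intro h2
  have hc := card_zero (F := F)
  obtain ⟨j, hj⟩ : ∃ j, Fintype.card F = 2 * j + 1 := ⟨Fintype.card F / 2, by omega⟩
  rw [hj] at hc
  push_cast at hc
  exact one_ne_zero (α := F) (by linear_combination hc - (j : F) * h2)

theorem final_eq [Fintype F] (hq : 23 ≤ Fintype.card F) (t z m : ℚ)
    (ht : ((un (F := F) ZT).ncard : ℚ) = ((Fintype.card F : ℚ) - 1) * t)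
    (hz : ((un (F := F) Z3).ncard : ℚ) = ((Fintype.card F : ℚ) - 1) * z)
    (hm : ((Irr3 (F := F)).ncard : ℚ) = m) :
    ((muSet F).ncard : ℚ) = ((Fintype.card F : ℚ) ^ 2 + Fintype.card F + 1) * (Fintype.card F : ℚ) ^ 2
      - t - ((Fintype.card F : ℚ) ^ 2 - Fintype.card F) / 2 - m - z := by
  have h := congrArg (Nat.cast (R := ℚ)) (total hq)
  have hn := congrArg (Nat.cast (R := ℚ)) (ncard_nz (F := F))
  have hK := congrArg (Nat.cast (R := ℚ)) (KK_count (F := F))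
  have hC := congrArg (Nat.cast (R := ℚ)) (ZC_count (F := F))
  have hI := congrArg (Nat.cast (R := ℚ)) (Irr_count (F := F))
  rw [ZF1_count, ZF2_count] at h
  rw [Nat.card_eq_fintype_card] at hn hK hC hI
  push_cast at h hn hK hC hI
  have hq' : (23 : ℚ) ≤ Fintype.card F := by exact_mod_cast hq
  have hn' : (({x : F | x ≠ 0}).ncard : ℚ) = (Fintype.card F : ℚ) - 1 := by linear_combination hn
  rw [hn', ht, hz, hm] at h
  have hq1 : (Fintype.card F : ℚ) - 1 ≠ 0 := by linarith
  apply mul_left_cancel₀ hq1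
  linear_combination h + hK - hC - ((Fintype.card F : ℚ) - 1) / 2 * hI

end

end TC

/-- Theorem (μ_q formula): for a prime power `q ≥ 23` (realized as the cardinality of
the finite field `F`), the number `μ_q` of lines of `P³(F_q)` that are not real chords
and lie in at least one 3-plane is given by the stated formulas depending on
`q mod 6`. -/
theorem mu_q_formula [Fintype F] (q : ℕ) (hq : q = Fintype.card F) (h23 : 23 ≤ q) :
    (q % 6 = 1 → ((muSet F).ncard : ℚ) = q ^ 4 + q ^ 3 + q ^ 2 / 2 + q / 2) ∧
    (q % 6 = 2 → ((muSet F).ncard : ℚ) = q ^ 4 + q ^ 3 + q ^ 2 / 2 - 3 * q / 2 - 1) ∧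
    (q % 6 = 3 → ((muSet F).ncard : ℚ) = q ^ 4 + q ^ 3 + q ^ 2 / 2 - 1 / 2) ∧
    (q % 6 = 4 → ((muSet F).ncard : ℚ) = q ^ 4 + q ^ 3 + q ^ 2 / 2 - q / 2 - 1) ∧
    (q % 6 = 5 → ((muSet F).ncard : ℚ) = q ^ 4 + q ^ 3 + q ^ 2 / 2 - q / 2) := by
  subst hq
  have hn : (({x : F | x ≠ 0}).ncard : ℚ) = (Fintype.card F : ℚ) - 1 := by
    have := congrArg (Nat.cast (R := ℚ)) (TC.ncard_nz (F := F))
    rw [Nat.card_eq_fintype_card] at this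
    push_cast at this
    linear_combination this
  have T2 : (2 : F) = 0 → ((TC.un (F := F) TC.ZT).ncard : ℚ) =
      ((Fintype.card F : ℚ) - 1) * ((Fintype.card F : ℚ) + 1) := by
    intro h
    rw [TC.ZT_count h, Nat.card_eq_fintype_card]
    push_cast
    rw [hn]
  have T2' : (2 : F) ≠ 0 → ((TC.un (F := F) TC.ZT).ncard : ℚ) = ((Fintype.card F : ℚ) - 1) * 0 := by
    intro h
    rw [TC.ZT_count' h]
    simp
  have Z1 : (∀ T : F, T ^ 2 + T + 1 = 0 → T = 1) → ((TC.un (F := F) TC.Z3).ncard : ℚ) =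
      ((Fintype.card F : ℚ) - 1) * 1 := by
    intro h
    rw [TC.Z3_count h, hn, mul_one]
  have Z0 : (∃ w : F, w ^ 2 + w + 1 = 0 ∧ w ≠ 1) → ((TC.un (F := F) TC.Z3).ncard : ℚ) =
      ((Fintype.card F : ℚ) - 1) * 0 := by
    rintro ⟨w, h1, h2⟩
    rw [TC.Z3_count' w h1 h2]
    simp
  have two0 : Fintype.card F % 2 = 0 → (2 : F) = 0 := by
    intro h
    have : Fact (Nat.Prime 2) := ⟨Nat.prime_two⟩
    exact_mod_cast TC.prime_char (F := F) 2 (by omega)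
  have three0 : Fintype.card F % 3 = 0 → (3 : F) = 0 := by
    intro h
    have : Fact (Nat.Prime 3) := ⟨Nat.prime_three⟩
    exact_mod_cast TC.prime_char (F := F) 3 (by omega)
  have M0 : Fintype.card F % 3 = 1 → ((TC.Irr3 (F := F)).ncard : ℚ) = 0 := by
    intro h
    obtain ⟨w, h1, h2⟩ := TC.cube_root (F := F) h
    rw [TC.Irr3_zero (TC.three_ne (by omega)) w h1]
    simp
  have M2 : Fintype.card F % 3 = 2 → ((TC.Irr3 (F := F)).ncard : ℚ) = (Fintype.card F : ℚ) - 1 := by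
    intro h
    rw [TC.Irr3_two (TC.three_ne (by omega)) (TC.no_cube_root h), hn]
  have Z2 : Fintype.card F % 3 = 2 → ∀ T : F, T ^ 2 + T + 1 = 0 → T = 1 :=
    fun h T hT => absurd hT (TC.no_cube_root h T)
  refine ⟨?_, ?_, ?_, ?_, ?_⟩ <;> intro h
  · rw [TC.final_eq h23 _ _ _ (T2' (TC.two_ne (by omega))) (Z0 (TC.cube_root (by omega))) (M0 (by omega))]
    ring
  · rw [TC.final_eq h23 _ _ _ (T2 (two0 (by omega))) (Z1 (Z2 (by omega))) (M2 (by omega))]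
    ring
  · have h3 := three0 (by omega)
    have hM := congrArg (Nat.cast (R := ℚ)) (TC.Irr3_three h3)
    rw [Nat.card_eq_fintype_card] at hM
    push_cast at hM
    have hz : ∀ T : F, T ^ 2 + T + 1 = 0 → T = 1 := by
      intro T hT
      have : (T - 1) ^ 2 = 0 := by linear_combination hT - T * h3
      exact sub_eq_zero.1 (pow_eq_zero_iff (two_ne_zero) |>.1 this)
    rw [TC.final_eq h23 _ _ _ (T2' (TC.two_ne (by omega))) (Z1 hz) rfl]
    linear_combination -hM / 2
  · rw [TC.final_eq h23 _ _ _ (T2 (two0 (by omega))) (Z0 (TC.cube_root (by omega))) (M0 (by omega))]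
    ring
  · rw [TC.final_eq h23 _ _ _ (T2' (TC.two_ne (by omega))) (Z1 (Z2 (by omega))) (M2 (by omega))]
    ring

end
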